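/- Let Γ be a group, K an algebraically closed field of characteristic 0, and H a reductive linear algebraic group over K with identity component H^0. Suppose σ, σ' : Γ → H(K) are two group homomorphisms such that the Zariski closures of their images are reductive, and such that for every n ≥ 1, every n-tuple (γ_1,...,γ_n) ∈ Γ^n, and every regular function f on H^n invariant under simultaneous conjugation by H^0, one has f(σ(γ_1),...,σ(γ_n)) = f(σ'(γ_1),...,σ'(γ_n)). Then there exists h ∈ H^0(K) with σ'(γ) = h σ(γ) h^{-1} for all γ ∈ Γ. -/

import Mathlib

/-!
**STATEMENT 16.**  Let `Γ` be a group, `K` an algebraically closed field of characteristic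
`0`, and `H` a reductive linear algebraic group over `K` with identity component `H⁰`.
Suppose `σ, σ' : Γ → H(K)` are two group homomorphisms such that the Zariski closures of their
images are reductive, and such that for every `n ≥ 1`, every `n`-tuple `(γ_1,…,γ_n) ∈ Γ^n`,
and every regular function `f` on `H^n` invariant under simultaneous conjugation by `H⁰`, one
has `f(σ(γ_1),…,σ(γ_n)) = f(σ'(γ_1),…,σ'(γ_n))`.  Then there exists `h ∈ H⁰(K)` with
`σ'(γ) = h σ(γ) h⁻¹` for all `γ ∈ Γ`.

Encoding: `H` is a Zariski-closed subgroup of `GL_N(K)`; regular functions on `H^n` are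
restrictions of polynomials in the matrix entries and the entries of the inverse matrices;
`H⁰` is the connected component of `1` in `H` for the Zariski topology (the topology generated
by the non-vanishing loci of regular functions); and, `K` being algebraically closed of
characteristic `0`, "the Zariski closure of the image is reductive" is taken in its
equivalent form: the natural module `K^N` is semisimple over the image (`NatSemisimpleOn`).
-/

open MvPolynomial Matrix

noncomputable def glCoords (K : Type) [Field K] (N : ℕ) {I : Type}
    (g : I → Matrix.GeneralLinearGroup (Fin N) K) :
    I × ((Fin N × Fin N) ⊕ (Fin N × Fin N)) → K := fun p =>
  Sum.elim (fun q => ((g p.1 : Matrix (Fin N) (Fin N) K)) q.1 q.2)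
    (fun q => (((g p.1)⁻¹ : Matrix (Fin N) (Fin N) K)) q.1 q.2) p.2

/-- `f` is a regular function on `G^I`. -/
def IsRegularOnPow (K : Type) [Field K] (N : ℕ)
    (G : Subgroup (Matrix.GeneralLinearGroup (Fin N) K)) {I : Type}
    (f : (I → G) → K) : Prop :=
  ∃ P : MvPolynomial (I × ((Fin N × Fin N) ⊕ (Fin N × Fin N))) K,
    ∀ g : I → G,
      f g = eval (glCoords K N fun i => (g i : Matrix.GeneralLinearGroup (Fin N) K)) P

/-- `G ≤ GL_N(K)` is Zariski closed. -/
def IsZarClosed (K : Type) [Field K] (N : ℕ)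
    (G : Subgroup (Matrix.GeneralLinearGroup (Fin N) K)) : Prop :=
  ∃ 𝒮 : Set (MvPolynomial (Unit × ((Fin N × Fin N) ⊕ (Fin N × Fin N))) K),
    ∀ g : Matrix.GeneralLinearGroup (Fin N) K,
      g ∈ G ↔ ∀ P ∈ 𝒮, eval (glCoords K N fun _ : Unit => g) P = 0

/-- The Zariski topology on (the points of) a subgroup `G ≤ GL_N(K)`: generated by the
non-vanishing loci of the regular functions. -/
def zarTop (K : Type) [Field K] (N : ℕ)
    (G : Subgroup (Matrix.GeneralLinearGroup (Fin N) K)) : TopologicalSpace G :=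
  TopologicalSpace.generateFrom
    {U | ∃ f : (Unit → G) → K, IsRegularOnPow K N G f ∧ U = {h | f (fun _ => h) ≠ 0}}

/-- The identity component `G⁰` of a subgroup `G ≤ GL_N(K)` : the connected component of `1`
for the Zariski topology. -/
def identityComponent (K : Type) [Field K] (N : ℕ)
    (G : Subgroup (Matrix.GeneralLinearGroup (Fin N) K)) : Set G :=
  @connectedComponent _ (zarTop K N G) 1

/-- The natural module `K^N` is semisimple over `S ⊆ GL_N(K)` (for a subgroup or its Zariski
closure, `K` algebraically closed of characteristic `0`, this is equivalent to reductivity of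
the Zariski closure). -/
def NatSemisimpleOn (K : Type) [Field K] (N : ℕ)
    (S : Set (Matrix.GeneralLinearGroup (Fin N) K)) : Prop :=
  ∀ W : Submodule K (Fin N → K),
    (∀ u ∈ S, ∀ v ∈ W, (u : Matrix (Fin N) (Fin N) K) *ᵥ v ∈ W) →
    ∃ W' : Submodule K (Fin N → K),
      (∀ u ∈ S, ∀ v ∈ W', (u : Matrix (Fin N) (Fin N) K) *ᵥ v ∈ W') ∧ IsCompl W W'

open LieModule LieAlgebra

section CasimirFamily

universe v

variable {K L : Type*} [Field K] [LieRing L] [LieAlgebra K L] [Module.Finite K L]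

/-- Dual families for a symmetric invariant form, which may be degenerate: modulo the kernel of
the form they are dual bases, and their sum of tensors is invariant. -/
theorem exists_casimir_family (τ : LinearMap.BilinForm K L) (hs : τ.IsSymm)
    (hτ : ∀ x y z : L, τ ⁅x, y⁆ z = - τ y ⁅x, z⁆) :
    ∃ (n : ℕ) (b b' : Fin n → L), (τ ≠ 0 → n ≠ 0) ∧ (∑ i, τ (b i) (b' i) = n) ∧
      ∀ (E : Type v) [AddCommGroup E] [Module K E] (B : L →ₗ[K] L →ₗ[K] E),
        (∀ x y, τ x = 0 → B x y = 0) → (∀ x y, τ y = 0 → B x y = 0) →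
        ∀ x : L, ∑ i, (B ⁅x, b i⁆ (b' i) + B (b i) ⁅x, b' i⁆) = 0 := by
  classical
  obtain ⟨P, hP⟩ := Submodule.exists_isCompl (LinearMap.ker τ)
  have hker : ∀ x, ∃ p : P, ∃ k, τ k = 0 ∧ x = p + k := by
    intro x
    have : x ∈ LinearMap.ker τ ⊔ P := hP.sup_eq_top ▸ Submodule.mem_top
    obtain ⟨k, hk, p, hp, rfl⟩ := Submodule.mem_sup.mp this
    exact ⟨⟨p, hp⟩, k, hk, add_comm _ _⟩
  have hsym : ∀ x y, τ x y = τ y x := fun x y => by simpa using hs.eq x y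
  set τP : LinearMap.BilinForm K P := τ.restrict P with hτP
  have hnd : τP.Nondegenerate := by
    have hl : ∀ p : P, (∀ q, τP p q = 0) → p = 0 := by
      intro p hp
      have : (p : L) ∈ LinearMap.ker τ ⊓ P := by
        refine ⟨?_, p.2⟩
        ext y
        obtain ⟨q, k, hk, rfl⟩ := hker y
        have h1 : τ p q = 0 := hp q
        simp [h1, hsym _ k, hk]
      rw [hP.inf_eq_bot] at this
      exact Subtype.ext (by simpa using this)
    refine ⟨hl, fun p hp => hl p fun q => ?_⟩
    exact (hsym _ _).trans (hp q)
  have hsP : τP.IsSymm := ⟨fun x y => hs.eq x y⟩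
  let v := Module.finBasis K P
  let v' := τP.dualBasis hnd v
  have hv : ∀ i j, τ (v i) (v' j) = if i = j then 1 else 0 := fun i j =>
    LinearMap.BilinForm.apply_dualBasis_right hnd hsP v i j
  refine ⟨_, fun i => v i, fun i => v' i, ?_, ?_, ?_⟩
  · intro h0 hn
    apply h0
    have : Subsingleton P := Module.finrank_zero_iff.mp hn
    ext x y
    obtain ⟨p, k, hk, rfl⟩ := hker x
    have : p = 0 := Subsingleton.elim _ _
    simp [this, hk]
  · simp [hv]
  · intro E _ _ B hB1 hB2 x
    have e1 : ∀ y : L, ∀ z, B y z = ∑ j, τ y (v' j) • B (v j) z := by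
      intro y z
      obtain ⟨p, k, hk, rfl⟩ := hker y
      have h1 : (p : L) = ∑ j, τ p (v' j) • (v j : L) := by
        conv_lhs => rw [← v.sum_repr p]
        simp only [Submodule.coe_sum, Submodule.coe_smul]
        refine Finset.sum_congr rfl fun j _ => ?_
        congr 1
        have : τ (p : L) (v' j) = τP (v' j) p := (hsym _ _)
        rw [this]
        conv_rhs => rw [← v.sum_repr p]
        simp only [map_sum, map_smul, smul_eq_mul]
        have : ∀ i, τP (v' j) (v i) = if i = j then 1 else 0 := fun i =>
          LinearMap.BilinForm.apply_dualBasis_left hnd v j i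
        simp [this]
      have h2 := hB1 k z hk
      simp only [map_add, LinearMap.add_apply, h2, add_zero, hk]
      conv_lhs => rw [h1]
      simp
    have e2 : ∀ y : L, ∀ z, B z y = ∑ j, τ y (v j) • B z (v' j) := by
      intro y z
      obtain ⟨p, k, hk, rfl⟩ := hker y
      have h1 : (p : L) = ∑ j, τ p (v j) • (v' j : L) := by
        conv_lhs => rw [← v'.sum_repr p]
        simp only [Submodule.coe_sum, Submodule.coe_smul]
        refine Finset.sum_congr rfl fun j _ => ?_
        congr 1
        exact LinearMap.BilinForm.dualBasis_repr_apply hnd v p j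
      have h2 := hB2 z k hk
      simp only [map_add, h2, add_zero, hk]
      conv_lhs => rw [h1]
      simp
    simp only [Finset.sum_add_distrib]
    have : ∑ i, B (v i : L) ⁅x, (v' i : L)⁆ = - ∑ i, B ⁅x, (v i : L)⁆ (v' i) := by
      simp_rw [fun i => e2 ⁅x, (v' i : L)⁆ (v i), fun i => e1 ⁅x, (v i : L)⁆ (v' i)]
      rw [Finset.sum_comm, ← Finset.sum_neg_distrib]
      refine Finset.sum_congr rfl fun i _ => ?_
      rw [← Finset.sum_neg_distrib]
      refine Finset.sum_congr rfl fun j _ => ?_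
      rw [← neg_smul, hτ, hsym (v' j : L)]
    rw [this, add_neg_cancel]

end CasimirFamily

/-- A form of reductivity: every ideal is perfect modulo a part on which the algebra acts
trivially, and the algebra is the sum of its centre and its derived algebra. -/
structure LieAlgebra.IsReductiveAlg (K L : Type*) [Field K] [LieRing L] [LieAlgebra K L] :
    Prop where
  lie_mem : ∀ (J : LieIdeal K L) (x y : L), y ∈ J → ⁅x, y⁆ ∈ ⁅J, J⁆
  center_sup : LieAlgebra.center K L ⊔ ⁅(⊤ : LieIdeal K L), (⊤ : LieIdeal K L)⁆ = ⊤

theorem exists_scalar_of_commute {K L M : Type*} [Field K] [IsAlgClosed K] [LieRing L]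
    [LieAlgebra K L] [AddCommGroup M] [Module K M] [LieRingModule L M]
    [LieModule K L M] [Module.Finite K M] [LieModule.IsIrreducible K L M]
    (f : Module.End K M) (hf : ∀ (x : L) (m : M), f ⁅x, m⁆ = ⁅x, f m⁆) :
    ∃ a : K, ∀ m, f m = a • m := by
  have := LieModule.nontrivial_of_isIrreducible K L M
  obtain ⟨a, ha⟩ := Module.End.exists_eigenvalue f
  refine ⟨a, ?_⟩
  let N : LieSubmodule K L M :=
    { f.eigenspace a with
      lie_mem := by
        intro x m hm
        simp only [AddSubsemigroup.mem_carrier, AddSubmonoid.mem_toSubsemigroup,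
          Submodule.mem_toAddSubmonoid, Module.End.mem_eigenspace_iff] at hm ⊢
        rw [hf, hm, lie_smul] }
  have hN : N = ⊤ := by
    refine (IsSimpleOrder.eq_bot_or_eq_top N).resolve_left fun h => ha ?_
    rw [eq_bot_iff]
    intro m hm
    have : m ∈ N := hm
    rw [h] at this
    simpa using this
  intro m
  have : m ∈ N := hN ▸ LieSubmodule.mem_top m
  exact Module.End.mem_eigenspace_iff.mp this

section Whitehead

universe v
variable {K L : Type*} [Field K] [CharZero K] [IsAlgClosed K] [LieRing L] [LieAlgebra K L]

/-- The radical of the trace form of an irreducible module acts trivially. -/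
theorem lie_eq_zero_of_traceForm_eq_zero (hL : IsReductiveAlg K L)
    {M : Type*} [AddCommGroup M] [Module K M] [LieRingModule L M]
    [LieModule K L M] [Module.Finite K M] [LieModule.IsIrreducible K L M]
    (J : LieIdeal K L) (hJ : ∀ x ∈ J, traceForm K L M x = 0) :
    ∀ x ∈ J, ∀ m : M, ⁅x, m⁆ = 0 := by
  have := LieModule.nontrivial_of_isIrreducible K L M
  have h1 : traceForm K J M = 0 := by
    ext x y
    have := LinearMap.congr_fun (hJ x x.2) (y : L)
    exact this
  have h2 := LieModule.isNilpotent_derivedSeries_of_traceForm_eq_zero h1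
  have h3 := LieModule.nontrivial_max_triv_of_isNilpotent K (derivedSeries K J 1) M
  have key : ∀ y ∈ ⁅J, J⁆, ∀ m : M, ⁅y, m⁆ = 0 := by
    let N : LieSubmodule K L M :=
      { carrier := {m | ∀ y ∈ ⁅J, J⁆, ⁅y, m⁆ = 0}
        add_mem' := fun ha hb y hy => by rw [lie_add, ha y hy, hb y hy, add_zero]
        zero_mem' := fun y _ => lie_zero y
        smul_mem' := fun a m hm y hy => by rw [lie_smul, hm y hy, smul_zero]
        lie_mem := by
          intro x m hm y hy
          rw [leibniz_lie y x m, hm y hy, lie_zero, add_zero]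
          exact hm _ (by rw [← lie_skew]; exact neg_mem (LieSubmodule.lie_mem _ hy)) }
    have hN : N = ⊤ := by
      refine (IsSimpleOrder.eq_bot_or_eq_top N).resolve_left fun h => ?_
      obtain ⟨m, hm⟩ := exists_ne (0 : maxTrivSubmodule K (derivedSeries K J 1) M)
      apply hm
      have : (m : M) ∈ N := by
        intro y hy
        have hmm := (mem_maxTrivSubmodule K (derivedSeries K J 1) M m).mp m.2
        have hyJ : y ∈ J := LieSubmodule.lie_le_left J J hy
        have : (⟨y, hyJ⟩ : J) ∈ derivedSeries K J 1 := by
          rw [LieIdeal.derivedSeries_eq_derivedSeriesOfIdeal_comap]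
          simpa using hy
        exact hmm ⟨⟨y, hyJ⟩, this⟩
      rw [h] at this
      exact Subtype.ext (by simpa using this)
    intro y hy m
    have : m ∈ N := hN ▸ LieSubmodule.mem_top m
    exact this y hy
  intro x hx
  obtain ⟨a, ha⟩ := exists_scalar_of_commute (L := L) (toEnd K L M x) (by
    intro y m
    simp only [toEnd_apply_apply]
    rw [leibniz_lie x y m, ← lie_skew, neg_lie, key _ (hL.lie_mem J y x hx), neg_zero, zero_add])
  have h0 : toEnd K L M x = a • LinearMap.id := by ext m; simpa using ha m
  have h4 : traceForm K L M x x = 0 := by rw [hJ x hx]; rfl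
  rw [traceForm_apply_apply, h0] at h4
  have h5 : (Module.finrank K M : K) ≠ 0 := by
    exact_mod_cast (Module.finrank_pos (R := K) (M := M)).ne'
  have h6 : a = 0 := by
    rw [LinearMap.smul_comp, LinearMap.id_comp, map_smul, map_smul, LinearMap.trace_id] at h4
    simpa [h5] using h4
  intro m
  have := ha m
  rw [h6, zero_smul] at this
  exact this

variable [Module.Finite K L]

theorem exists_primitive_of_isIrreducible (hL : IsReductiveAlg K L)
    {M : Type v} [AddCommGroup M] [Module K M] [LieRingModule L M]
    [LieModule K L M] [Module.Finite K M] [LieModule.IsIrreducible K L M]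
    (c : L →ₗ[K] M) (hc : ∀ x y, c ⁅x, y⁆ = ⁅x, c y⁆ - ⁅y, c x⁆)
    (hz : ∀ z ∈ center K L, ∃ m, c z = ⁅z, m⁆) :
    ∃ m, ∀ x, c x = ⁅x, m⁆ := by
  by_cases htriv : ∀ (x : L) (m : M), ⁅x, m⁆ = 0
  · refine ⟨0, fun x => ?_⟩
    rw [lie_zero]
    have hx : x ∈ center K L ⊔ ⁅(⊤ : LieIdeal K L), (⊤ : LieIdeal K L)⁆ := by
      rw [hL.center_sup]; exact LieSubmodule.mem_top x
    have hle : (center K L ⊔ ⁅(⊤ : LieIdeal K L), (⊤ : LieIdeal K L)⁆).toSubmodule ≤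
        LinearMap.ker c := by
      rw [LieSubmodule.sup_toSubmodule, sup_le_iff]
      constructor
      · intro z hzz
        obtain ⟨m, hm⟩ := hz z hzz
        simp [hm, htriv]
      · rw [LieSubmodule.lieIdeal_oper_eq_linear_span', Submodule.span_le]
        rintro _ ⟨x, -, y, -, rfl⟩
        simp [hc, htriv]
    exact hle hx
  · push Not at htriv
    obtain ⟨x₀, m₀, hxm⟩ := htriv
    have := LieModule.nontrivial_of_isIrreducible K L M
    let τ := traceForm K L M
    let J : LieIdeal K L :=
      { LinearMap.ker τ with
        lie_mem := by
          intro x y hy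
          simp only [AddSubsemigroup.mem_carrier, AddSubmonoid.mem_toSubsemigroup,
            Submodule.mem_toAddSubmonoid, LinearMap.mem_ker] at hy ⊢
          ext z
          have := traceForm_apply_lie_apply' K L M x y z
          rw [hy] at this
          simpa using this }
    have hJm : ∀ x, x ∈ J ↔ τ x = 0 := fun x => Iff.rfl
    have hJ0 := lie_eq_zero_of_traceForm_eq_zero hL (M := M) J (fun x hx => hx)
    have hinv0 : ∀ m : M, (∀ x : L, ⁅x, m⁆ = 0) → m = 0 := by
      intro m hm
      have hN : maxTrivSubmodule K L M = ⊥ := by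
        refine (IsSimpleOrder.eq_bot_or_eq_top _).resolve_right fun h => hxm ?_
        exact (mem_maxTrivSubmodule K L M m₀).mp (h ▸ LieSubmodule.mem_top m₀) x₀
      have := (mem_maxTrivSubmodule K L M m).mpr hm
      rw [hN] at this
      simpa using this
    have hcJ : ∀ y ∈ J, c y = 0 := by
      have h1 : ∀ y ∈ ⁅J, J⁆, c y = 0 := by
        have : (⁅J, J⁆ : LieIdeal K L).toSubmodule ≤ LinearMap.ker c := by
          rw [LieSubmodule.lieIdeal_oper_eq_linear_span', Submodule.span_le]
          rintro _ ⟨x, hx, y, hy, rfl⟩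
          simp [hc, hJ0 x hx, hJ0 y hy]
        exact this
      intro y hy
      refine hinv0 _ fun x => ?_
      have := h1 _ (hL.lie_mem J x y hy)
      rw [hc, hJ0 y hy, sub_zero] at this
      exact this
    obtain ⟨n, b, b', hn, htr, hB⟩ := exists_casimir_family.{v} τ
      ⟨fun x y => by simpa using traceForm_comm K L M x y⟩
      (fun x y z => traceForm_apply_lie_apply' K L M x y z)
    have hτ0 : τ ≠ 0 := fun h => hxm (hJ0 x₀ ((hJm _).mpr (by rw [h]; rfl)) m₀)
    let Ω : Module.End K M := ∑ i, toEnd K L M (b i) ∘ₗ toEnd K L M (b' i)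
    have hΩ : ∀ m, Ω m = ∑ i, ⁅b i, ⁅b' i, m⁆⁆ := fun m => by simp [Ω]
    have hΩc : ∀ (x : L) (m : M), Ω ⁅x, m⁆ = ⁅x, Ω m⁆ := by
      intro x m
      have := hB M (LinearMap.mk₂ K (fun u v => ⁅u, ⁅v, m⁆⁆) (by simp) (by simp) (by simp)
        (by simp)) (fun u v hu => hJ0 u hu _)
        (fun u v hu => by
          rw [LinearMap.mk₂_apply, hJ0 v hu, lie_zero]) x
      simp only [LinearMap.mk₂_apply] at this
      rw [hΩ, hΩ, lie_sum, ← sub_eq_zero, ← Finset.sum_sub_distrib, ← neg_eq_zero,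
        ← Finset.sum_neg_distrib, ← this]
      refine Finset.sum_congr rfl fun i _ => ?_
      rw [leibniz_lie x (b i), leibniz_lie x (b' i), lie_add]
      abel
    obtain ⟨ω, hω⟩ := exists_scalar_of_commute (L := L) Ω hΩc
    have hω0 : ω ≠ 0 := by
      rintro rfl
      have h0 : Ω = 0 := by ext m; simpa using hω m
      have : LinearMap.trace K M Ω = n := by
        rw [← htr]; simp [Ω, τ, traceForm_apply_apply]
      rw [h0, map_zero] at this
      exact hn hτ0 (by exact_mod_cast this.symm)
    refine ⟨ω⁻¹ • ∑ i, ⁅b i, c (b' i)⁆, fun x => ?_⟩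
    have := hB M (LinearMap.mk₂ K (fun u v => ⁅u, c v⁆) (by simp) (by simp) (by simp)
        (by simp)) (fun u v hu => hJ0 u hu _)
        (fun u v hu => by
          rw [LinearMap.mk₂_apply, hcJ v hu, lie_zero]) x
    simp only [LinearMap.mk₂_apply] at this
    have h2 : Ω (c x) = ⁅x, ∑ i, ⁅b i, c (b' i)⁆⁆ := by
      rw [hΩ, lie_sum, ← sub_eq_zero, ← Finset.sum_sub_distrib, ← neg_eq_zero,
        ← Finset.sum_neg_distrib, ← this]
      refine Finset.sum_congr rfl fun i _ => ?_
      rw [leibniz_lie x (b i), hc, lie_sub]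
      abel
    rw [lie_smul, ← h2, hω, smul_smul, inv_mul_cancel₀ hω0, one_smul]

end Whitehead

section Whitehead2
universe v
variable {K L : Type*} [Field K] [CharZero K] [IsAlgClosed K] [LieRing L] [LieAlgebra K L]
  [Module.Finite K L]

/-- First Whitehead lemma for modules on which the centre acts without Jordan blocks. -/
theorem exists_primitive (hL : IsReductiveAlg K L) (n : ℕ) :
    ∀ {M : Type v} [AddCommGroup M] [Module K M] [LieRingModule L M]
    [LieModule K L M] [Module.Finite K M] (_ : Module.finrank K M = n)
    (_ : ∀ z ∈ center K L, ∀ N : Submodule K M, (∀ m ∈ N, ⁅z, m⁆ ∈ N) →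
      ∀ m, ⁅z, m⁆ ∈ N → ∃ m' ∈ N, ⁅z, m'⁆ = ⁅z, m⁆)
    (c : L →ₗ[K] M) (_ : ∀ x y, c ⁅x, y⁆ = ⁅x, c y⁆ - ⁅y, c x⁆)
    (_ : ∀ z ∈ center K L, ∃ m, c z = ⁅z, m⁆),
    ∃ m, ∀ x, c x = ⁅x, m⁆ := by
  induction n using Nat.strong_induction_on with
  | _ n ih =>
    intro M _ _ _ _ _ hfr hss c hc hz
    by_cases hsub : Subsingleton M
    · exact ⟨0, fun x => Subsingleton.elim _ _⟩
    rw [not_subsingleton_iff_nontrivial] at hsub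
    by_cases hirr : ∀ N : LieSubmodule K L M, N = ⊥ ∨ N = ⊤
    · have : LieModule.IsIrreducible K L M :=
        { toNontrivial := (LieSubmodule.nontrivial_iff K L M).mpr hsub
          eq_bot_or_eq_top := hirr }
      exact exists_primitive_of_isIrreducible hL c hc hz
    push Not at hirr
    obtain ⟨N, hN0, hN1⟩ := hirr
    have hN1' : N.toSubmodule ≠ ⊤ := fun h => hN1 ((LieSubmodule.toSubmodule_eq_top N).mp h)
    have hN0' : N.toSubmodule ≠ ⊥ := fun h => hN0 ((LieSubmodule.toSubmodule_eq_bot N).mp h)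
    have hltN : Module.finrank K N < n := hfr ▸ Submodule.finrank_lt hN1'
    have hltQ : Module.finrank K (M ⧸ N) < n := by
      have h1 := Submodule.finrank_quotient_add_finrank N.toSubmodule
      have h2 : 0 < Module.finrank K N.toSubmodule := by
        have := Submodule.nontrivial_iff_ne_bot.mpr hN0'
        exact Module.finrank_pos
      change Module.finrank K (M ⧸ N.toSubmodule) < n
      omega
    have : Module.Finite K (M ⧸ N) := inferInstanceAs (Module.Finite K (M ⧸ N.toSubmodule))
    let π : M →ₗ[K] M ⧸ N := (LieSubmodule.Quotient.mk' N : M →ₗ[K] M ⧸ N)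
    have hπ : ∀ (x : L) (m : M), π ⁅x, m⁆ = ⁅x, π m⁆ := fun x m => rfl
    have hπs : Function.Surjective π := LieSubmodule.Quotient.surjective_mk' N
    have hπ0 : ∀ m, π m = 0 ↔ m ∈ N := fun m => LieSubmodule.Quotient.mk_eq_zero N
    obtain ⟨q, hq⟩ := ih _ hltQ (M := M ⧸ N) rfl
      (by
        intro z hzz N' hN' q hq
        obtain ⟨m, rfl⟩ := hπs q
        obtain ⟨m', hm', he⟩ := hss z hzz (N'.comap π) (fun a ha => by
          rw [Submodule.mem_comap, hπ]; exact hN' _ ha) m (by rwa [Submodule.mem_comap, hπ])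
        exact ⟨π m', hm', by rw [← hπ, ← hπ, he]⟩)
      (π ∘ₗ c)
      (by intro x y; simp only [LinearMap.comp_apply, hc, map_sub, hπ])
      (by
        intro z hzz
        obtain ⟨m, hm⟩ := hz z hzz
        exact ⟨π m, by rw [LinearMap.comp_apply, hm, hπ]⟩)
    obtain ⟨m₁, rfl⟩ := hπs q
    have hmem : ∀ x, c x - ⁅x, m₁⁆ ∈ N := by
      intro x
      rw [← hπ0, map_sub, hπ, ← hq, LinearMap.comp_apply, sub_self]
    let c' : L →ₗ[K] N :=
      { toFun := fun x => ⟨c x - ⁅x, m₁⁆, hmem x⟩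
        map_add' := fun x y => Subtype.ext (by simp [add_sub_add_comm])
        map_smul' := fun a x => Subtype.ext (by simp [smul_sub]) }
    have hc' : ∀ x, (c' x : M) = c x - ⁅x, m₁⁆ := fun x => rfl
    obtain ⟨m₂, hm₂⟩ := ih _ hltN (M := N) rfl
      (by
        intro z hzz N' hN' m hm
        obtain ⟨m', hm', he⟩ := hss z hzz (N'.map N.toSubmodule.subtype) (by
          rintro _ ⟨a : N, ha, rfl⟩
          exact ⟨_, hN' a ha, rfl⟩) (m : M) ⟨_, hm, rfl⟩
        obtain ⟨a, ha, rfl⟩ := hm'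
        exact ⟨a, ha, Subtype.ext he⟩)
      c'
      (by
        intro x y
        apply Subtype.ext
        rw [LieSubmodule.coe_sub, LieSubmodule.coe_bracket, LieSubmodule.coe_bracket, hc', hc',
          hc', hc, lie_sub, lie_sub, leibniz_lie x y m₁]
        abel)
      (by
        intro z hzz
        obtain ⟨m, hm⟩ := hz z hzz
        obtain ⟨m', hm', he⟩ := hss z hzz N.toSubmodule (fun a ha => N.lie_mem ha) (m - m₁) (by
          have := hmem z
          rwa [hm, ← lie_sub] at this)
        refine ⟨⟨m', hm'⟩, Subtype.ext ?_⟩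
        rw [LieSubmodule.coe_bracket, hc', hm, he, lie_sub])
    refine ⟨m₁ + m₂, fun x => ?_⟩
    have := congrArg Subtype.val (hm₂ x)
    rw [LieSubmodule.coe_bracket, hc'] at this
    rw [lie_add, ← this]
    abel

/-- Weyl's theorem for reductive Lie algebras. -/
theorem exists_isCompl_of_isReductiveAlg (hL : IsReductiveAlg K L)
    {M : Type v} [AddCommGroup M] [Module K M] [LieRingModule L M]
    [LieModule K L M] [Module.Finite K M]
    (hss : ∀ z ∈ center K L, (toEnd K L M z).IsSemisimple)
    (N : LieSubmodule K L M) : ∃ N' : LieSubmodule K L M, IsCompl N.toSubmodule N'.toSubmodule := by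
  let E : LieSubmodule K L (M →ₗ[K] M) :=
    { carrier := {f | (∀ m, f m ∈ N) ∧ ∀ m ∈ N, f m = 0}
      add_mem' := fun {a b} ha hb => ⟨fun m => add_mem (ha.1 m) (hb.1 m), fun m hm => by
        rw [LinearMap.add_apply, ha.2 m hm, hb.2 m hm, add_zero]⟩
      zero_mem' := ⟨fun m => zero_mem N, fun m _ => rfl⟩
      smul_mem' := fun a f hf => ⟨fun m => N.smul_mem a (hf.1 m), fun m hm => by
        rw [LinearMap.smul_apply, hf.2 m hm, smul_zero]⟩
      lie_mem := by
        intro x f hf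
        refine ⟨fun m => ?_, fun m hm => ?_⟩
        · rw [LieHom.lie_apply]
          exact sub_mem (N.lie_mem (hf.1 _)) (hf.1 _)
        · rw [LieHom.lie_apply, hf.2 m hm, hf.2 _ (N.lie_mem hm), lie_zero, sub_zero] }
  have hE : ∀ f, f ∈ E ↔ (∀ m, f m ∈ N) ∧ ∀ m ∈ N, f m = 0 := fun f => Iff.rfl
  have proj : ∀ C : Submodule K M, IsCompl N.toSubmodule C → ∃ p : M →ₗ[K] M,
      (∀ m, p m ∈ N) ∧ (∀ m ∈ N, p m = m) ∧ ∀ m ∈ C, p m = 0 := by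
    intro C hC
    refine ⟨N.toSubmodule.subtype ∘ₗ N.toSubmodule.projectionOnto C hC, fun m => ?_,
      fun m hm => ?_, fun m hm => ?_⟩
    · exact (N.toSubmodule.projectionOnto C hC m).2
    · have := Submodule.projectionOnto_apply_left hC ⟨m, hm⟩
      rw [LinearMap.comp_apply, this]; rfl
    · rw [LinearMap.comp_apply, Submodule.projectionOnto_apply_of_mem_right hC hm, map_zero]
  obtain ⟨C, hC⟩ := N.toSubmodule.exists_isCompl
  obtain ⟨p, hp1, hp2, -⟩ := proj C hC
  have hcE : ∀ x : L, ⁅x, p⁆ ∈ E := by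
    intro x
    rw [hE]
    refine ⟨fun m => ?_, fun m hm => ?_⟩
    · rw [LieHom.lie_apply]
      exact sub_mem (N.lie_mem (hp1 _)) (hp1 _)
    · rw [LieHom.lie_apply, hp2 m hm, hp2 _ (N.lie_mem hm), sub_self]
  let c : L →ₗ[K] E :=
    { toFun := fun x => ⟨⁅x, p⁆, hcE x⟩
      map_add' := fun x y => Subtype.ext (by simp)
      map_smul' := fun a x => Subtype.ext (by simp) }
  have hcc : ∀ x, (c x : M →ₗ[K] M) = ⁅x, p⁆ := fun x => rfl
  obtain ⟨m, hm⟩ := exists_primitive hL _ (M := E) rfl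
    (by
      intro z hz F hF m hm
      have had : (toEnd K L (M →ₗ[K] M) z).IsSemisimple := by
        have := LieAlgebra.ad_isSemisimple_of_isSemisimple (hss z hz)
        exact this
      obtain ⟨D, hD, hFD⟩ := Module.End.isSemisimple_iff.mp had
        (F.map E.toSubmodule.subtype) (by
          rintro _ ⟨a, ha, rfl⟩
          exact ⟨_, hF a ha, rfl⟩)
      obtain ⟨a, ha, b, hb, hab⟩ := Submodule.mem_sup.mp
        (hFD.sup_eq_top ▸ Submodule.mem_top : (m : M →ₗ[K] M) ∈ _)
      obtain ⟨a' : E, ha, rfl⟩ := ha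
      refine ⟨a', ha, Subtype.ext ?_⟩
      have hb' : ⁅z, b⁆ = 0 := by
        have h1 : ⁅z, b⁆ ∈ D := hD hb
        have h2 : ⁅z, b⁆ ∈ F.map E.toSubmodule.subtype := by
          have : ⁅z, b⁆ = E.toSubmodule.subtype (⁅z, m⁆ - ⁅z, a'⁆) := by
            rw [← lie_sub]
            change _ = ⁅z, (m : M →ₗ[K] M) - (a' : M →ₗ[K] M)⁆
            rw [← hab]; simp
          rw [this]
          exact ⟨_, sub_mem hm (hF a' ha), rfl⟩
        exact Submodule.disjoint_def.mp hFD.disjoint _ h2 h1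
      change ⁅z, (a' : M →ₗ[K] M)⁆ = ⁅z, (m : M →ₗ[K] M)⁆
      rw [← hab, lie_add, hb', add_zero]; rfl)
    c
    (by
      intro x y
      apply Subtype.ext
      rw [LieSubmodule.coe_sub, LieSubmodule.coe_bracket, LieSubmodule.coe_bracket, hcc, hcc, hcc,
        lie_lie])
    (by
      intro z hz
      obtain ⟨D, hD, hND⟩ := Module.End.isSemisimple_iff.mp (hss z hz) N.toSubmodule
        (fun m hm => N.lie_mem hm)
      obtain ⟨q, hq1, hq2, hq3⟩ := proj D hND
      have hqz : ⁅z, q⁆ = 0 := by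
        ext m
        obtain ⟨a, ha, b, hb, rfl⟩ := Submodule.mem_sup.mp
          (hND.sup_eq_top ▸ Submodule.mem_top : m ∈ _)
        have hb' : ⁅z, b⁆ ∈ D := hD hb
        rw [LieHom.lie_apply, lie_add, map_add, map_add, hq2 a ha, hq3 b hb,
          hq2 _ (N.lie_mem ha), hq3 _ hb']
        simp
      refine ⟨⟨p - q, fun m => sub_mem (hp1 m) (hq1 m), fun m hm => ?_⟩, Subtype.ext ?_⟩
      · rw [LinearMap.sub_apply, hp2 m hm, hq2 m hm, sub_self]
      · rw [LieSubmodule.coe_bracket, hcc]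
        change _ = ⁅z, p - q⁆
        rw [lie_sub, hqz, sub_zero])
  have hm1 : ∀ x : L, ⁅x, p - (m : M →ₗ[K] M)⁆ = 0 := by
    intro x
    have := congrArg Subtype.val (hm x)
    rw [LieSubmodule.coe_bracket, hcc] at this
    rw [lie_sub, this, sub_self]
  have hmE := (hE m).mp m.2
  let P : M →ₗ[K] M := p - (m : M →ₗ[K] M)
  have hP1 : ∀ u, P u ∈ N := fun u => sub_mem (hp1 u) (hmE.1 u)
  have hP2 : ∀ u ∈ N, P u = u := fun u hu => by
    rw [LinearMap.sub_apply, hp2 u hu, hmE.2 u hu, sub_zero]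
  refine ⟨{ LinearMap.ker P with
    lie_mem := ?_ }, ?_⟩
  · intro x u hu
    have hu' : P u = 0 := hu
    change P ⁅x, u⁆ = 0
    have h := LinearMap.congr_fun (hm1 x) u
    rw [LieHom.lie_apply, LinearMap.zero_apply] at h
    change ⁅x, P u⁆ - P ⁅x, u⁆ = 0 at h
    rw [hu', lie_zero, zero_sub, neg_eq_zero] at h
    exact h
  · have := LinearMap.isCompl_of_proj (f := P.codRestrict N.toSubmodule hP1)
      (fun u => Subtype.ext (hP2 u u.2))
    rw [LinearMap.ker_codRestrict] at this
    exact this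
end Whitehead2

theorem LieAlgebra.IsReductiveAlg.of_radical_le_center {K L : Type*} [Field K] [CharZero K]
    [IsAlgClosed K] [LieRing L] [LieAlgebra K L] [Module.Finite K L]
    (hrad : radical K L ≤ center K L) : IsReductiveAlg K L := by
  have hker : ∀ z, killingForm K L z = 0 → z ∈ center K L := by
    intro z hz
    refine hrad (killingCompl_top_le_radical K L ((LieIdeal.mem_killingCompl K L ⊤).mpr ?_))
    intro y _
    rw [LieModule.traceForm_comm]
    exact LinearMap.congr_fun hz y
  have key : ∀ J : LieIdeal K L, J ≤ ⁅J, J⁆ ⊔ center K L := by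
    intro J
    rw [← LieSubmodule.toSubmodule_le_toSubmodule]
    intro j hj
    by_contra hjn
    obtain ⟨f, hfj, hf⟩ := Submodule.exists_le_ker_of_notMem hjn
    have hfr : f ∈ LinearMap.range (LinearMap.flip (killingForm K L)) := by
      rw [← LinearMap.dualAnnihilator_ker_eq_range_flip, Submodule.mem_dualAnnihilator]
      intro z hz
      exact hf (LieSubmodule.mem_sup_right (N := ⁅J, J⁆) (hker z hz))
    obtain ⟨y, rfl⟩ := hfr
    have hyJ : ∀ u ∈ ⁅J, J⁆, killingForm K L y u = 0 := fun u hu => by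
      rw [LieModule.traceForm_comm]
      exact hf (LieSubmodule.mem_sup_left hu)
    have hyZ : ∀ u ∈ J, ⁅y, u⁆ ∈ center K L := by
      have hsol : IsSolvable (J ⊓ J.killingCompl : LieIdeal K L) := by
        refine LieIdeal.isSolvable_of_killingForm_apply_lie_eq_zero _ fun a ha b hb => ?_
        have hb' : b ∈ J := (LieSubmodule.lie_le_left _ _ hb).1
        rw [LieModule.traceForm_comm]
        exact (LieIdeal.mem_killingCompl K L J).mp ha.2 b hb'
      intro u hu
      refine hrad ((LieIdeal.solvable_iff_le_radical _ _ _).mp hsol ⟨lie_mem_right K L J y u hu, ?_⟩)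
      refine (LieIdeal.mem_killingCompl K L J).mpr fun w hw => ?_
      rw [LieModule.traceForm_comm, traceForm_apply_lie_apply]
      exact hyJ _ (LieSubmodule.lie_mem_lie hu hw)
    have hnil : IsNilpotent (ad K L y ∘ₗ ad K L j) := by
      refine ⟨2, ?_⟩
      ext x
      have h1 : ⁅y, ⁅j, x⁆⁆ ∈ center K L := hyZ _ (lie_mem_left K L J j x hj)
      have h2 := (mem_maxTrivSubmodule K L L _).mp h1 j
      simp [pow_two, h2]
    apply hfj
    change killingForm K L j y = 0
    rw [LieModule.traceForm_comm, killingForm_apply_apply]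
    exact (LinearMap.isNilpotent_trace_of_isNilpotent hnil).eq_zero
  refine ⟨fun J x y hy => ?_, ?_⟩
  · obtain ⟨s, hs, z, hz, rfl⟩ := (LieSubmodule.mem_sup _ _ _).mp (key J hy)
    rw [lie_add, (mem_maxTrivSubmodule K L L z).mp hz x, add_zero]
    exact LieSubmodule.lie_mem _ hs
  · rw [sup_comm]
    exact top_le_iff.mp (key ⊤)

theorem Module.End.isSemisimple_of_iSup_eigenspace_eq_top {K V : Type*} [Field K]
    [AddCommGroup V] [Module K V] [Module.Finite K V] {f : Module.End K V}
    (h : ⨆ a, f.eigenspace a = ⊤) : f.IsSemisimple := by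
  classical
  have hfin : Set.Finite {a | f.HasEigenvalue a} := Module.End.finite_hasEigenvalue f
  let p : Polynomial K := ∏ a ∈ hfin.toFinset, (Polynomial.X - Polynomial.C a)
  have hp : Squarefree p := by
    refine (Polynomial.separable_prod_X_sub_C_iff' (f := fun a : K => a)).mpr ?_ |>.squarefree
    intro a _ b _ hab
    exact hab
  refine Module.End.isSemisimple_of_squarefree_aeval_eq_zero hp ?_
  rw [← LinearMap.ker_eq_top, eq_top_iff, ← h, iSup_le_iff]
  intro a v hv
  by_cases ha : f.HasEigenvalue a
  · have : p = (∏ b ∈ hfin.toFinset.erase a, (Polynomial.X - Polynomial.C b)) *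
        (Polynomial.X - Polynomial.C a) :=
      (Finset.prod_erase_mul _ _ (by simpa using ha)).symm
    rw [LinearMap.mem_ker, this, map_mul, Module.End.mul_apply]
    rw [Module.End.mem_eigenspace_iff] at hv
    simp [hv, Module.algebraMap_end_apply]
  · have : f.eigenspace a = ⊥ := by
      by_contra hne
      exact ha hne
    rw [this] at hv
    rw [(Submodule.mem_bot K).mp hv]
    exact zero_mem _

theorem exists_radical_scalar_of_isIrreducible {K L : Type*} [Field K] [CharZero K]
    [IsAlgClosed K] [LieRing L] [LieAlgebra K L] [Module.Finite K L]
    {M : Type*} [AddCommGroup M] [Module K M] [LieRingModule L M]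
    [LieModule K L M] [Module.Finite K M] [LieModule.IsIrreducible K L M] :
    ∀ x ∈ radical K L, ∃ a : K, ∀ m : M, ⁅x, m⁆ = a • m := by
  have _i := nontrivial_of_isIrreducible K L M
  obtain ⟨χ, hχ⟩ : ∃ χ : Module.Dual K (radical K L), Nontrivial (weightSpace M χ) :=
    exists_nontrivial_weightSpace_of_isSolvable K (radical K L) M
  let N : LieSubmodule K L M := weightSpaceOfIsLieTower K M χ
  replace hχ : Nontrivial N := hχ
  replace hχ : N = ⊤ := N.eq_top_of_isIrreducible K L M
  intro x hx
  refine ⟨χ ⟨x, hx⟩, fun m => ?_⟩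
  have hm : ∀ (y : L) (hy : y ∈ radical K L), ⁅y, m⁆ = χ ⟨y, hy⟩ • m := by
    simpa [N, weightSpaceOfIsLieTower, mem_weightSpace] using (hχ ▸ LieSubmodule.mem_top _ : m ∈ N)
  exact hm x hx

/-- A Lie algebra with a faithful semisimple module is reductive and its centre acts diagonalizably
on that module. -/
theorem isReductiveAlg_of_semisimple_faithful {K L : Type*} [Field K] [CharZero K]
    [IsAlgClosed K] [LieRing L] [LieAlgebra K L] [Module.Finite K L]
    {M : Type*} [AddCommGroup M] [Module K M] [LieRingModule L M]
    [LieModule K L M] [Module.Finite K M] (hfaith : ∀ x : L, (∀ m : M, ⁅x, m⁆ = 0) → x = 0)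
    (hss : ∀ N : LieSubmodule K L M, ∃ N' : LieSubmodule K L M, IsCompl N N') :
    IsReductiveAlg K L ∧
      ∀ z ∈ center K L, ⨆ a, (toEnd K L M z).eigenspace a = ⊤ := by
  have hatoms : ⨆ N ∈ {N : LieSubmodule K L M | IsAtom N}, N = ⊤ := by
    obtain ⟨N', hN'⟩ := hss (⨆ N ∈ {N : LieSubmodule K L M | IsAtom N}, N)
    rcases eq_bot_or_exists_atom_le N' with h | ⟨A, hA, hAN⟩
    · rw [h] at hN'
      simpa using hN'.sup_eq_top
    · exfalso
      refine hA.1 (le_bot_iff.mp ?_)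
      rw [← hN'.inf_eq_bot]
      exact le_inf (le_iSup₂_of_le A hA le_rfl) hAN
  have hscal : ∀ A : LieSubmodule K L M, IsAtom A → ∀ x ∈ radical K L,
      ∃ a : K, ∀ m ∈ A, ⁅x, m⁆ = a • m := by
    intro A hA x hx
    have : LieModule.IsIrreducible K L A := by
      have : Nontrivial A := (LieSubmodule.nontrivial_iff_ne_bot K L M).mpr hA.1
      refine LieModule.IsIrreducible.mk fun N hN => ?_
      by_contra hne
      have h1 : N.map A.incl < A := lt_of_le_of_ne LieSubmodule.map_incl_le fun h => hne (by
        rw [eq_top_iff]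
        intro m _
        have hm : (m : M) ∈ N.map A.incl := by rw [h]; exact m.2
        obtain ⟨n, hn, hnm⟩ := (LieSubmodule.mem_map _).mp hm
        rwa [← show n = m from Subtype.ext hnm])
      have h2 := hA.2 _ h1
      apply hN
      rw [LieSubmodule.eq_bot_iff]
      intro m hm
      have : A.incl m ∈ N.map A.incl := LieSubmodule.mem_map_of_mem hm
      rw [h2] at this
      exact Subtype.ext this
    obtain ⟨a, ha⟩ := exists_radical_scalar_of_isIrreducible (M := A) x hx
    exact ⟨a, fun m hm => congrArg Subtype.val (ha ⟨m, hm⟩)⟩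
  have hatoms' : ∀ S : Submodule K M, (∀ A : LieSubmodule K L M, IsAtom A → A.toSubmodule ≤ S) →
      S = ⊤ := by
    intro S hS
    rw [eq_top_iff, ← LieSubmodule.top_toSubmodule (R := K) (L := L) (M := M), ← hatoms,
      LieSubmodule.iSup_toSubmodule]
    refine iSup_le fun A => ?_
    rw [LieSubmodule.iSup_toSubmodule]
    exact iSup_le fun hA => hS A hA
  have hcen : radical K L ≤ center K L := by
    intro x hx
    refine (mem_maxTrivSubmodule K L L x).mpr fun y => hfaith _ ?_
    have := hatoms' (LinearMap.ker (toEnd K L M ⁅y, x⁆)) (by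
      intro A hA m hm
      obtain ⟨a, ha⟩ := hscal A hA x hx
      rw [LinearMap.mem_ker, toEnd_apply_apply, lie_lie, ha m hm, ha _ (A.lie_mem hm), lie_smul,
        sub_self])
    intro m
    have hm : m ∈ LinearMap.ker (toEnd K L M ⁅y, x⁆) := this ▸ Submodule.mem_top
    exact hm
  refine ⟨.of_radical_le_center hcen, fun z hz => hatoms' _ fun A hA => ?_⟩
  obtain ⟨a, ha⟩ := hscal A hA z (center_le_radical K L hz)
  refine le_trans (fun m hm => ?_) (le_iSup _ a)
  exact Module.End.mem_eigenspace_iff.mpr (ha m hm)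

section Taylor
variable {K σ : Type*} [Field K] [Fintype σ]

theorem sub_taylor_mem_sq [DecidableEq σ] (p : σ → K) (f : MvPolynomial σ K) :
    f - C (eval p f) - ∑ i, C (eval p (pderiv i f)) * (X i - C (p i)) ∈
      RingHom.ker (eval p) ^ 2 := by
  have hm : ∀ i, (X i - C (p i) : MvPolynomial σ K) ∈ RingHom.ker (eval p) := fun i => by
    simp [RingHom.mem_ker]
  induction f using MvPolynomial.induction_on with
  | C a => simp
  | add f g hf hg =>
    convert add_mem hf hg using 1
    simp only [map_add, add_mul, Finset.sum_add_distrib]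
    ring
  | mul_X f j hf =>
    have h2 : (∑ i, C (eval p (pderiv i f)) * (X i - C (p i))) * (X j - C (p j)) ∈
        RingHom.ker (eval p) ^ 2 := by
      rw [pow_two]
      exact Ideal.mul_mem_mul (sum_mem fun i _ => Ideal.mul_mem_left _ _ (hm i)) (hm j)
    convert add_mem (Ideal.mul_mem_right (X j) _ hf) h2 using 1
    have h3 : ∑ i, C (eval p (pderiv i (f * X j))) * (X i - C (p i)) =
        C (eval p f) * (X j - C (p j)) +
        (∑ i, C (eval p (pderiv i f)) * (X i - C (p i))) * C (p j) := by
      rw [Finset.sum_mul]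
      have : ∀ i, C (eval p (pderiv i (f * X j))) * (X i - C (p i)) =
          (if j = i then C (eval p f) * (X j - C (p j)) else 0) +
          C (eval p (pderiv i f)) * (X i - C (p i)) * C (p j) := by
        intro i
        rw [Derivation.leibniz, pderiv_X]
        by_cases h : j = i
        · subst h
          simp
          ring
        · simp [h]
          ring
      simp_rw [this, Finset.sum_add_distrib]
      simp
    rw [h3, map_mul, eval_X, map_mul]
    ring

theorem eval_derivation (p : σ → K) (D : Derivation K (MvPolynomial σ K) (MvPolynomial σ K))
    (f : MvPolynomial σ K) :
    eval p (D f) = ∑ i, eval p (pderiv i f) * eval p (D (X i)) := by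
  classical
  have : D f = ∑ i, pderiv i f * D (X i) := by
    have hs : ∀ g, (∑ i, D (X i) • pderiv i : Derivation K (MvPolynomial σ K) _) g =
        ∑ i, D (X i) * pderiv i g := fun g => by
      have := congrFun (map_sum (Derivation.coeFnAddMonoidHom (R := K) (A := MvPolynomial σ K)
        (M := MvPolynomial σ K)) (fun i => D (X i) • pderiv i) Finset.univ) g
      rw [Finset.sum_apply] at this
      exact this
    have h : D = ∑ i, D (X i) • pderiv i := by
      refine MvPolynomial.derivation_ext fun j => ?_
      rw [hs]
      simp [pderiv_X, Pi.single_apply]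
    conv_lhs => rw [h]
    rw [hs]
    exact Finset.sum_congr rfl fun i _ => mul_comm _ _
  rw [this]
  simp

/-- If `E` acts as the identity on `m` modulo `m² + I` then it acts as `k` on `m ^ k`. -/
theorem derivation_sub_nsmul_mem {R : Type*} [CommRing R] (m I : Ideal R) (E : R → R)
    (hadd : ∀ a b, E (a + b) = E a + E b) (hE : ∀ a b, E (a * b) = a * E b + b * E a)
    (hm : ∀ a, E a ∈ m) (h1 : ∀ a ∈ m, E a - a ∈ m ^ 2 ⊔ I) (k : ℕ) :
    ∀ f ∈ m ^ k, E f - k • f ∈ m ^ (k + 1) ⊔ I := by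
  induction k with
  | zero =>
    intro f _
    have : E f ∈ m ^ 1 ⊔ I := Ideal.mem_sup_left (by simpa using hm f)
    simpa using this
  | succ k ih =>
    intro f hf
    rw [pow_succ] at hf
    refine Submodule.mul_induction_on hf (fun g hg a ha => ?_) (fun x y hx hy => ?_)
    · have e : E (g * a) - (k + 1) • (g * a) = g * (E a - a) + a * (E g - k • g) := by
        rw [hE]; simp only [nsmul_eq_mul]; push_cast; ring
      rw [e]
      have key : ∀ (J J' J'' : Ideal R), J * J' ≤ J'' → ∀ x ∈ J, ∀ y ∈ J' ⊔ I,
          x * y ∈ J'' ⊔ I := by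
        intro J J' J'' hJ x hx y hy
        obtain ⟨b, hb, c, hc, rfl⟩ := Submodule.mem_sup.mp hy
        rw [mul_add]
        exact add_mem (Ideal.mem_sup_left (hJ (Ideal.mul_mem_mul hx hb)))
          (Ideal.mem_sup_right (I.mul_mem_left _ hc))
      exact add_mem (key _ _ (m ^ (k + 1 + 1)) (by rw [← pow_add]) g hg _ (h1 a ha))
        (key _ _ (m ^ (k + 1 + 1)) (by rw [← pow_succ']) a ha _ (ih g hg))
    · have e : E (x + y) - (k + 1) • (x + y) =
          (E x - (k + 1) • x) + (E y - (k + 1) • y) := by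
        rw [hadd, smul_add]; ring
      rw [e]
      exact add_mem hx hy

/-- A formal Taylor argument: a set of functions vanishing at `p` and stable under derivations that
span the tangent space of `I` at `p` vanishes near `p` on the zero locus of `I`. -/
theorem exists_mul_mem_of_derivations [CharZero K] (p : σ → K) (I : Ideal (MvPolynomial σ K))
    (hI : ∀ f ∈ I, eval p f = 0)
    (D : Set (Derivation K (MvPolynomial σ K) (MvPolynomial σ K)))
    (hD : ∀ d ∈ D, ∀ f ∈ I, d f ∈ I)
    (htan : ∀ v : σ → K, (∀ f ∈ I, ∑ i, eval p (pderiv i f) * v i = 0) →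
      ∃ d ∈ D, ∀ i, eval p (d (X i)) = v i)
    (F : Set (MvPolynomial σ K)) (hF0 : ∀ f ∈ F, eval p f = 0)
    (hF : ∀ d ∈ D, ∀ f ∈ F, d f ∈ F) :
    ∀ f ∈ F, ∃ s, eval p s = 1 ∧ s * f ∈ I := by
  classical
  let m : Ideal (MvPolynomial σ K) := RingHom.ker (eval p)
  have hmm : ∀ f, f ∈ m ↔ eval p f = 0 := fun f => Iff.rfl
  let gr : MvPolynomial σ K →ₗ[K] Module.Dual K (σ → K) :=
    { toFun := fun f => ∑ i, eval p (pderiv i f) • LinearMap.proj i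
      map_add' := fun f g => by simp [add_smul, Finset.sum_add_distrib]
      map_smul' := fun a f => by simp [Finset.smul_sum, mul_smul] }
  have hgr : ∀ f v, gr f v = ∑ i, eval p (pderiv i f) * v i := fun f v => by simp [gr]
  have hgrD : ∀ (d : Derivation K (MvPolynomial σ K) (MvPolynomial σ K)) f,
      eval p (d f) = gr f (fun i => eval p (d (X i))) := fun d f => by
    rw [hgr, eval_derivation]
  have hgr2 : ∀ f ∈ m, gr f = 0 → f ∈ m ^ 2 := by
    intro f hf h0
    have hi : ∀ i, eval p (pderiv i f) = 0 := fun i => by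
      have := LinearMap.congr_fun h0 (Pi.single i 1)
      simpa [hgr, Pi.single_apply] using this
    have := sub_taylor_mem_sq p f
    rw [(hmm f).mp hf] at this
    simpa [hi] using this
  let E : Submodule K (Module.Dual K (σ → K)) := (I.restrictScalars K).map gr
  let T : Submodule K (σ → K) := E.dualCoannihilator
  have hT : ∀ v ∈ T, ∃ d ∈ D, ∀ i, eval p (d (X i)) = v i := by
    intro v hv
    refine htan v fun f hf => ?_
    rw [← hgr]
    exact (Submodule.mem_dualCoannihilator _).mp hv _ ⟨f, hf, rfl⟩
  let b := Module.finBasis K T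
  choose d hdD hd using fun j => hT (b j) (b j).2
  obtain ⟨pr, hpr⟩ := T.exists_isCompl
  let c : Fin (Module.finrank K T) → Module.Dual K (σ → K) := fun j =>
    b.coord j ∘ₗ T.projectionOnto pr hpr
  have hc : ∀ j (v : T), c j v = b.coord j v := fun j v => by
    simp [c, Submodule.projectionOnto_apply_left]
  let t : Fin (Module.finrank K T) → MvPolynomial σ K := fun j =>
    ∑ i, C (c j (Pi.single i 1)) * (X i - C (p i))
  have ht : ∀ j, t j ∈ m := fun j => by simp [hmm, t]
  have hgrt : ∀ j, gr (t j) = c j := by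
    intro j
    refine LinearMap.pi_ext' fun i => LinearMap.ext_ring ?_
    simp [hgr, t, pderiv_X, Pi.single_apply, apply_ite (eval p)]
  let 𝓔 : MvPolynomial σ K → MvPolynomial σ K := fun f => ∑ j, t j * d j f
  have h1 : ∀ a ∈ m, 𝓔 a - a ∈ m ^ 2 ⊔ I := by
    intro a ha
    have hsplit : 𝓔 a - a = ∑ j, t j * (d j a - C (eval p (d j a))) -
        (a - ∑ j, eval p (d j a) • t j) := by
      simp only [𝓔, mul_sub, Finset.sum_sub_distrib, MvPolynomial.smul_eq_C_mul]
      have : ∀ j, C (eval p (d j a)) * t j = t j * C (eval p (d j a)) := fun j => mul_comm _ _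
      simp_rw [this]
      ring
    rw [hsplit]
    refine sub_mem (Ideal.mem_sup_left ?_) ?_
    · rw [pow_two]
      exact sum_mem fun j _ => Ideal.mul_mem_mul (ht j) (by simp [hmm])
    · set e := a - ∑ j, eval p (d j a) • t j with he
      have hem : e ∈ m := sub_mem ha (sum_mem fun j _ => Submodule.smul_of_tower_mem m _ (ht j))
      have heE : gr e ∈ E := by
        rw [← Subspace.dualCoannihilator_dualAnnihilator_eq (W := E), Submodule.mem_dualAnnihilator]
        intro v hv
        have hsum : ∀ w : T, gr e w = 0 := by
          have : gr e ∘ₗ T.subtype = 0 := by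
            refine b.ext fun k => ?_
            have hk : gr a (b k) = eval p (d k a) := by
              rw [hgrD]; congr 1; funext i; rw [hd]
            simp [he, hgrt, hc, hk, Finsupp.single_apply]
          exact fun w => LinearMap.congr_fun this w
        exact hsum ⟨v, hv⟩
      obtain ⟨f, hf, hfe⟩ := heE
      have : e = (e - f) + f := by ring
      rw [this]
      refine add_mem (Ideal.mem_sup_left (hgr2 _ (sub_mem hem (hI f hf)) ?_))
        (Ideal.mem_sup_right hf)
      rw [map_sub, hfe, sub_self]
  have h2 := derivation_sub_nsmul_mem m I 𝓔
    (fun x y => by simp [𝓔, mul_add, Finset.sum_add_distrib])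
    (fun x y => by
      simp only [𝓔, Derivation.leibniz, smul_eq_mul, mul_add, Finset.sum_add_distrib,
        Finset.mul_sum]
      congr 1 <;> exact Finset.sum_congr rfl fun j _ => by ring)
    (fun x => sum_mem fun j _ => Ideal.mul_mem_right _ _ (ht j)) h1
  have h3 : ∀ k, ∀ f ∈ F, f ∈ m ^ (k + 1) ⊔ I := by
    intro k
    induction k with
    | zero => exact fun f hf => Ideal.mem_sup_left (by simpa [hmm] using hF0 f hf)
    | succ k ih =>
      intro f hf
      obtain ⟨g, hg, i, hi, rfl⟩ := Submodule.mem_sup.mp (ih f hf)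
      have hEf : 𝓔 (g + i) ∈ m ^ (k + 1 + 1) ⊔ I := by
        refine sum_mem fun j _ => ?_
        obtain ⟨g', hg', i', hi', h⟩ := Submodule.mem_sup.mp (ih _ (hF (d j) (hdD j) _ hf))
        rw [← h, mul_add]
        refine add_mem (Ideal.mem_sup_left ?_) (Ideal.mem_sup_right (I.mul_mem_left _ hi'))
        rw [pow_succ']
        exact Ideal.mul_mem_mul (ht j) hg'
      have hEi : 𝓔 i ∈ I := sum_mem fun j _ => I.mul_mem_left _ (hD _ (hdD j) _ hi)
      have hEg : (k + 1) • g ∈ m ^ (k + 1 + 1) ⊔ I := by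
        have e : (k + 1) • g = 𝓔 (g + i) - 𝓔 i - (𝓔 g - (k + 1) • g) := by
          have : 𝓔 (g + i) = 𝓔 g + 𝓔 i := by simp [𝓔, mul_add, Finset.sum_add_distrib]
          rw [this]; ring
        rw [e]
        exact sub_mem (sub_mem hEf (Ideal.mem_sup_right hEi)) (h2 (k + 1) g hg)
      have hk : ((k + 1 : ℕ) : K) ≠ 0 := Nat.cast_ne_zero.mpr (Nat.succ_ne_zero k)
      have : g = ((k + 1 : ℕ) : K)⁻¹ • ((k + 1) • g) := by
        rw [← Nat.cast_smul_eq_nsmul K, smul_smul, inv_mul_cancel₀ hk, one_smul]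
      refine add_mem ?_ (Ideal.mem_sup_right hi)
      rw [this]
      exact Submodule.smul_of_tower_mem _ _ hEg
  intro f hf
  have h4 : (Ideal.Quotient.mk I f) ∈ (⨅ i : ℕ, m ^ i • ⊤ : Submodule (MvPolynomial σ K)
      (MvPolynomial σ K ⧸ I)) := by
    rw [Submodule.mem_iInf]
    intro k
    obtain ⟨g, hg, i, hi, rfl⟩ := Submodule.mem_sup.mp (h3 k f hf)
    have e : Ideal.Quotient.mk I (g + i) = g • (1 : MvPolynomial σ K ⧸ I) := by
      rw [map_add, Ideal.Quotient.eq_zero_iff_mem.mpr hi, add_zero, ← Ideal.Quotient.algebraMap_eq,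
        Algebra.algebraMap_eq_smul_one]
    rw [e]
    exact Submodule.smul_mem_smul (Ideal.pow_le_pow_right (Nat.le_succ k) hg) trivial
  obtain ⟨r, hr⟩ := (Ideal.mem_iInf_smul_pow_eq_bot_iff m _).mp h4
  refine ⟨1 - r, by simpa [sub_eq_iff_eq_add] using (hmm _).mp r.2, ?_⟩
  rw [← Ideal.Quotient.eq_zero_iff_mem, sub_mul, one_mul, map_sub, sub_eq_zero, ← hr]
  rw [map_mul]
  rfl

end Taylor

theorem isIrreducible_connectedComponent_one {G : Type*} [Group G] [TopologicalSpace G]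
    [TopologicalSpace.NoetherianSpace G] (hl : ∀ g : G, Continuous (g * ·)) :
    IsIrreducible (connectedComponent (1 : G)) ∧ IsOpen (connectedComponent (1 : G)) := by
  have himg : ∀ (g : G) (Z : Set G), IsIrreducible Z → IsIrreducible ((g * ·) '' Z) :=
    fun g Z hZ => hZ.image _ (hl g).continuousOn
  have hcomp : ∀ (g : G), ∀ Z ∈ irreducibleComponents G, (g * ·) '' Z ∈ irreducibleComponents G := by
    intro g Z hZ
    refine ⟨himg g Z hZ.1, fun W hW hle => ?_⟩
    have h1 : Z ≤ (g⁻¹ * ·) '' W := fun z hz => ⟨g * z, hle ⟨z, hz, rfl⟩, by simp⟩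
    have h2 := hZ.2 (himg g⁻¹ W hW) h1
    intro w hw
    exact ⟨g⁻¹ * w, h2 ⟨w, hw, rfl⟩, by simp⟩
  have hfin := TopologicalSpace.NoetherianSpace.finite_irreducibleComponents (α := G)
  let Z₁ := irreducibleComponent (1 : G)
  have hZ₁ : Z₁ ∈ irreducibleComponents G := irreducibleComponent_mem_irreducibleComponents 1
  have hclosed : ∀ s : Set (Set G), s ⊆ irreducibleComponents G → IsClosed (⋃₀ s) := fun s hs =>
    by
    rw [Set.sUnion_eq_biUnion]
    exact (hfin.subset hs).isClosed_biUnion fun t ht =>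
      isClosed_of_mem_irreducibleComponents t (hs ht)
  obtain ⟨x₀, hx₀, hx₀'⟩ : ∃ x₀ ∈ Z₁, ∀ Z ∈ irreducibleComponents G, x₀ ∈ Z → Z = Z₁ := by
    by_contra! hcon
    have hfin' : (irreducibleComponents G \ {Z₁}).Finite := hfin.subset Set.sdiff_subset
    have h := (isIrreducible_iff_sUnion_isClosed.mp hZ₁.1) hfin'.toFinset
      (fun z hz => isClosed_of_mem_irreducibleComponents z
        (by simp only [Set.Finite.mem_toFinset] at hz; exact hz.1))
      (fun x hx => by
        obtain ⟨Z, hZ, hxZ, hne⟩ := hcon x hx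
        exact ⟨Z, by simp [hZ, hne], hxZ⟩)
    obtain ⟨Z, hZ, hle⟩ := h
    simp only [Set.Finite.mem_toFinset, Set.mem_sdiff, Set.mem_singleton_iff] at hZ
    exact hZ.2 (le_antisymm (hZ₁.2 hZ.1.1 hle) hle)
  have huniq : ∀ x, ∀ Z ∈ irreducibleComponents G, ∀ Z' ∈ irreducibleComponents G,
      x ∈ Z → x ∈ Z' → Z = Z' := by
    intro x Z hZ Z' hZ' hx hx'
    have h1 := hx₀' _ (hcomp (x₀ * x⁻¹) Z hZ) ⟨x, hx, by simp⟩
    have h2 := hx₀' _ (hcomp (x₀ * x⁻¹) Z' hZ') ⟨x, hx', by simp⟩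
    exact (mul_right_injective (x₀ * x⁻¹)).image_injective (h1.trans h2.symm)
  have hopen : IsOpen Z₁ := by
    have : Z₁ = (⋃₀ (irreducibleComponents G \ {Z₁}))ᶜ := by
      ext x
      constructor
      · rintro hx ⟨Z, ⟨hZ, hne⟩, hxZ⟩
        exact hne (huniq x Z hZ Z₁ hZ₁ hxZ hx)
      · intro hx
        by_contra hx1
        refine hx ⟨irreducibleComponent x, ⟨irreducibleComponent_mem_irreducibleComponents x,
          fun h => hx1 ?_⟩, mem_irreducibleComponent⟩
        rw [← show irreducibleComponent x = Z₁ from h]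
        exact mem_irreducibleComponent
    rw [this]
    exact (hclosed _ Set.sdiff_subset).isOpen_compl
  have heq : connectedComponent (1 : G) = Z₁ :=
    Set.Subset.antisymm
      (IsClopen.connectedComponent_subset
        ⟨isClosed_of_mem_irreducibleComponents _ hZ₁, hopen⟩ mem_irreducibleComponent)
      (hZ₁.1.isPreirreducible.isPreconnected.subset_connectedComponent mem_irreducibleComponent)
  rw [heq]
  exact ⟨hZ₁.1, hopen⟩

theorem div_mem_connectedComponent_one {G : Type*} [Group G] [TopologicalSpace G]
    (hl : ∀ g : G, Continuous (g * ·)) {g h : G} (hg : g ∈ connectedComponent (1 : G))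
    (hh : h ∈ connectedComponent (1 : G)) : g⁻¹ * h ∈ connectedComponent (1 : G) :=
  (isPreconnected_connectedComponent.image _ (hl g⁻¹).continuousOn).subset_connectedComponent
    ⟨g, hg, by simp⟩ ⟨h, hh, rfl⟩

theorem conj_mem_connectedComponent_one {G : Type*} [Group G] [TopologicalSpace G]
    (hl : ∀ g : G, Continuous (g * ·)) (hr : ∀ g : G, Continuous (· * g)) (h : G) {g : G}
    (hg : g ∈ connectedComponent (1 : G)) : h * g * h⁻¹ ∈ connectedComponent (1 : G) :=
  (isPreconnected_connectedComponent.image (fun x => h * x * h⁻¹)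
    ((hr h⁻¹).comp (hl h)).continuousOn).subset_connectedComponent
    ⟨1, mem_connectedComponent, by simp⟩ ⟨g, hg, rfl⟩

section GeneralLinear

/-- The index set of the coordinates on `GL_N`. -/
abbrev GLIndex (N : ℕ) := Unit × ((Fin N × Fin N) ⊕ (Fin N × Fin N))

/-- Polynomials in the entries of a matrix and of its inverse. -/
abbrev GLPoly (K : Type) [Field K] (N : ℕ) := MvPolynomial (GLIndex N) K

variable {K : Type} [Field K] {N : ℕ}

/-- The coordinate assignment sending the entries of the matrix to `A` and those of its inverse
to `B`. -/
def matSubst {R : Type*} (A B : Matrix (Fin N) (Fin N) R) :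
    GLIndex N → R := fun p =>
  Sum.elim (fun q => A q.1 q.2) (fun q => B q.1 q.2) p.2

/-- The generic matrix. -/
noncomputable def xMat (K : Type) [Field K] (N : ℕ) : Matrix (Fin N) (Fin N)
    (GLPoly K N) :=
  Matrix.of fun i j => X ((), Sum.inl (i, j))

/-- The generic inverse matrix. -/
noncomputable def yMat (K : Type) [Field K] (N : ℕ) : Matrix (Fin N) (Fin N)
    (GLPoly K N) :=
  Matrix.of fun i j => X ((), Sum.inr (i, j))

/-- The point of the coordinate space attached to an invertible matrix. -/
noncomputable def glPt (g : GL (Fin N) K) : GLIndex N → K :=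
  matSubst (g : Matrix (Fin N) (Fin N) K) ((g⁻¹ : GL (Fin N) K) : Matrix (Fin N) (Fin N) K)

theorem glCoords_eq_glPt (g : GL (Fin N) K) : glCoords K N (fun _ : Unit => g) = glPt g := by
  funext p
  simp [glCoords, glPt, matSubst]

theorem xMat_map_eval (A B : Matrix (Fin N) (Fin N) K) :
    (xMat K N).map (eval (matSubst A B)) = A := by
  ext i j; simp [xMat, matSubst]

theorem yMat_map_eval (A B : Matrix (Fin N) (Fin N) K) :
    (yMat K N).map (eval (matSubst A B)) = B := by
  ext i j; simp [yMat, matSubst]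

theorem map_matSubst {R S : Type*} (f : R → S) (A B : Matrix (Fin N) (Fin N) R) :
    (fun p => f (matSubst A B p)) = matSubst (A.map f) (B.map f) := by
  funext ⟨_, p⟩
  cases p <;> rfl

/-- Pull-back of functions along a left translation. -/
noncomputable def leftTranslate (g : GL (Fin N) K) :
    GLPoly K N →ₐ[K]
    GLPoly K N :=
  aeval (matSubst ((g : Matrix (Fin N) (Fin N) K).map C * xMat K N)
    (yMat K N * ((g⁻¹ : GL (Fin N) K) : Matrix (Fin N) (Fin N) K).map C))

/-- Pull-back of functions along a right translation. -/
noncomputable def rightTranslate (g : GL (Fin N) K) :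
    GLPoly K N →ₐ[K]
    GLPoly K N :=
  aeval (matSubst (xMat K N * (g : Matrix (Fin N) (Fin N) K).map C)
    (((g⁻¹ : GL (Fin N) K) : Matrix (Fin N) (Fin N) K).map C * yMat K N))

theorem eval_aeval_matSubst {σ : Type*} (p : σ → K)
    (A B : Matrix (Fin N) (Fin N) (MvPolynomial σ K)) (P) :
    eval p (aeval (matSubst A B) P) = eval (matSubst (A.map (eval p)) (B.map (eval p))) P := by
  rw [← map_matSubst]
  have h := comp_aeval_apply (matSubst A B) (aeval p : MvPolynomial σ K →ₐ[K] K) P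
  exact h

theorem map_C_map_eval {σ : Type*} (p : σ → K) (A : Matrix (Fin N) (Fin N) K) :
    (A.map (C : K →+* MvPolynomial σ K)).map (eval p) = A := by
  ext; simp

theorem eval_leftTranslate (g h : GL (Fin N) K) (P) :
    eval (glPt h) (leftTranslate g P) = eval (glPt (g * h)) P := by
  rw [leftTranslate, eval_aeval_matSubst]
  congr 2
  simp only [Matrix.map_mul, map_C_map_eval, glPt, xMat_map_eval, yMat_map_eval]
  simp

theorem eval_rightTranslate (g h : GL (Fin N) K) (P) :
    eval (glPt h) (rightTranslate g P) = eval (glPt (h * g)) P := by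
  rw [rightTranslate, eval_aeval_matSubst]
  congr 2
  simp only [Matrix.map_mul, map_C_map_eval, glPt, xMat_map_eval, yMat_map_eval]
  simp

end GeneralLinear

section IdentityComponent
variable {K : Type} [Field K] {N : ℕ}

/-- The kernel of evaluation, as a point of the spectrum. -/
noncomputable def specPt (g : GL (Fin N) K) : PrimeSpectrum (GLPoly K N) :=
  ⟨RingHom.ker (eval (glPt g)), RingHom.ker_isPrime _⟩

theorem zarTop_eq_induced (H : Subgroup (GL (Fin N) K)) :
    zarTop K N H = TopologicalSpace.induced (fun h : H => specPt (h : GL (Fin N) K)) inferInstance := by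
  rw [PrimeSpectrum.isTopologicalBasis_basic_opens.eq_generateFrom, induced_generateFrom_eq, zarTop]
  congr 1
  ext U
  constructor
  · rintro ⟨f, ⟨P, hP⟩, rfl⟩
    refine ⟨_, ⟨P, rfl⟩, ?_⟩
    ext h
    simp only [Set.mem_preimage, Set.mem_ofPred_eq, hP, glCoords_eq_glPt]
    rfl
  · rintro ⟨_, ⟨P, rfl⟩, rfl⟩
    refine ⟨fun g => eval (glCoords K N fun i => (g i : GL (Fin N) K)) P, ⟨P, fun g => rfl⟩, ?_⟩
    ext h
    simp only [Set.mem_preimage, Set.mem_ofPred_eq, glCoords_eq_glPt]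
    rfl

/-- The ideal of polynomials vanishing on a subgroup. -/
noncomputable def vanIdeal (G : Subgroup (GL (Fin N) K)) : Ideal (GLPoly K N) :=
  ⨅ g : G, RingHom.ker (eval (glPt (g : GL (Fin N) K)))

theorem mem_vanIdeal {G : Subgroup (GL (Fin N) K)} {P : GLPoly K N} :
    P ∈ vanIdeal G ↔ ∀ g ∈ G, eval (glPt g) P = 0 := by
  simp [vanIdeal, RingHom.mem_ker]

theorem exists_identityComponent_subgroup (H : Subgroup (GL (Fin N) K)) (hH : IsZarClosed K N H) :
    ∃ G : Subgroup (GL (Fin N) K), G ≤ H ∧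
      (∀ h : H, h ∈ identityComponent K N H ↔ (h : GL (Fin N) K) ∈ G) ∧
      (∀ h ∈ H, ∀ g ∈ G, h * g * h⁻¹ ∈ G) ∧
      (G.subgroupOf H).FiniteIndex ∧
      (vanIdeal G).IsPrime ∧
      (∀ u : GL (Fin N) K, (∀ P ∈ vanIdeal G, eval (glPt u) P = 0) → u ∈ G) ∧
      ∃ u : GLPoly K N, eval (glPt 1) u ≠ 0 ∧ ∀ h ∈ H, h ∉ G → eval (glPt h) u = 0 := by
  let := zarTop K N H
  have hind : Topology.IsInducing (fun h : H => specPt (h : GL (Fin N) K)) :=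
    ⟨zarTop_eq_induced H⟩
  have : TopologicalSpace.NoetherianSpace H := hind.noetherianSpace
  have hopen : ∀ P : GLPoly K N, IsOpen {h : H | eval (glPt (h : GL (Fin N) K)) P ≠ 0} := fun P =>
    (PrimeSpectrum.basicOpen P).2.preimage hind.continuous
  have hbasis : ∀ U : Set H, IsOpen U → ∀ x ∈ U, ∃ P : GLPoly K N,
      eval (glPt (x : GL (Fin N) K)) P ≠ 0 ∧
      ∀ h : H, eval (glPt (h : GL (Fin N) K)) P ≠ 0 → h ∈ U := by
    intro U hU x hx
    obtain ⟨V, hV, rfl⟩ := hind.isOpen_iff.mp hU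
    obtain ⟨_, ⟨P, rfl⟩, hxP, hPV⟩ :=
      PrimeSpectrum.isTopologicalBasis_basic_opens.exists_subset_of_mem_open hx hV
    exact ⟨P, hxP, fun h hh => hPV hh⟩
  have hcont : ∀ φ : H → H, (∀ P : GLPoly K N, ∃ Q : GLPoly K N, ∀ h : H,
      eval (glPt (φ h : GL (Fin N) K)) P = eval (glPt (h : GL (Fin N) K)) Q) → Continuous φ := by
    intro φ hφ
    rw [hind.continuous_iff, PrimeSpectrum.isTopologicalBasis_basic_opens.continuous_iff]
    rintro _ ⟨P, rfl⟩
    obtain ⟨Q, hQ⟩ := hφ P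
    convert hopen Q using 1
    ext h
    rw [Set.mem_ofPred_eq, ← hQ]
    rfl
  have hl : ∀ g : H, Continuous (g * ·) := fun g => hcont _ fun P =>
    ⟨leftTranslate g P, fun h => by rw [eval_leftTranslate]; rfl⟩
  have hr : ∀ g : H, Continuous (· * g) := fun g => hcont _ fun P =>
    ⟨rightTranslate g P, fun h => by rw [eval_rightTranslate]; rfl⟩
  obtain ⟨hirr, hCo⟩ := isIrreducible_connectedComponent_one hl
  let G₀ : Subgroup H :=
    { carrier := connectedComponent 1
      mul_mem' := fun {a b} ha hb => by
        have ha' : a⁻¹ ∈ connectedComponent (1 : H) := by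
          simpa using div_mem_connectedComponent_one hl ha mem_connectedComponent
        simpa using div_mem_connectedComponent_one hl ha' hb
      one_mem' := mem_connectedComponent
      inv_mem' := fun {a} ha => by
        simpa using div_mem_connectedComponent_one hl ha mem_connectedComponent }
  have hG₀ : ∀ h, h ∈ G₀ ↔ h ∈ connectedComponent (1 : H) := fun h => Iff.rfl
  have hmem : ∀ h : H, (h : GL (Fin N) K) ∈ G₀.map H.subtype ↔ h ∈ G₀ := fun h => by
    constructor
    · rintro ⟨g, hg, he⟩
      rwa [← show g = h from Subtype.ext he]
    · exact fun hh => ⟨h, hh, rfl⟩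
  have hle : G₀.map H.subtype ≤ H := by
    rintro _ ⟨h, -, rfl⟩
    exact h.2
  refine ⟨G₀.map H.subtype, hle, fun h => (hmem h).symm, ?_, ?_, ?_, ?_, ?_⟩
  · intro h hh g hg
    have := conj_mem_connectedComponent_one hl hr ⟨h, hh⟩ ((hmem ⟨g, hle hg⟩).mp hg)
    exact (hmem _).mpr this
  · have he : (G₀.map H.subtype).subgroupOf H = G₀ := by
      ext h
      rw [Subgroup.mem_subgroupOf, hmem]
    rw [he]
    refine Subgroup.finiteIndex_iff_finite_quotient.mpr ?_
    have hq : ∀ U : Set (H ⧸ G₀), IsOpen ((QuotientGroup.mk : H → H ⧸ G₀) ⁻¹' U) := by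
      intro U
      rw [isOpen_iff_forall_mem_open]
      intro x hx
      refine ⟨(x⁻¹ * ·) ⁻¹' connectedComponent 1, fun y hy => ?_, hCo.preimage (hl x⁻¹), ?_⟩
      · have : (QuotientGroup.mk x : H ⧸ G₀) = QuotientGroup.mk y := QuotientGroup.eq.mpr hy
        rw [Set.mem_preimage, ← this]
        exact hx
      · simpa using mem_connectedComponent
    let : TopologicalSpace (H ⧸ G₀) := ⊥
    have : DiscreteTopology (H ⧸ G₀) := ⟨rfl⟩
    have hc : Continuous (QuotientGroup.mk : H → H ⧸ G₀) := ⟨fun U _ => hq U⟩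
    have : CompactSpace (H ⧸ G₀) := by
      rw [← isCompact_univ_iff, ← (QuotientGroup.mk_surjective (s := G₀)).range_eq]
      exact isCompact_range hc
    exact finite_of_compact_of_discrete
  · refine ⟨?_, fun {P Q} hPQ => ?_⟩
    · rw [Ne, Ideal.eq_top_iff_one, mem_vanIdeal]
      intro h
      simpa using h 1 (one_mem _)
    · by_contra! hcon
      simp only [mem_vanIdeal, not_forall] at hcon hPQ
      obtain ⟨⟨g, hg, hgP⟩, ⟨h, hh, hhQ⟩⟩ := hcon
      obtain ⟨x, hx, hxP, hxQ⟩ := hirr.isPreirreducible _ _ (hopen P) (hopen Q)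
        ⟨⟨g, hle hg⟩, (hmem ⟨g, hle hg⟩).mp hg, hgP⟩ ⟨⟨h, hle hh⟩, (hmem ⟨h, hle hh⟩).mp hh, hhQ⟩
      have := hPQ x ((hmem x).mpr hx)
      rw [map_mul] at this
      exact (mul_ne_zero hxP hxQ) this
  · intro u hu
    obtain ⟨S, hS⟩ := hH
    have huH : u ∈ H := by
      refine (hS u).mpr fun P hP => ?_
      rw [glCoords_eq_glPt]
      refine hu P (mem_vanIdeal.mpr fun g hg => ?_)
      rw [← glCoords_eq_glPt]
      exact (hS g).mp (hle hg) P hP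
    by_contra hcon
    obtain ⟨P, hP1, hP2⟩ := hbasis _ isClosed_connectedComponent.isOpen_compl ⟨u, huH⟩
      (fun h => hcon ((hmem ⟨u, huH⟩).mpr h))
    refine hP1 (hu P (mem_vanIdeal.mpr fun g hg => ?_))
    by_contra hgP
    exact hP2 ⟨g, hle hg⟩ hgP ((hmem ⟨g, hle hg⟩).mp hg)
  · obtain ⟨P, hP1, hP2⟩ := hbasis _ hCo 1 mem_connectedComponent
    refine ⟨P, by simpa using hP1, fun h hh hhG => ?_⟩
    by_contra hne
    exact hhG ((hmem ⟨h, hh⟩).mpr (hP2 ⟨h, hh⟩ hne))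

end IdentityComponent

attribute [local instance] LieRing.ofAssociativeRing

section InvariantDerivation
variable {K : Type} [Field K] {N : ℕ}

/-- The left-invariant derivation attached to a matrix. -/
noncomputable def invDer (Z : Matrix (Fin N) (Fin N) K) :
    Derivation K (GLPoly K N) (GLPoly K N) :=
  mkDerivation K (matSubst (xMat K N * Z.map C) (-(Z.map C * yMat K N)))

theorem invDer_X (Z : Matrix (Fin N) (Fin N) K) (p : GLIndex N) :
    invDer Z (X p) = matSubst (xMat K N * Z.map C) (-(Z.map C * yMat K N)) p :=
  mkDerivation_X _ _ _

theorem xMat_map_invDer (Z : Matrix (Fin N) (Fin N) K) :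
    (xMat K N).map (invDer Z) = xMat K N * Z.map C := by
  ext1 i j
  simp only [Matrix.map_apply, xMat, Matrix.of_apply, invDer_X]
  rfl

theorem yMat_map_invDer (Z : Matrix (Fin N) (Fin N) K) :
    (yMat K N).map (invDer Z) = -(Z.map C * yMat K N) := by
  ext1 i j
  simp only [Matrix.map_apply, yMat, Matrix.of_apply, invDer_X]
  rfl

theorem Derivation.matrix_map_mul {K R : Type*} [CommRing K] [CommRing R] [Algebra K R] {l m n : Type*}
    [Fintype m] (D : Derivation K R R) (A : Matrix l m R) (B : Matrix m n R) :
    (A * B).map D = A.map D * B + A * B.map D := by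
  ext1 i j
  simp only [Matrix.map_apply, Matrix.mul_apply, Matrix.add_apply, map_sum, Derivation.leibniz,
    smul_eq_mul, Finset.sum_add_distrib]
  rw [add_comm]
  congr 1
  exact Finset.sum_congr rfl fun _ _ => mul_comm _ _

theorem Derivation.map_C_map {σ : Type*} {l m : Type*}
    (D : Derivation K (MvPolynomial σ K) (MvPolynomial σ K)) (A : Matrix l m K) :
    (A.map (C : K →+* MvPolynomial σ K)).map D = 0 := by
  ext1 i j
  simp

theorem matrix_map_neg {R S F : Type*} [Ring R] [Ring S] [FunLike F R S] [AddMonoidHomClass F R S]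
    (f : F) {l m : Type*} (A : Matrix l m R) : (-A).map f = -(A.map f) := by
  ext1 i j
  simp

theorem invDer_commutator (Z W : Matrix (Fin N) (Fin N) K) :
    ⁅invDer Z, invDer W⁆ = invDer ⁅Z, W⁆ := by
  refine MvPolynomial.derivation_ext fun p => ?_
  have hx : ((xMat K N).map (invDer W)).map (invDer Z) - ((xMat K N).map (invDer Z)).map (invDer W)
      = (xMat K N).map (invDer ⁅Z, W⁆) := by
    simp only [xMat_map_invDer, Derivation.matrix_map_mul, Derivation.map_C_map, Ring.lie_def,
      mul_zero, add_zero]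
    rw [Matrix.map_sub C (by simp), Matrix.map_mul, Matrix.map_mul]
    noncomm_ring
  have hy : ((yMat K N).map (invDer W)).map (invDer Z) - ((yMat K N).map (invDer Z)).map (invDer W)
      = (yMat K N).map (invDer ⁅Z, W⁆) := by
    simp only [yMat_map_invDer, matrix_map_neg, Derivation.matrix_map_mul, Derivation.map_C_map,
      Ring.lie_def, zero_mul, zero_add]
    rw [Matrix.map_sub C (by simp), Matrix.map_mul, Matrix.map_mul]
    noncomm_ring
  rw [Derivation.commutator_apply]
  obtain ⟨_, p | p⟩ := p
  · exact congrFun (congrFun hx p.1) p.2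
  · exact congrFun (congrFun hy p.1) p.2

theorem invDer_add (Z W : Matrix (Fin N) (Fin N) K) : invDer (Z + W) = invDer Z + invDer W := by
  refine MvPolynomial.derivation_ext fun p => ?_
  rw [Derivation.add_apply, invDer_X, invDer_X, invDer_X, Matrix.map_add C (by simp), mul_add,
    add_mul, neg_add]
  obtain ⟨_, p | p⟩ := p <;> rfl

theorem invDer_smul (c : K) (Z : Matrix (Fin N) (Fin N) K) : invDer (c • Z) = c • invDer Z := by
  refine MvPolynomial.derivation_ext fun p => ?_
  rw [Derivation.smul_apply, invDer_X, invDer_X]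
  have h : (c • Z).map (C : K →+* GLPoly K N) = c • Z.map C := by
    ext1 i j
    simp [MvPolynomial.smul_eq_C_mul]
  rw [h, Matrix.mul_smul, Matrix.smul_mul, ← smul_neg]
  obtain ⟨_, p | p⟩ := p <;> rfl

theorem algHom_invDer (φ : GLPoly K N →ₐ[K] GLPoly K N) (Z W : Matrix (Fin N) (Fin N) K)
    (hx : (xMat K N * Z.map C).map φ = ((xMat K N).map φ).map (invDer W))
    (hy : (-(Z.map C * yMat K N)).map φ = ((yMat K N).map φ).map (invDer W)) (P) :
    φ (invDer Z P) = invDer W (φ P) := by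
  have hX : ∀ p, φ (invDer Z (X p)) = invDer W (φ (X p)) := by
    rintro ⟨_, p | p⟩
    · rw [invDer_X]
      exact congrFun (congrFun hx p.1) p.2
    · rw [invDer_X]
      exact congrFun (congrFun hy p.1) p.2
  induction P using MvPolynomial.induction_on with
  | C a => simp [← algebraMap_eq]
  | add f g hf hg => simp [hf, hg]
  | mul_X f p hf => simp [hf, hX]

theorem xMat_map_leftTranslate (g : GL (Fin N) K) :
    (xMat K N).map (leftTranslate g) = (g : Matrix (Fin N) (Fin N) K).map C * xMat K N := by
  ext1 i j
  simp only [Matrix.map_apply, xMat, Matrix.of_apply, leftTranslate, aeval_X]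
  rfl

theorem yMat_map_leftTranslate (g : GL (Fin N) K) :
    (yMat K N).map (leftTranslate g) =
      yMat K N * ((g⁻¹ : GL (Fin N) K) : Matrix (Fin N) (Fin N) K).map C := by
  ext1 i j
  simp only [Matrix.map_apply, yMat, Matrix.of_apply, leftTranslate, aeval_X]
  rfl

theorem xMat_map_rightTranslate (g : GL (Fin N) K) :
    (xMat K N).map (rightTranslate g) = xMat K N * (g : Matrix (Fin N) (Fin N) K).map C := by
  ext1 i j
  simp only [Matrix.map_apply, xMat, Matrix.of_apply, rightTranslate, aeval_X]
  rfl

theorem yMat_map_rightTranslate (g : GL (Fin N) K) :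
    (yMat K N).map (rightTranslate g) =
      ((g⁻¹ : GL (Fin N) K) : Matrix (Fin N) (Fin N) K).map C * yMat K N := by
  ext1 i j
  simp only [Matrix.map_apply, yMat, Matrix.of_apply, rightTranslate, aeval_X]
  rfl

theorem map_C_map_algHom {σ τ : Type*} {l m : Type*} (φ : MvPolynomial σ K →ₐ[K] MvPolynomial τ K)
    (A : Matrix l m K) : (A.map (C : K →+* MvPolynomial σ K)).map φ = A.map C := by
  ext1 i j
  exact MvPolynomial.algHom_C φ (A i j)

theorem leftTranslate_invDer (g : GL (Fin N) K) (Z : Matrix (Fin N) (Fin N) K) (P) :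
    leftTranslate g (invDer Z P) = invDer Z (leftTranslate g P) := by
  apply algHom_invDer
  · simp only [Matrix.map_mul, xMat_map_leftTranslate, map_C_map_algHom,
      Derivation.matrix_map_mul, Derivation.map_C_map, xMat_map_invDer, zero_mul, zero_add,
      mul_assoc]
  · simp only [matrix_map_neg, Matrix.map_mul, yMat_map_leftTranslate, map_C_map_algHom,
      Derivation.matrix_map_mul, Derivation.map_C_map, yMat_map_invDer, mul_zero, add_zero,
      mul_assoc, neg_mul]

theorem rightTranslate_invDer (g : GL (Fin N) K) (Z : Matrix (Fin N) (Fin N) K) (P) :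
    rightTranslate g (invDer (((g⁻¹ : GL (Fin N) K) : Matrix (Fin N) (Fin N) K) * Z *
        (g : Matrix (Fin N) (Fin N) K)) P) =
      invDer Z (rightTranslate g P) := by
  have h : (g : Matrix (Fin N) (Fin N) K).map (C : K →+* GLPoly K N) *
      ((g⁻¹ : GL (Fin N) K) : Matrix (Fin N) (Fin N) K).map C = 1 := by
    rw [← Matrix.map_mul, ← Units.val_mul, mul_inv_cancel, Units.val_one,
      Matrix.map_one C (map_zero _) (map_one _)]
  apply algHom_invDer
  · simp only [Matrix.map_mul, xMat_map_rightTranslate, map_C_map_algHom,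
      Derivation.matrix_map_mul, Derivation.map_C_map, xMat_map_invDer, mul_zero, add_zero]
    simp only [← mul_assoc]
    rw [mul_assoc (xMat K N), h, mul_one]
  · simp only [matrix_map_neg, Matrix.map_mul, yMat_map_rightTranslate, map_C_map_algHom,
      Derivation.matrix_map_mul, Derivation.map_C_map, yMat_map_invDer, zero_mul, zero_add]
    simp only [mul_assoc, mul_neg]
    rw [← mul_assoc (Matrix.map _ _) (Matrix.map _ _) (yMat K N), h, one_mul]

theorem eval_invDer (g : GL (Fin N) K) (Z : Matrix (Fin N) (Fin N) K) (P) :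
    eval (glPt g) (invDer Z P) = eval (glPt 1) (invDer Z (leftTranslate g P)) := by
  rw [← leftTranslate_invDer, eval_leftTranslate, mul_one]

/-- The Lie algebra of a subgroup of the general linear group. -/
noncomputable def lieAlg (G : Subgroup (GL (Fin N) K)) :
    LieSubalgebra K (Matrix (Fin N) (Fin N) K) where
  carrier := {Z | ∀ f ∈ vanIdeal G, invDer Z f ∈ vanIdeal G}
  add_mem' := fun ha hb f hf => by
    rw [invDer_add]
    exact add_mem (ha f hf) (hb f hf)
  zero_mem' := fun f hf => by
    have : invDer (0 : Matrix (Fin N) (Fin N) K) = 0 := by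
      rw [← zero_smul K (0 : Matrix (Fin N) (Fin N) K), invDer_smul, zero_smul]
    rw [this]
    exact zero_mem _
  smul_mem' := fun c Z hZ f hf => by
    rw [invDer_smul, Derivation.smul_apply, smul_eq_C_mul]
    exact Ideal.mul_mem_left _ _ (hZ f hf)
  lie_mem' := fun ha hb f hf => by
    rw [← invDer_commutator, Derivation.commutator_apply]
    exact sub_mem (ha _ (hb f hf)) (hb _ (ha f hf))

variable {G H : Subgroup (GL (Fin N) K)} {Z : Matrix (Fin N) (Fin N) K}

theorem invDer_mem_vanIdeal (hZ : Z ∈ lieAlg G) {f} (hf : f ∈ vanIdeal G) :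
    invDer Z f ∈ vanIdeal G := hZ f hf

theorem leftTranslate_mem_vanIdeal {g : GL (Fin N) K} (hg : g ∈ G) {f} (hf : f ∈ vanIdeal G) :
    leftTranslate g f ∈ vanIdeal G :=
  mem_vanIdeal.mpr fun h hh => by
    rw [eval_leftTranslate]
    exact mem_vanIdeal.mp hf _ (mul_mem hg hh)

theorem mem_lieAlg : Z ∈ lieAlg G ↔ ∀ f ∈ vanIdeal G, eval (glPt 1) (invDer Z f) = 0 := by
  refine ⟨fun h f hf => mem_vanIdeal.mp (h f hf) 1 (one_mem G), fun h f hf => ?_⟩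
  refine mem_vanIdeal.mpr fun g hg => ?_
  rw [eval_invDer]
  exact h _ (leftTranslate_mem_vanIdeal hg hf)

/-- The Lie algebra only depends on a neighbourhood of the identity. -/
theorem mem_lieAlg_of_open {u : GLPoly K N} (hu : eval (glPt 1) u ≠ 0)
    (hu' : ∀ h ∈ H, h ∉ G → eval (glPt h) u = 0) (hZ : Z ∈ lieAlg H) : Z ∈ lieAlg G := by
  refine mem_lieAlg.mpr fun f hf => ?_
  have huf : u * f ∈ vanIdeal H := mem_vanIdeal.mpr fun h hh => by
    by_cases hG : h ∈ G
    · rw [map_mul, mem_vanIdeal.mp hf h hG, mul_zero]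
    · rw [map_mul, hu' h hh hG, zero_mul]
  have h1 := mem_lieAlg.mp hZ _ huf
  rw [Derivation.leibniz, map_add, smul_eq_mul, smul_eq_mul, map_mul, map_mul,
    mem_vanIdeal.mp hf 1 (one_mem G), zero_mul, add_zero] at h1
  exact (mul_eq_zero.mp h1).resolve_left hu

theorem conj_mem_lieAlg {h : GL (Fin N) K} (hh : ∀ g ∈ G, h * g * h⁻¹ ∈ G) (hZ : Z ∈ lieAlg G) :
    (h : Matrix (Fin N) (Fin N) K) * Z * ((h⁻¹ : GL (Fin N) K) : Matrix (Fin N) (Fin N) K) ∈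
      lieAlg G := by
  refine mem_lieAlg.mpr fun f hf => ?_
  have h1 := rightTranslate_invDer h⁻¹ Z f
  rw [inv_inv] at h1
  have h2 := congrArg (eval (glPt h)) h1
  rw [eval_rightTranslate, mul_inv_cancel, eval_invDer h] at h2
  rw [h2]
  refine mem_lieAlg.mp hZ _ (mem_vanIdeal.mpr fun g hg => ?_)
  rw [eval_leftTranslate, eval_rightTranslate]
  exact mem_vanIdeal.mp hf _ (hh g hg)

theorem eval_invDer_X_one (p : GLIndex N) : eval (glPt 1) (invDer Z (X p)) = matSubst Z (-Z) p := by
  rw [invDer_X]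
  have h := congrFun (map_matSubst (eval (glPt (1 : GL (Fin N) K))) (xMat K N * Z.map C)
    (-(Z.map C * yMat K N))) p
  refine h.trans ?_
  simp only [matrix_map_neg, Matrix.map_mul, map_C_map_eval, glPt, xMat_map_eval, yMat_map_eval]
  simp

/-- Tangent vectors at the identity come from the Lie algebra. -/
theorem exists_mem_lieAlg_of_tangent (v : GLIndex N → K)
    (hv : ∀ f ∈ vanIdeal G, ∑ i, eval (glPt 1) (pderiv i f) * v i = 0) :
    ∃ Z ∈ lieAlg G, ∀ i, eval (glPt 1) (invDer Z (X i)) = v i := by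
  let Z : Matrix (Fin N) (Fin N) K := Matrix.of fun i j => v ((), Sum.inl (i, j))
  let W : Matrix (Fin N) (Fin N) K := Matrix.of fun i j => v ((), Sum.inr (i, j))
  have hvZ : v = matSubst Z W := by
    funext ⟨_, p⟩
    cases p <;> rfl
  let D : Derivation K (GLPoly K N) (GLPoly K N) := mkDerivation K fun i => C (v i)
  have hD : ∀ f, eval (glPt 1) (D f) = ∑ i, eval (glPt 1) (pderiv i f) * v i := fun f => by
    rw [eval_derivation]
    simp [D, mkDerivation_X]
  have hDx : (xMat K N).map D = Z.map C := by
    ext1 i j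
    simp [xMat, D, mkDerivation_X, Z]
  have hDy : (yMat K N).map D = W.map C := by
    ext1 i j
    simp [yMat, D, mkDerivation_X, W]
  have hZW : W = -Z := by
    have h0 : ((xMat K N * yMat K N - 1).map D).map (eval (glPt 1)) = 0 := by
      ext1 i j
      simp only [Matrix.map_apply, Matrix.zero_apply]
      rw [hD]
      refine hv _ (mem_vanIdeal.mpr fun g _ => ?_)
      have h1 : (xMat K N * yMat K N - 1).map (eval (glPt g)) = 0 := by
        rw [Matrix.map_sub _ (by simp), Matrix.map_mul, glPt, xMat_map_eval, yMat_map_eval,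
          ← Units.val_mul]
        simp
      exact congrFun (congrFun h1 i) j
    have h2 : (1 : Matrix (Fin N) (Fin N) (GLPoly K N)).map D = 0 := by
      ext1 i j
      by_cases hij : i = j <;> simp [hij]
    rw [Matrix.map_sub _ (by simp), h2, sub_zero, Derivation.matrix_map_mul, hDx, hDy,
      Matrix.map_add _ (by simp), Matrix.map_mul, Matrix.map_mul, map_C_map_eval, map_C_map_eval,
      glPt, xMat_map_eval, yMat_map_eval] at h0
    simp only [inv_one, Units.val_one, one_mul, mul_one] at h0
    exact eq_neg_of_add_eq_zero_right h0
  have hval : ∀ i, eval (glPt 1) (invDer Z (X i)) = v i := fun i => by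
    rw [eval_invDer_X_one, hvZ, hZW]
  refine ⟨Z, mem_lieAlg.mpr fun f hf => ?_, hval⟩
  rw [eval_derivation, ← hv f hf]
  exact Finset.sum_congr rfl fun i _ => by rw [hval]

end InvariantDerivation

section LieHom

theorem exists_isCompl_of_lieHom {K L W : Type} [Field K] [CharZero K] [IsAlgClosed K] [LieRing L]
    [LieAlgebra K L] [Module.Finite K L] [AddCommGroup W] [Module K W] [Module.Finite K W]
    (hL : IsReductiveAlg K L) (φ : L →ₗ⁅K⁆ Module.End K W)
    (hss : ∀ z ∈ center K L, (φ z).IsSemisimple) (U : Submodule K W)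
    (hU : ∀ x, ∀ w ∈ U, φ x w ∈ U) :
    ∃ U' : Submodule K W, (∀ x, ∀ w ∈ U', φ x w ∈ U') ∧ IsCompl U U' := by
  let _i : LieRingModule L W := LieRingModule.compLieHom W φ
  have _j : LieModule K L W := LieModule.compLieHom W φ
  obtain ⟨N', hN'⟩ := exists_isCompl_of_isReductiveAlg hL (M := W)
    (fun z hz => hss z hz) { U with lie_mem := fun {x w} hw => hU x w hw }
  exact ⟨N'.toSubmodule, fun x w hw => N'.lie_mem (x := x) hw, hN'⟩

theorem isReductiveAlg_of_lieHom {K L W : Type} [Field K] [CharZero K] [IsAlgClosed K] [LieRing L]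
    [LieAlgebra K L] [Module.Finite K L] [AddCommGroup W] [Module K W] [Module.Finite K W]
    (φ : L →ₗ⁅K⁆ Module.End K W) (hφ : Function.Injective φ)
    (hss : ∀ U : Submodule K W, (∀ x, ∀ w ∈ U, φ x w ∈ U) →
      ∃ U' : Submodule K W, (∀ x, ∀ w ∈ U', φ x w ∈ U') ∧ IsCompl U U') :
    IsReductiveAlg K L ∧ ∀ z ∈ center K L, ⨆ a, (φ z).eigenspace a = ⊤ := by
  let _i : LieRingModule L W := LieRingModule.compLieHom W φ
  have _j : LieModule K L W := LieModule.compLieHom W φ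
  refine isReductiveAlg_of_semisimple_faithful (M := W) (fun x hx => ?_) fun U => ?_
  · exact (map_eq_zero_iff φ hφ).mp (LinearMap.ext hx)
  · obtain ⟨U', h1, h2⟩ := hss U.toSubmodule fun x w hw => U.lie_mem (x := x) hw
    exact ⟨{ U' with lie_mem := fun {x w} hw => h1 x w hw },
      (LieSubmodule.isCompl_toSubmodule).mp h2⟩

end LieHom

section Differential
variable {K : Type} [Field K] {N : ℕ} {W : Type} [AddCommGroup W] [Module K W]

/-- `δ` is the differential of the rational representation `ρ`, expressed through its matrix
coefficients. -/
def HasDifferential (ρ : GL (Fin N) K → Module.End K W)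
    (δ : Matrix (Fin N) (Fin N) K → Module.End K W) : Prop :=
  ∀ l : Module.Dual K W, ∃ c : W →ₗ[K] GLPoly K N,
    (∀ g w, eval (glPt g) (c w) = l (ρ g w)) ∧ ∀ Z w, invDer Z (c w) = c (δ Z w)

variable {ρ : GL (Fin N) K → Module.End K W} {δ : Matrix (Fin N) (Fin N) K → Module.End K W}
  {G : Subgroup (GL (Fin N) K)}

theorem HasDifferential.of_separating [Module.Finite K W] (S : Set (Module.Dual K W))
    (hS : ∀ w, (∀ l ∈ S, l w = 0) → w = 0)
    (h : ∀ l ∈ S, ∃ c : W →ₗ[K] GLPoly K N,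
      (∀ g w, eval (glPt g) (c w) = l (ρ g w)) ∧ ∀ Z w, invDer Z (c w) = c (δ Z w)) :
    HasDifferential ρ δ := by
  have hspan : Submodule.span K S = ⊤ := by
    rw [← Subspace.dualCoannihilator_dualAnnihilator_eq (W := Submodule.span K S)]
    have : (Submodule.span K S).dualCoannihilator = ⊥ := by
      rw [eq_bot_iff]
      intro w hw
      exact hS w fun l hl => (Submodule.mem_dualCoannihilator w).mp hw l (Submodule.subset_span hl)
    rw [this, Submodule.dualAnnihilator_bot]
  intro l
  have hl : l ∈ Submodule.span K S := hspan ▸ Submodule.mem_top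
  induction hl using Submodule.span_induction with
  | mem l hl => exact h l hl
  | zero => exact ⟨0, by simp, by simp⟩
  | add l l' _ _ h1 h2 =>
    obtain ⟨c, hc, hc'⟩ := h1
    obtain ⟨d, hd, hd'⟩ := h2
    exact ⟨c + d, by simp [hc, hd], by simp [hc', hd']⟩
  | smul a l _ h1 =>
    obtain ⟨c, hc, hc'⟩ := h1
    exact ⟨a • c, by simp [hc, smul_eq_C_mul], by simp [hc']⟩

theorem Submodule.mem_of_dual (U : Submodule K W) {w : W}
    (h : ∀ l : Module.Dual K W, (∀ u ∈ U, l u = 0) → l w = 0) : w ∈ U := by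
  by_contra hw
  obtain ⟨l, hl, hl'⟩ := Submodule.exists_le_ker_of_notMem hw
  exact hl (h l hl')

theorem HasDifferential.lie_stable (h : HasDifferential ρ δ) (h1 : ρ 1 = 1)
    (U : Submodule K W) (hU : ∀ g ∈ G, ∀ w ∈ U, ρ g w ∈ U) :
    ∀ Z ∈ lieAlg G, ∀ w ∈ U, δ Z w ∈ U := by
  refine fun Z hZ w hw => U.mem_of_dual fun l hl => ?_
  obtain ⟨c, hc, hc'⟩ := h l
  have hcw : c w ∈ vanIdeal G := mem_vanIdeal.mpr fun g hg => by
    rw [hc]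
    exact hl _ (hU g hg w hw)
  have h2 := mem_lieAlg.mp hZ _ hcw
  rw [hc', hc, h1] at h2
  exact h2

theorem HasDifferential.stable [CharZero K] (h : HasDifferential ρ δ) (h1 : ρ 1 = 1)
    (hG : (vanIdeal G).IsPrime) (U : Submodule K W)
    (hU : ∀ Z ∈ lieAlg G, ∀ w ∈ U, δ Z w ∈ U) : ∀ g ∈ G, ∀ w ∈ U, ρ g w ∈ U := by
  refine fun g hg w hw => U.mem_of_dual fun l hl => ?_
  obtain ⟨c, hc, hc'⟩ := h l
  obtain ⟨s, hs, hsf⟩ := exists_mul_mem_of_derivations (glPt 1) (vanIdeal G)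
    (fun f hf => mem_vanIdeal.mp hf 1 (one_mem G)) (invDer '' lieAlg G)
    (by
      rintro _ ⟨Z, hZ, rfl⟩ f hf
      exact invDer_mem_vanIdeal hZ hf)
    (fun v hv => by
      obtain ⟨Z, hZ, h⟩ := exists_mem_lieAlg_of_tangent v hv
      exact ⟨_, ⟨Z, hZ, rfl⟩, h⟩)
    (c '' U)
    (by
      rintro _ ⟨u, hu, rfl⟩
      rw [hc, h1]
      exact hl u hu)
    (by
      rintro _ ⟨Z, hZ, rfl⟩ _ ⟨u, hu, rfl⟩
      exact ⟨_, hU Z hZ u hu, (hc' Z u).symm⟩)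
    (c w) ⟨w, hw, rfl⟩
  have hsI : s ∉ vanIdeal G := fun hsI => by
    rw [mem_vanIdeal.mp hsI 1 (one_mem G)] at hs
    exact zero_ne_one hs
  rw [← hc]
  exact mem_vanIdeal.mp ((hG.mem_or_mem hsf).resolve_left hsI) g hg

theorem HasDifferential.exists_isCompl [CharZero K] [IsAlgClosed K] [Module.Finite K W]
    (hG : (vanIdeal G).IsPrime) (hred : IsReductiveAlg K (lieAlg G))
    (φ : Matrix (Fin N) (Fin N) K →ₗ⁅K⁆ Module.End K W) (h : HasDifferential ρ φ) (h1 : ρ 1 = 1)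
    (hz : ∀ z ∈ center K (lieAlg G), (φ z).IsSemisimple)
    (U : Submodule K W) (hU : ∀ g ∈ G, ∀ w ∈ U, ρ g w ∈ U) :
    ∃ U' : Submodule K W, (∀ g ∈ G, ∀ w ∈ U', ρ g w ∈ U') ∧ IsCompl U U' := by
  obtain ⟨U', h2, h3⟩ := exists_isCompl_of_lieHom hred (φ.comp (lieAlg G).incl) hz U
    fun x w hw => h.lie_stable h1 U hU x x.2 w hw
  exact ⟨U', h.stable h1 hG U' fun Z hZ w hw => h2 ⟨Z, hZ⟩ w hw, h3⟩

theorem hasDifferential_toLin' : HasDifferential (K := K) (N := N)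
    (fun g => Matrix.toLin' (g : Matrix (Fin N) (Fin N) K)) (fun Z => Matrix.toLin' Z) := by
  refine HasDifferential.of_separating (Set.range fun i => LinearMap.proj i)
    (fun w hw => funext fun i => hw _ ⟨i, rfl⟩) ?_
  rintro _ ⟨i, rfl⟩
  refine ⟨∑ j, (LinearMap.proj j).smulRight (xMat K N i j), fun g w => ?_, fun Z w => ?_⟩
  · have h := xMat_map_eval (g : Matrix (Fin N) (Fin N) K) ((g⁻¹ : GL (Fin N) K) : Matrix _ _ K)
    have h' : ∀ j, eval (glPt g) (xMat K N i j) = (g : Matrix (Fin N) (Fin N) K) i j :=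
      fun j => congrFun (congrFun h i) j
    simp [smul_eq_C_mul, h', Matrix.mulVec, dotProduct, mul_comm]
  · have h := xMat_map_invDer (K := K) (N := N) Z
    have h' : ∀ j, invDer Z (xMat K N i j) = ∑ k, xMat K N i k * C (Z k j) :=
      fun j => (congrFun (congrFun h i) j)
    simp only [LinearMap.sum_apply, LinearMap.smulRight_apply, LinearMap.proj_apply, map_sum,
      Derivation.map_smul, h', Matrix.toLin'_apply, Matrix.mulVec, dotProduct, Finset.sum_smul,
      Finset.smul_sum]
    rw [Finset.sum_comm]
    refine Finset.sum_congr rfl fun k _ => Finset.sum_congr rfl fun j _ => ?_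
    simp only [smul_eq_C_mul, C_mul]
    ring

theorem isReductiveAlg_lieAlg [CharZero K] [IsAlgClosed K] (hG : (vanIdeal G).IsPrime)
    (hss : NatSemisimpleOn K N (G : Set (GL (Fin N) K))) :
    IsReductiveAlg K (lieAlg G) ∧
      ∀ z ∈ center K (lieAlg G), ⨆ a, Module.End.eigenspace (Matrix.toLin' (z : Matrix (Fin N) (Fin N) K)) a = ⊤ := by
  have h1 : Matrix.toLin' ((1 : GL (Fin N) K) : Matrix (Fin N) (Fin N) K) = 1 := by
    simp [Module.End.one_eq_id]
  let φ : lieAlg G →ₗ⁅K⁆ Module.End K (Fin N → K) :=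
    (lieEquivMatrix' (R := K) (n := Fin N)).symm.toLieHom.comp (lieAlg G).incl
  have hφ : ∀ x : lieAlg G, φ x = Matrix.toLin' (x : Matrix (Fin N) (Fin N) K) := fun x => rfl
  refine isReductiveAlg_of_lieHom φ (fun x y hxy => ?_) fun U hU => ?_
  · rw [hφ, hφ] at hxy
    exact Subtype.ext (Matrix.toLin'.injective hxy)
  · obtain ⟨U', h2, h3⟩ := hss U fun u hu v hv =>
      hasDifferential_toLin'.stable h1 hG U (fun Z hZ w hw => hU ⟨Z, hZ⟩ w hw) u hu v hv
    exact ⟨U', fun x w hw => hasDifferential_toLin'.lie_stable h1 U' h2 x x.2 w hw, h3⟩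

end Differential

section Clifford
variable {K V : Type} [Field K] [AddCommGroup V] [Module K V] [Module.Finite K V]

/-- A module which is semisimple over a group is semisimple over every normal subgroup. -/
theorem exists_isCompl_of_normal {H : Type} [Group H] (ρ : H →* Module.End K V) (G : Subgroup H)
    [G.Normal]
    (hss : ∀ U : Submodule K V, (∀ h, ∀ v ∈ U, ρ h v ∈ U) →
      ∃ U' : Submodule K V, (∀ h, ∀ v ∈ U', ρ h v ∈ U') ∧ IsCompl U U')
    (U : Submodule K V) (hU : ∀ g ∈ G, ∀ v ∈ U, ρ g v ∈ U) :
    ∃ U' : Submodule K V, (∀ g ∈ G, ∀ v ∈ U', ρ g v ∈ U') ∧ IsCompl U U' := by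
  have hinv : ∀ h v, ρ h (ρ h⁻¹ v) = v := fun h v => by
    rw [← Module.End.mul_apply, ← map_mul, mul_inv_cancel, map_one, Module.End.one_apply]
  have hinv' : ∀ h v, ρ h⁻¹ (ρ h v) = v := fun h v => by
    rw [← Module.End.mul_apply, ← map_mul, inv_mul_cancel, map_one, Module.End.one_apply]
  let st : Submodule K V → Prop := fun U => ∀ g ∈ G, ∀ v ∈ U, ρ g v ∈ U
  let simp' : Submodule K V → Prop := fun U => st U ∧ ∀ U' ≤ U, st U' → U' ≠ ⊥ → U' = U
  have hmap : ∀ h, ∀ U, st U → st (U.map (ρ h)) := by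
    rintro h U hU g hg _ ⟨v, hv, rfl⟩
    refine ⟨ρ (h⁻¹ * g * h) v, hU _ (by simpa using ‹G.Normal›.conj_mem g hg h⁻¹) v hv, ?_⟩
    rw [← Module.End.mul_apply, ← Module.End.mul_apply, ← map_mul, ← map_mul]
    congr 2
    group
  have hmapinv : ∀ h (U : Submodule K V), (U.map (ρ h⁻¹)).map (ρ h) = U := by
    intro h U
    rw [← Submodule.map_comp]
    convert Submodule.map_id U
    exact LinearMap.ext (hinv h)
  have hmapinv' : ∀ h (U : Submodule K V), (U.map (ρ h)).map (ρ h⁻¹) = U := by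
    intro h U
    rw [← Submodule.map_comp]
    convert Submodule.map_id U
    exact LinearMap.ext (hinv' h)
  have hsimp : ∀ h, ∀ U, simp' U → simp' (U.map (ρ h)) := by
    refine fun h U hU => ⟨hmap h U hU.1, fun U' hle hst hne => ?_⟩
    have h1 := hU.2 (U'.map (ρ h⁻¹)) (by
      rw [← hmapinv' h U]
      exact Submodule.map_mono hle) (hmap _ _ hst) (fun h0 => hne (by
        rw [← hmapinv h U', h0, Submodule.map_bot]))
    rw [← h1, hmapinv]
  have hex : ∀ U, st U → U ≠ ⊥ → ∃ S ≤ U, simp' S ∧ S ≠ ⊥ := by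
    intro U hU hne
    obtain ⟨S, ⟨h1, h2, h3⟩, hmin⟩ := WellFounded.has_min (wellFounded_lt (α := Submodule K V))
      {S | S ≤ U ∧ st S ∧ S ≠ ⊥} ⟨U, le_rfl, hU, hne⟩
    refine ⟨S, h1, ⟨h2, fun U' hle hst hne' => ?_⟩, h3⟩
    by_contra hcon
    exact hmin U' ⟨hle.trans h1, hst, hne'⟩ (lt_of_le_of_ne hle hcon)
  let T : Submodule K V := sSup {S | simp' S}
  have hT : T = ⊤ := by
    obtain ⟨T', hT', hcompl⟩ := hss T (fun h v hv => by
      have h1 : T.map (ρ h) ≤ T := by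
        rw [Submodule.map_le_iff_le_comap]
        refine sSup_le fun S hS => ?_
        rw [← Submodule.map_le_iff_le_comap]
        exact le_sSup (hsimp h S hS)
      exact h1 ⟨v, hv, rfl⟩)
    rcases eq_or_ne T' ⊥ with h0 | h0
    · rw [h0] at hcompl
      simpa using hcompl.sup_eq_top
    · obtain ⟨S, hS, hS', hS0⟩ := hex T' (fun g _ => hT' g) h0
      exact absurd (le_bot_iff.mp (hcompl.disjoint (le_sSup hS') hS)) hS0
  obtain ⟨U', ⟨h1, h2⟩, hmax⟩ := WellFounded.has_min (wellFounded_gt (α := Submodule K V))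
      {S | st S ∧ Disjoint U S} ⟨⊥, fun g _ v hv => by simp_all, disjoint_bot_right⟩
  refine ⟨U', h1, h2, codisjoint_iff.mpr ?_⟩
  rw [eq_top_iff, ← hT]
  refine sSup_le fun S hS => ?_
  by_contra hcon
  have hsup : ∀ A B, st A → st B → st (A ⊔ B) := by
    intro A B hA hB g hg v hv
    obtain ⟨a, ha, b, hb, rfl⟩ := Submodule.mem_sup.mp hv
    rw [map_add]
    exact Submodule.add_mem_sup (hA g hg a ha) (hB g hg b hb)
  have hdis : Disjoint (U ⊔ U') S := by
    rw [disjoint_iff]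
    by_contra h0
    have h3 := hS.2 ((U ⊔ U') ⊓ S) inf_le_right
      (fun g hg v hv => ⟨hsup _ _ hU h1 g hg v hv.1, hS.1 g hg v hv.2⟩) h0
    exact hcon (inf_eq_right.mp h3)
  refine hmax (U' ⊔ S) ⟨hsup _ _ h1 hS.1, h2.disjoint_sup_right_of_disjoint_sup_left hdis⟩ ?_
  refine lt_of_le_of_ne le_sup_left fun h => hcon ?_
  exact le_trans (le_trans le_sup_right h.ge) le_sup_right

/-- Maschke's theorem relative to a subgroup of finite index. -/
theorem exists_isCompl_of_finiteIndex [CharZero K] {W H : Type} [AddCommGroup W] [Module K W]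
    [Group H] (ρ : H →* Module.End K W) (G : Subgroup H) [G.FiniteIndex] (U : Submodule K W)
    (hU : ∀ h, ∀ v ∈ U, ρ h v ∈ U)
    (hss : ∃ U' : Submodule K W, (∀ g ∈ G, ∀ v ∈ U', ρ g v ∈ U') ∧ IsCompl U U') :
    ∃ U' : Submodule K W, (∀ h, ∀ v ∈ U', ρ h v ∈ U') ∧ IsCompl U U' := by
  classical
  obtain ⟨U', hU', hc⟩ := hss
  have hinv : ∀ h v, ρ h (ρ h⁻¹ v) = v := fun h v => by
    rw [← Module.End.mul_apply, ← map_mul, mul_inv_cancel, map_one, Module.End.one_apply]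
  let π : W →ₗ[K] W := U.subtype ∘ₗ Submodule.projectionOnto U U' hc
  have hπU : ∀ w, π w ∈ U := fun w => (Submodule.projectionOnto U U' hc w).2
  have hπ1 : ∀ u ∈ U, π u = u := fun u hu =>
    congrArg Subtype.val (Submodule.projectionOnto_apply_left hc ⟨u, hu⟩)
  have hπ0 : ∀ u ∈ U', π u = 0 := fun u hu => by
    have := (Submodule.projectionOnto_apply_eq_zero_iff hc).mpr hu
    simp [π, this]
  have hπG : ∀ g ∈ G, ∀ w, π (ρ g w) = ρ g (π w) := by
    intro g hg w
    obtain ⟨a, ha, b, hb, rfl⟩ := Submodule.mem_sup.mp (hc.sup_eq_top ▸ Submodule.mem_top (x := w))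
    rw [map_add, map_add, map_add, hπ1 _ (hU g a ha), hπ0 _ (hU' g hg b hb), hπ1 a ha, hπ0 b hb]
    simp
  let F₀ : H → W →ₗ[K] W := fun h => ρ h * π * ρ h⁻¹
  have hF₀ : ∀ a b, a⁻¹ * b ∈ G → F₀ a = F₀ b := by
    intro a b hab
    ext w
    obtain ⟨g, rfl⟩ : ∃ g, b = a * g := ⟨a⁻¹ * b, by group⟩
    have hg : g ∈ G := by simpa using hab
    have h1 : ρ (a * g)⁻¹ w = ρ g⁻¹ (ρ a⁻¹ w) := by
      rw [_root_.mul_inv_rev, map_mul, Module.End.mul_apply]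
    simp only [F₀, Module.End.mul_apply]
    rw [h1, hπG _ (inv_mem hg), map_mul, Module.End.mul_apply, hinv]
  let F : H ⧸ G → W →ₗ[K] W := Quotient.lift F₀ fun a b hab =>
    hF₀ a b (QuotientGroup.leftRel_apply.mp hab)
  have hFh : ∀ h q, F (h • q) * ρ h = ρ h * F q := by
    intro h q
    induction q using Quotient.inductionOn with
    | h a =>
      change F₀ (h * a) * ρ h = ρ h * F₀ a
      simp only [F₀, _root_.mul_inv_rev, map_mul, mul_assoc]
      rw [← map_mul ρ h⁻¹ h, inv_mul_cancel, map_one, mul_one]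
  let _ : Fintype (H ⧸ G) := Fintype.ofFinite _
  let P : W →ₗ[K] W := ∑ q, F q
  let m : K := Fintype.card (H ⧸ G)
  have hm : m ≠ 0 := by
    simp [m]
  have hPh : ∀ h w, P (ρ h w) = ρ h (P w) := by
    intro h w
    have : P * ρ h = ρ h * P := by
      simp only [P, Finset.sum_mul, Finset.mul_sum]
      rw [← Equiv.sum_comp (MulAction.toPerm h) (fun q => F q * ρ h)]
      exact Finset.sum_congr rfl fun q _ => hFh h q
    exact LinearMap.congr_fun this w
  have hPU : ∀ w, P w ∈ U := by
    intro w
    rw [LinearMap.sum_apply]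
    refine sum_mem fun q _ => ?_
    induction q using Quotient.inductionOn with
    | h a => exact hU a _ (hπU _)
  have hP1 : ∀ u ∈ U, P u = m • u := by
    intro u hu
    rw [LinearMap.sum_apply]
    have : ∀ q, F q u = u := by
      intro q
      induction q using Quotient.inductionOn with
      | h a =>
        change ρ a (π (ρ a⁻¹ u)) = u
        rw [hπ1 _ (hU _ u hu), hinv]
    simp [this, m, ← Nat.cast_smul_eq_nsmul K]
  refine ⟨LinearMap.ker P, fun h v hv => ?_, ?_, ?_⟩
  · rw [LinearMap.mem_ker] at hv ⊢
    rw [hPh, hv, map_zero]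
  · rw [Submodule.disjoint_def]
    intro u hu hu'
    rw [LinearMap.mem_ker, hP1 u hu] at hu'
    exact (smul_eq_zero.mp hu').resolve_left hm
  · rw [codisjoint_iff, eq_top_iff]
    intro w _
    refine Submodule.mem_sup.mpr ⟨m⁻¹ • P w, U.smul_mem _ (hPU w), w - m⁻¹ • P w, ?_, by simp⟩
    rw [LinearMap.mem_ker, map_sub, map_smul, hP1 _ (hPU w), smul_smul, inv_mul_cancel₀ hm,
      one_smul, sub_self]

end Clifford

section Conjugation
variable {K : Type} [Field K] {N : ℕ}

theorem isSemisimple_ad_matrix [CharZero K] {Z : Matrix (Fin N) (Fin N) K}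
    (hZ : Module.End.IsSemisimple (Matrix.toLin' Z)) :
    (ad K (Matrix (Fin N) (Fin N) K) Z).IsSemisimple := by
  have h := LieAlgebra.ad_isSemisimple_of_isSemisimple hZ
  refine (LinearEquiv.isSemisimple_iff _ _ Matrix.toLin' ?_).mpr h
  ext1 A
  simp only [LinearMap.comp_apply, LinearEquiv.coe_coe, ad_apply, Ring.lie_def, map_sub,
    Matrix.toLin'_mul]
  rfl

/-- Conjugation of matrices by invertible matrices. -/
noncomputable def conjRep (K : Type) [Field K] (N : ℕ) :
    GL (Fin N) K →* Module.End K (Matrix (Fin N) (Fin N) K) where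
  toFun g := LinearMap.mulLeft K (g : Matrix (Fin N) (Fin N) K) ∘ₗ
    LinearMap.mulRight K ((g⁻¹ : GL (Fin N) K) : Matrix (Fin N) (Fin N) K)
  map_one' := by
    ext1 A
    simp
  map_mul' g h := by
    ext1 A
    simp only [LinearMap.comp_apply, LinearMap.mulLeft_apply, LinearMap.mulRight_apply,
      _root_.mul_inv_rev, Units.val_mul, mul_assoc, Module.End.mul_apply]

theorem conjRep_apply (g : GL (Fin N) K) (A : Matrix (Fin N) (Fin N) K) :
    conjRep K N g A = g * (A * ((g⁻¹ : GL (Fin N) K) : Matrix (Fin N) (Fin N) K)) := rfl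

theorem hasDifferential_conjRep : HasDifferential (K := K) (N := N) (conjRep K N)
    (ad K (Matrix (Fin N) (Fin N) K)) := by
  refine HasDifferential.of_separating
    (Set.range fun p : Fin N × Fin N => Matrix.entryLinearMap K K p.1 p.2)
    (fun w hw => Matrix.ext fun i j => hw _ ⟨(i, j), rfl⟩) ?_
  rintro _ ⟨⟨i, j⟩, rfl⟩
  refine ⟨{ toFun := fun A => (xMat K N * A.map C * yMat K N : Matrix _ _ (GLPoly K N)) i j
            map_add' := fun A B => ?_
            map_smul' := fun a A => ?_ }, fun g A => ?_, fun Z A => ?_⟩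
  · rw [Matrix.map_add C (by simp), mul_add, add_mul, Matrix.add_apply]
  · have h : (a • A).map (C : K →+* GLPoly K N) = a • A.map C := by
      ext1 i j
      simp [MvPolynomial.smul_eq_C_mul]
    rw [h, Matrix.mul_smul, Matrix.smul_mul, Matrix.smul_apply, RingHom.id_apply]
  · have h : (xMat K N * A.map C * yMat K N).map (eval (glPt g)) = conjRep K N g A := by
      rw [Matrix.map_mul, Matrix.map_mul, map_C_map_eval, glPt, xMat_map_eval, yMat_map_eval,
        conjRep_apply, mul_assoc]
    exact congrFun (congrFun h i) j
  · have h : (xMat K N * A.map C * yMat K N).map (invDer Z) =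
        xMat K N * (⁅Z, A⁆ : Matrix (Fin N) (Fin N) K).map C * yMat K N := by
      simp only [Derivation.matrix_map_mul, Derivation.map_C_map, xMat_map_invDer, yMat_map_invDer,
        Ring.lie_def]
      rw [Matrix.map_sub C (by simp), Matrix.map_mul, Matrix.map_mul]
      noncomm_ring
    exact congrFun (congrFun h i) j

/-- The Lie algebra of a reductive normal subgroup of finite index has an invariant
complement. -/
theorem exists_isCompl_lieAlg [CharZero K] [IsAlgClosed K] {G H : Subgroup (GL (Fin N) K)}
    (hfin : (G.subgroupOf H).FiniteIndex)
    (hconj : ∀ h ∈ H, ∀ g ∈ G, h * g * h⁻¹ ∈ G) (hG : (vanIdeal G).IsPrime)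
    (hred : IsReductiveAlg K (lieAlg G))
    (hz : ∀ z ∈ center K (lieAlg G),
      ⨆ a, Module.End.eigenspace (Matrix.toLin' (z : Matrix (Fin N) (Fin N) K)) a = ⊤)
    (hGH : G ≤ H) :
    ∃ U' : Submodule K (Matrix (Fin N) (Fin N) K), (∀ h ∈ H, ∀ A ∈ U', conjRep K N h A ∈ U') ∧
      IsCompl (lieAlg G).toSubmodule U' := by
  have hst : ∀ h : H, ∀ A ∈ (lieAlg G).toSubmodule, conjRep K N h A ∈ (lieAlg G).toSubmodule := by
    intro h A hA
    rw [conjRep_apply, ← mul_assoc]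
    exact conj_mem_lieAlg (hconj h h.2) hA
  obtain ⟨U', h1, h2⟩ := hasDifferential_conjRep.exists_isCompl hG hred _ (map_one _)
    (fun z hz' => isSemisimple_ad_matrix
      (Module.End.isSemisimple_of_iSup_eigenspace_eq_top (hz z hz')))
    (lieAlg G).toSubmodule fun g hg => hst ⟨g, hGH hg⟩
  obtain ⟨U'', h3, h4⟩ := exists_isCompl_of_finiteIndex ((conjRep K N).comp H.subtype)
    (G.subgroupOf H) (lieAlg G).toSubmodule hst
    ⟨U', fun g hg v hv => h1 g (Subgroup.mem_subgroupOf.mp hg) v hv, h2⟩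
  exact ⟨U'', fun h hh => h3 ⟨h, hh⟩, h4⟩

theorem natSemisimpleOn_of_normal [CharZero K] {G H : Subgroup (GL (Fin N) K)} (hGH : G ≤ H)
    (hconj : ∀ h ∈ H, ∀ g ∈ G, h * g * h⁻¹ ∈ G) (hss : NatSemisimpleOn K N (H : Set (GL (Fin N) K))) :
    NatSemisimpleOn K N (G : Set (GL (Fin N) K)) := by
  let ρ : H →* Module.End K (Fin N → K) :=
    ((Matrix.toLinAlgEquiv' : Matrix (Fin N) (Fin N) K ≃ₐ[K] _) : _ →* _).comp
      ((Units.coeHom _).comp H.subtype)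
  have hρ : ∀ h v, ρ h v = ((h : GL (Fin N) K) : Matrix (Fin N) (Fin N) K) *ᵥ v := fun h v => rfl
  have _ : (G.subgroupOf H).Normal := ⟨fun g hg h => Subgroup.mem_subgroupOf.mpr
    (hconj h h.2 g (Subgroup.mem_subgroupOf.mp hg))⟩
  intro U hU
  obtain ⟨U', h1, h2⟩ := exists_isCompl_of_normal ρ (G.subgroupOf H)
    (fun W hW => by
      obtain ⟨W', h1, h2⟩ := hss W fun u hu => hW ⟨u, hu⟩
      exact ⟨W', fun h => h1 h h.2, h2⟩)
    U (fun g hg v hv => hU g (Subgroup.mem_subgroupOf.mp hg) v hv)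
  exact ⟨U', fun u hu v hv => h1 ⟨u, hGH hu⟩ (Subgroup.mem_subgroupOf.mpr hu) v hv, h2⟩

end Conjugation

section Tuples
variable {K : Type} [Field K] {N r : ℕ}

/-- Polynomial functions of `r` matrices. -/
abbrev TuplePoly (K : Type) [Field K] (N r : ℕ) := MvPolynomial (Fin r × (Fin N × Fin N)) K

/-- The generic matrices. -/
noncomputable def tupMat (K : Type) [Field K] (N : ℕ) {r : ℕ} (k : Fin r) :
    Matrix (Fin N) (Fin N) (TuplePoly K N r) :=
  Matrix.of fun i j => X (k, (i, j))

/-- The substitution attached to a family of matrices. -/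
def tupSubst {R : Type*} (A : Fin r → Matrix (Fin N) (Fin N) R) : Fin r × (Fin N × Fin N) → R :=
  fun p => A p.1 p.2.1 p.2.2

theorem tupMat_map_eval (y : Fin r → Matrix (Fin N) (Fin N) K) (k : Fin r) :
    (tupMat K N k).map (eval (tupSubst y)) = y k := by
  ext1 i j
  simp [tupMat, tupSubst]

theorem tupMat_map_aeval {R : Type*} [CommRing R] [Algebra K R]
    (A : Fin r → Matrix (Fin N) (Fin N) R) (k : Fin r) :
    (tupMat K N k).map (aeval (tupSubst A) : TuplePoly K N r →ₐ[K] R) = A k := by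
  ext1 i j
  simp [tupMat, tupSubst]

theorem eval_aeval_tupSubst {σ : Type*} (p : σ → K)
    (A : Fin r → Matrix (Fin N) (Fin N) (MvPolynomial σ K)) (f : TuplePoly K N r) :
    eval p (aeval (tupSubst A) f) = eval (tupSubst fun k => (A k).map (eval p)) f :=
  comp_aeval_apply (tupSubst A) (aeval p : MvPolynomial σ K →ₐ[K] K) f

/-- Translation of polynomials along simultaneous conjugation. -/
noncomputable def conjAct (g : GL (Fin N) K) : TuplePoly K N r →ₐ[K] TuplePoly K N r :=
  aeval (tupSubst fun k => ((g⁻¹ : GL (Fin N) K) : Matrix (Fin N) (Fin N) K).map C * tupMat K N k *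
    (g : Matrix (Fin N) (Fin N) K).map C)

theorem eval_conjAct (g : GL (Fin N) K) (y : Fin r → Matrix (Fin N) (Fin N) K) (f) :
    eval (tupSubst y) (conjAct g f) =
      eval (tupSubst fun k => ((g⁻¹ : GL (Fin N) K) : Matrix (Fin N) (Fin N) K) * y k *
        (g : Matrix (Fin N) (Fin N) K)) f := by
  rw [conjAct, eval_aeval_tupSubst]
  simp only [Matrix.map_mul, map_C_map_eval, tupMat_map_eval]

theorem conjAct_one (f : TuplePoly K N r) : conjAct 1 f = f := by
  have h : (1 : Matrix (Fin N) (Fin N) K).map (C : K →+* TuplePoly K N r) = 1 :=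
    Matrix.map_one C (map_zero _) (map_one _)
  simp only [conjAct, inv_one, Units.val_one, h, one_mul, mul_one]
  exact aeval_X_left_apply f

/-- The derivation of the polynomials in `r` matrices given by the infinitesimal conjugation. -/
noncomputable def tupDer (Z : Matrix (Fin N) (Fin N) K) :
    Derivation K (TuplePoly K N r) (TuplePoly K N r) :=
  mkDerivation K (tupSubst fun k => tupMat K N k * Z.map C - Z.map C * tupMat K N k)

theorem tupDer_X (Z : Matrix (Fin N) (Fin N) K) (p : Fin r × (Fin N × Fin N)) :
    tupDer Z (X p) =
      (tupMat K N p.1 * Z.map C - Z.map C * tupMat K N p.1 : Matrix _ _ (TuplePoly K N r))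
        p.2.1 p.2.2 :=
  mkDerivation_X _ _ _

theorem tupMat_map_tupDer (Z : Matrix (Fin N) (Fin N) K) (k : Fin r) :
    (tupMat K N k).map (tupDer Z) = tupMat K N k * Z.map C - Z.map C * tupMat K N k := by
  ext1 i j
  simp only [Matrix.map_apply, tupMat, Matrix.of_apply, tupDer_X]

theorem tupDer_commutator (Z W : Matrix (Fin N) (Fin N) K) :
    ⁅tupDer (r := r) Z, tupDer (r := r) W⁆ = tupDer ⁅Z, W⁆ := by
  refine MvPolynomial.derivation_ext fun p => ?_
  have h : ((tupMat K N p.1).map (tupDer W)).map (tupDer Z) -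
      ((tupMat K N p.1).map (tupDer Z)).map (tupDer W) = (tupMat K N p.1).map (tupDer ⁅Z, W⁆) := by
    simp only [tupMat_map_tupDer, Matrix.map_sub _ (map_sub _), Derivation.matrix_map_mul,
      Derivation.map_C_map, Ring.lie_def]
    rw [Matrix.map_mul, Matrix.map_mul]
    noncomm_ring
  rw [Derivation.commutator_apply]
  exact congrFun (congrFun h p.2.1) p.2.2

theorem tupDer_add (Z W : Matrix (Fin N) (Fin N) K) :
    (tupDer (Z + W) : Derivation K (TuplePoly K N r) _) = tupDer Z + tupDer W := by
  refine MvPolynomial.derivation_ext fun p => ?_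
  rw [Derivation.add_apply, tupDer_X, tupDer_X, tupDer_X, Matrix.map_add C (by simp), mul_add,
    add_mul]
  simp only [Matrix.sub_apply, Matrix.add_apply]
  ring

theorem tupDer_smul (c : K) (Z : Matrix (Fin N) (Fin N) K) :
    (tupDer (c • Z) : Derivation K (TuplePoly K N r) _) = c • tupDer Z := by
  refine MvPolynomial.derivation_ext fun p => ?_
  rw [Derivation.smul_apply, tupDer_X, tupDer_X]
  have h : (c • Z).map (C : K →+* TuplePoly K N r) = c • Z.map C := by
    ext1 i j
    simp [MvPolynomial.smul_eq_C_mul]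
  rw [h, Matrix.mul_smul, Matrix.smul_mul, ← smul_sub]
  rfl

/-- Polynomials of degree at most one. -/
noncomputable def tupLinear (K : Type) [Field K] (N r : ℕ) : Submodule K (TuplePoly K N r) :=
  Submodule.span K (insert 1 (Set.range X))

/-- Polynomials of degree at most `d`. -/
noncomputable abbrev tupDeg (K : Type) [Field K] (N r d : ℕ) : Submodule K (TuplePoly K N r) :=
  tupLinear K N r ^ d

instance finite_tupDeg (d : ℕ) : Module.Finite K (tupDeg K N r d) := by
  rw [Module.Finite.iff_fg]
  exact Submodule.FG.pow (Submodule.fg_span ((Set.finite_range _).insert _)) d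

theorem one_le_tupLinear : 1 ≤ tupLinear K N r := by
  rw [Submodule.one_le]
  exact Submodule.subset_span (Set.mem_insert _ _)

theorem X_mem_tupLinear (p) : (X p : TuplePoly K N r) ∈ tupLinear K N r :=
  Submodule.subset_span (Set.mem_insert_of_mem _ ⟨p, rfl⟩)

theorem tupDeg_mono : Monotone (tupDeg K N r) := fun _ _ h =>
  pow_le_pow_right₀ one_le_tupLinear h

theorem exists_mem_tupDeg (f : TuplePoly K N r) : ∃ d, f ∈ tupDeg K N r d := by
  induction f using MvPolynomial.induction_on with
  | C a =>
    refine ⟨0, ?_⟩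
    rw [tupDeg, pow_zero, Submodule.mem_one]
    exact ⟨a, rfl⟩
  | add f g hf hg =>
    obtain ⟨d, hd⟩ := hf
    obtain ⟨e, he⟩ := hg
    exact ⟨max d e, add_mem (tupDeg_mono (le_max_left _ _) hd) (tupDeg_mono (le_max_right _ _) he)⟩
  | mul_X f p hf =>
    obtain ⟨d, hd⟩ := hf
    refine ⟨d + 1, ?_⟩
    rw [tupDeg, pow_succ]
    exact Submodule.mul_mem_mul hd (X_mem_tupLinear p)

theorem mul_tupMat_mul_mem (A B : Matrix (Fin N) (Fin N) K) (k : Fin r) (i j : Fin N) :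
    (A.map C * tupMat K N k * B.map C : Matrix _ _ (TuplePoly K N r)) i j ∈ tupLinear K N r := by
  simp only [Matrix.mul_apply, Matrix.map_apply, Finset.sum_mul]
  refine sum_mem fun a _ => sum_mem fun b _ => ?_
  rw [mul_right_comm, ← C_mul, ← smul_eq_C_mul]
  exact Submodule.smul_mem _ _ (X_mem_tupLinear _)

theorem conjAct_mem_tupDeg (g : GL (Fin N) K) {d : ℕ} {f : TuplePoly K N r}
    (hf : f ∈ tupDeg K N r d) : conjAct g f ∈ tupDeg K N r d := by
  have h1 : (tupLinear K N r).map (conjAct g).toLinearMap ≤ tupLinear K N r := by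
    rw [tupLinear, Submodule.map_span_le]
    rintro _ (rfl | ⟨p, rfl⟩)
    · rw [AlgHom.toLinearMap_apply, map_one]
      exact Submodule.subset_span (Set.mem_insert _ _)
    · rw [AlgHom.toLinearMap_apply, conjAct, aeval_X]
      exact mul_tupMat_mul_mem _ _ _ _ _
  have h2 : (tupDeg K N r d).map (conjAct g).toLinearMap ≤ tupDeg K N r d := by
    rw [tupDeg, Submodule.map_pow]
    exact pow_le_pow_left' h1 d
  exact h2 ⟨f, hf, rfl⟩

theorem tupDer_mem_tupLinear (Z : Matrix (Fin N) (Fin N) K) {f : TuplePoly K N r}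
    (hf : f ∈ tupLinear K N r) : tupDer Z f ∈ tupLinear K N r := by
  have h1 : (tupLinear K N r).map (tupDer Z).toLinearMap ≤ tupLinear K N r := by
    rw [tupLinear, Submodule.map_span_le]
    rintro _ (rfl | ⟨p, rfl⟩)
    · change tupDer Z 1 ∈ _
      rw [Derivation.map_one_eq_zero]
      exact zero_mem _
    · change tupDer Z (X p) ∈ _
      rw [tupDer_X, Matrix.sub_apply]
      have h2 := mul_tupMat_mul_mem (K := K) (r := r) 1 Z p.1 p.2.1 p.2.2
      have h3 := mul_tupMat_mul_mem (K := K) (r := r) Z 1 p.1 p.2.1 p.2.2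
      rw [Matrix.map_one C (map_zero _) (map_one _), one_mul] at h2
      rw [Matrix.map_one C (map_zero _) (map_one _), mul_one] at h3
      exact sub_mem h2 h3
  exact h1 ⟨f, hf, rfl⟩

theorem tupDer_mem_tupDeg (Z : Matrix (Fin N) (Fin N) K) {d : ℕ} :
    ∀ f : TuplePoly K N r, f ∈ tupDeg K N r d → tupDer Z f ∈ tupDeg K N r d := by
  induction d with
  | zero =>
    intro f hf
    rw [tupDeg, pow_zero, Submodule.mem_one] at hf
    obtain ⟨a, rfl⟩ := hf
    rw [Derivation.map_algebraMap]
    exact zero_mem _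
  | succ d ih =>
    intro f hf
    rw [tupDeg, pow_succ] at hf ⊢
    refine Submodule.mul_induction_on hf (fun a ha b hb => ?_) fun x y hx hy => ?_
    · rw [Derivation.leibniz, smul_eq_mul, smul_eq_mul]
      refine add_mem (Submodule.mul_mem_mul ha (tupDer_mem_tupLinear Z hb)) ?_
      rw [mul_comm b]
      exact Submodule.mul_mem_mul (ih a ha) hb
    · rw [map_add]
      exact add_mem hx hy

/-- The conjugation action on polynomials of bounded degree. -/
noncomputable def tupRep (d : ℕ) (g : GL (Fin N) K) : Module.End K (tupDeg K N r d) :=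
  (conjAct g).toLinearMap.restrict fun _ => conjAct_mem_tupDeg g

/-- The infinitesimal conjugation action on polynomials of bounded degree. -/
noncomputable def tupLie (K : Type) [Field K] (N r d : ℕ) :
    Matrix (Fin N) (Fin N) K →ₗ⁅K⁆ Module.End K (tupDeg K N r d) where
  toFun Z := (tupDer Z).toLinearMap.restrict fun _ => tupDer_mem_tupDeg Z _
  map_add' Z W := by
    ext1 f
    apply Subtype.ext
    exact congrArg (fun D : Derivation K (TuplePoly K N r) (TuplePoly K N r) => D f)
      (tupDer_add Z W)
  map_smul' c Z := by
    ext1 f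
    apply Subtype.ext
    exact congrArg (fun D : Derivation K (TuplePoly K N r) (TuplePoly K N r) => D f)
      (tupDer_smul c Z)
  map_lie' {Z W} := by
    ext1 f
    apply Subtype.ext
    exact (congrArg (fun D : Derivation K (TuplePoly K N r) (TuplePoly K N r) => D f)
      (tupDer_commutator Z W)).symm

theorem tupRep_one (d : ℕ) : (tupRep d 1 : Module.End K (tupDeg K N r d)) = 1 := by
  ext1 f
  exact Subtype.ext (conjAct_one _)

theorem hasDifferential_tupRep [Infinite K] (d : ℕ) :
    HasDifferential (tupRep d : GL (Fin N) K → Module.End K (tupDeg K N r d)) (tupLie K N r d) := by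
  refine HasDifferential.of_separating (Set.range fun y : Fin r × (Fin N × Fin N) → K =>
      (aeval y : TuplePoly K N r →ₐ[K] K).toLinearMap ∘ₗ (tupDeg K N r d).subtype)
    (fun f hf => Subtype.ext (MvPolynomial.funext fun y => ?_)) ?_
  · simpa [aeval_eq_eval] using hf _ ⟨y, rfl⟩
  · rintro _ ⟨y, rfl⟩
    let y' : Fin r → Matrix (Fin N) (Fin N) K := fun k => Matrix.of fun i j => y (k, (i, j))
    have hy : y = tupSubst y' := rfl
    let φ : TuplePoly K N r →ₐ[K] GLPoly K N :=
      aeval (tupSubst fun k => yMat K N * (y' k).map C * xMat K N)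
    refine ⟨φ.toLinearMap ∘ₗ (tupDeg K N r d).subtype, fun g f => ?_, fun Z f => ?_⟩
    · change eval (glPt g) (φ f) = eval y (conjAct g f)
      rw [hy, eval_conjAct, eval_aeval_tupSubst]
      simp only [Matrix.map_mul, map_C_map_eval, glPt, xMat_map_eval, yMat_map_eval]
    · change invDer Z (φ f) = φ (tupDer Z f)
      generalize (f : TuplePoly K N r) = P
      have hX : ∀ p, invDer Z (φ (X p)) = φ (tupDer Z (X p)) := by
        intro p
        have h : ((tupMat K N p.1).map φ).map (invDer Z) =
            ((tupMat K N p.1).map (tupDer Z)).map φ := by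
          have e : (tupMat K N p.1).map φ = yMat K N * (y' p.1).map C * xMat K N :=
            tupMat_map_aeval _ _
          simp only [tupMat_map_tupDer, Matrix.map_sub _ (map_sub _), Matrix.map_mul, e,
            map_C_map_algHom, Derivation.matrix_map_mul, Derivation.map_C_map, xMat_map_invDer,
            yMat_map_invDer]
          noncomm_ring
        exact congrFun (congrFun h p.2.1) p.2.2
      induction P using MvPolynomial.induction_on with
      | C a => simp [← algebraMap_eq]
      | add f g hf hg => simp [hf, hg]
      | mul_X f p hf => simp [hf, hX]

end Tuples

section Invariants
variable {K : Type} [Field K] {N r : ℕ}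

theorem iSup_eigenspace_ad_eq_top [CharZero K] [IsAlgClosed K] {Z : Matrix (Fin N) (Fin N) K}
    (hZ : ⨆ a, Module.End.eigenspace (Matrix.toLin' Z) a = ⊤) :
    ⨆ a, Module.End.eigenspace (ad K (Matrix (Fin N) (Fin N) K) Z) a = ⊤ := by
  have h := isSemisimple_ad_matrix (Module.End.isSemisimple_of_iSup_eigenspace_eq_top hZ)
  rw [← h.iSup_maxGenEigenspace_eq_top_iff]
  exact Module.End.iSup_maxGenEigenspace_eq_top _

/-- The eigenvectors of degree at most `d` of an infinitesimal conjugation. -/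
def tupEigen (Z : Matrix (Fin N) (Fin N) K) (r d : ℕ) : Set (TuplePoly K N r) :=
  {f | f ∈ tupDeg K N r d ∧ ∃ a : K, tupDer Z f = a • f}

theorem tupLinear_le_span_tupEigen {Z : Matrix (Fin N) (Fin N) K}
    (hZ : ⨆ a, Module.End.eigenspace (ad K (Matrix (Fin N) (Fin N) K) Z) a = ⊤) :
    tupLinear K N r ≤ Submodule.span K (tupEigen Z r 1) := by
  rw [tupLinear, Submodule.span_le]
  rintro _ (rfl | ⟨⟨k, i, j⟩, rfl⟩)
  · refine Submodule.subset_span ⟨?_, 0, by simp⟩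
    rw [tupDeg, pow_one]
    exact Submodule.subset_span (Set.mem_insert _ _)
  · let τ : Matrix (Fin N) (Fin N) K →ₗ[K] TuplePoly K N r :=
      { toFun := fun A => (A.map C * tupMat K N k : Matrix _ _ (TuplePoly K N r)).trace
        map_add' := fun A B => by rw [Matrix.map_add C (by simp), add_mul, Matrix.trace_add]
        map_smul' := fun c A => by
          have h : (c • A).map (C : K →+* TuplePoly K N r) = c • A.map C := by
            ext1 i j
            simp [MvPolynomial.smul_eq_C_mul]
          rw [h, Matrix.smul_mul, Matrix.trace_smul, RingHom.id_apply] }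
    have hτ : ∀ A, τ A = (A.map C * tupMat K N k : Matrix _ _ (TuplePoly K N r)).trace :=
      fun _ => rfl
    have hder : ∀ A, tupDer Z (τ A) = τ ⁅Z, A⁆ := by
      intro A
      have h : (A.map C * tupMat K N k).map (tupDer Z) =
          A.map C * (tupMat K N k * Z.map C - Z.map C * tupMat K N k) := by
        rw [Derivation.matrix_map_mul, Derivation.map_C_map, zero_mul, zero_add, tupMat_map_tupDer]
      have h2 : tupDer Z (τ A) = ((A.map C * tupMat K N k).map (tupDer (r := r) Z)).trace := by
        rw [hτ]
        simp [Matrix.trace]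
      rw [h2, h, hτ, Ring.lie_def, Matrix.map_sub C (by simp), Matrix.map_mul, Matrix.map_mul,
        mul_sub, sub_mul, Matrix.trace_sub, Matrix.trace_sub, ← mul_assoc, Matrix.trace_mul_comm,
        mul_assoc, mul_assoc]
    have hmem : ∀ A, τ A ∈ Submodule.span K (tupEigen Z r 1) := by
      intro A
      have hA : A ∈ ⨆ a, Module.End.eigenspace (ad K (Matrix (Fin N) (Fin N) K) Z) a :=
        hZ ▸ Submodule.mem_top
      have hle : ⨆ a, Module.End.eigenspace (ad K (Matrix (Fin N) (Fin N) K) Z) a ≤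
          (Submodule.span K (tupEigen Z r 1)).comap τ := by
        refine iSup_le fun a B hB => Submodule.subset_span ⟨?_, a, ?_⟩
        · rw [tupDeg, pow_one, hτ, Matrix.trace]
          refine sum_mem fun i _ => ?_
          have := mul_tupMat_mul_mem B 1 k i i
          rwa [Matrix.map_one C (map_zero _) (map_one _), mul_one] at this
        · rw [Module.End.mem_eigenspace_iff, ad_apply] at hB
          rw [hder, hB, map_smul]
      exact hle hA
    have hX : (X (k, (i, j)) : TuplePoly K N r) = τ (Matrix.single j i 1) := by
      rw [hτ, Matrix.map_single, Matrix.trace_mul_comm, Matrix.trace_mul_single]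
      simp [tupMat]
    rw [hX]
    exact hmem _

theorem tupDeg_le_span_tupEigen {Z : Matrix (Fin N) (Fin N) K}
    (hZ : ⨆ a, Module.End.eigenspace (ad K (Matrix (Fin N) (Fin N) K) Z) a = ⊤) (d : ℕ) :
    tupDeg K N r d ≤ Submodule.span K (tupEigen Z r d) := by
  induction d with
  | zero =>
    intro f hf
    have hf' := hf
    rw [tupDeg, pow_zero, Submodule.mem_one] at hf
    obtain ⟨a, rfl⟩ := hf
    exact Submodule.subset_span ⟨hf', 0, by simp⟩
  | succ d ih =>
    have h := mul_le_mul' ih (tupLinear_le_span_tupEigen (r := r) hZ)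
    rw [Submodule.span_mul_span, ← pow_succ] at h
    refine h.trans (Submodule.span_mono ?_)
    rintro _ ⟨f, ⟨hf, a, ha⟩, g, ⟨hg, b, hb⟩, rfl⟩
    refine ⟨?_, a + b, ?_⟩
    · rw [tupDeg, pow_one] at hg
      rw [tupDeg, pow_succ]
      exact Submodule.mul_mem_mul hf hg
    · simp only [Derivation.leibniz, ha, hb, smul_eq_mul, mul_smul_comm]
      rw [mul_comm g f, add_smul, add_comm]

theorem iSup_eigenspace_tupLie_eq_top {Z : Matrix (Fin N) (Fin N) K}
    (hZ : ⨆ a, Module.End.eigenspace (ad K (Matrix (Fin N) (Fin N) K) Z) a = ⊤) (d : ℕ) :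
    ⨆ a, Module.End.eigenspace (tupLie K N r d Z) a = ⊤ := by
  rw [eq_top_iff]
  rintro ⟨f, hf⟩ -
  have h : tupDeg K N r d ≤ (⨆ a, Module.End.eigenspace (tupLie K N r d Z) a).map
      (tupDeg K N r d).subtype := by
    refine (tupDeg_le_span_tupEigen hZ d).trans (Submodule.span_le.mpr ?_)
    rintro f ⟨hf, a, ha⟩
    refine ⟨⟨f, hf⟩, Submodule.mem_iSup_of_mem a ?_, rfl⟩
    exact Module.End.mem_eigenspace_iff.mpr (Subtype.ext ha)
  obtain ⟨f', hf', rfl⟩ := h hf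
  exact hf'

/-- Disjoint invariant closed sets are separated by an invariant polynomial. -/
theorem exists_invariant [CharZero K] [IsAlgClosed K] {G : Subgroup (GL (Fin N) K)}
    (hG : (vanIdeal G).IsPrime) (hred : IsReductiveAlg K (lieAlg G))
    (hz : ∀ z ∈ center K (lieAlg G),
      ⨆ a, Module.End.eigenspace (Matrix.toLin' (z : Matrix (Fin N) (Fin N) K)) a = ⊤)
    (I J : Ideal (TuplePoly K N r)) (hI : ∀ g ∈ G, ∀ f ∈ I, conjAct g f ∈ I)
    (hJ : ∀ g ∈ G, ∀ f ∈ J, conjAct g f ∈ J) (hIJ : I ⊔ J = ⊤) :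
    ∃ a ∈ I, 1 - a ∈ J ∧ ∀ g ∈ G, conjAct g a = a := by
  obtain ⟨a, ha, b, hb, hab⟩ := Submodule.mem_sup.mp
    (hIJ ▸ Submodule.mem_top : (1 : TuplePoly K N r) ∈ I ⊔ J)
  obtain ⟨d, hd⟩ := exists_mem_tupDeg a
  let U : Submodule K (tupDeg K N r d) :=
    ((I.restrictScalars K) ⊓ (J.restrictScalars K)).comap (tupDeg K N r d).subtype
  obtain ⟨U', h1, h2⟩ := (hasDifferential_tupRep d).exists_isCompl hG hred _ (tupRep_one d)
    (fun z hz' => Module.End.isSemisimple_of_iSup_eigenspace_eq_top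
      (iSup_eigenspace_tupLie_eq_top (iSup_eigenspace_ad_eq_top (hz z hz')) d))
    U (fun g hg f hf => ⟨hI g hg _ hf.1, hJ g hg _ hf.2⟩)
  obtain ⟨a₀, ha₀, a₁, ha₁, he⟩ := Submodule.mem_sup.mp
    (h2.sup_eq_top ▸ Submodule.mem_top : (⟨a, hd⟩ : tupDeg K N r d) ∈ U ⊔ U')
  have he' : (a₀ : TuplePoly K N r) + a₁ = a := congrArg Subtype.val he
  have hI₁ : (a₁ : TuplePoly K N r) ∈ I := by
    rw [show (a₁ : TuplePoly K N r) = a - a₀ by rw [← he']; ring]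
    exact sub_mem ha ha₀.1
  have hJ₁ : 1 - (a₁ : TuplePoly K N r) ∈ J := by
    rw [show 1 - (a₁ : TuplePoly K N r) = b + a₀ by rw [← hab, ← he']; ring]
    exact add_mem hb ha₀.2
  refine ⟨a₁, hI₁, hJ₁, fun g hg => ?_⟩
  have h3 : tupRep d g a₁ - a₁ ∈ U := by
    refine ⟨sub_mem (hI g hg _ hI₁) hI₁, ?_⟩
    have h4 := sub_mem hJ₁ (hJ g hg _ hJ₁)
    rw [map_sub, map_one] at h4
    rwa [sub_sub_sub_cancel_left] at h4
  have h4 := (Submodule.disjoint_def.mp h2.disjoint) _ h3 (sub_mem (h1 g hg _ ha₁) ha₁)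
  exact congrArg Subtype.val (sub_eq_zero.mp h4)

end Invariants

section Chevalley
variable {K : Type} [Field K]

/-- A dominant map of affine varieties is surjective over a nonempty open set. -/
theorem exists_preimage_of_generic [IsAlgClosed K] {σ τ : Type} [Finite σ] [Finite τ]
    (ω : MvPolynomial σ K →ₐ[K] MvPolynomial τ K) (P : Ideal (MvPolynomial τ K)) [P.IsPrime] :
    ∃ s : MvPolynomial σ K, ω s ∉ P ∧
      ∀ y : σ → K, (∀ f, ω f ∈ P → eval y f = 0) → eval y s ≠ 0 →
        ∃ u : τ → K, (∀ f ∈ P, eval u f = 0) ∧ ∀ f, eval u (ω f) = eval y f := by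
  let π := Ideal.Quotient.mkₐ K P
  let φ : MvPolynomial σ K →ₐ[K] MvPolynomial τ K ⧸ P := π.comp ω
  have hφ : ∀ f, φ f = 0 ↔ ω f ∈ P := fun f => Ideal.Quotient.eq_zero_iff_mem
  have hfin : (φ : MvPolynomial σ K →+* MvPolynomial τ K ⧸ P).FinitePresentation := by
    rw [← RingHom.FinitePresentation.of_finiteType]
    refine RingHom.FiniteType.of_comp_finiteType
      (f := algebraMap K (MvPolynomial σ K)) ?_
    rw [AlgHom.comp_algebraMap, RingHom.finiteType_algebraMap]
    infer_instance
  obtain ⟨S, hS⟩ := PrimeSpectrum.exists_constructibleSetData_iff.mpr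
    (PrimeSpectrum.isConstructible_range_comap hfin)
  let p₀ : PrimeSpectrum (MvPolynomial τ K ⧸ P) := ⟨⊥, Ideal.isPrime_bot⟩
  have h₀ : PrimeSpectrum.comap (φ : MvPolynomial σ K →+* MvPolynomial τ K ⧸ P) p₀ ∈ S.toSet :=
    hS ▸ ⟨p₀, rfl⟩
  obtain ⟨T, hT, hT'⟩ : ∃ T ∈ S,
      PrimeSpectrum.comap (φ : MvPolynomial σ K →+* MvPolynomial τ K ⧸ P) p₀ ∈ T.toSet := by
    simpa [PrimeSpectrum.ConstructibleSetData.toSet] using h₀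
  refine ⟨T.f, fun h => hT'.2 ?_, fun y hy hys => ?_⟩
  · rw [PrimeSpectrum.mem_zeroLocus, Set.singleton_subset_iff]
    exact (hφ _).mpr h
  · let m : PrimeSpectrum (MvPolynomial σ K) := ⟨RingHom.ker (eval y), RingHom.ker_isPrime _⟩
    have hm : m ∈ S.toSet := by
      refine Set.mem_iUnion₂.mpr ⟨T, hT, ?_, fun h => hys ?_⟩
      · rw [PrimeSpectrum.mem_zeroLocus]
        exact fun f hf => hy f ((hφ f).mp (hT'.1 hf))
      · rw [PrimeSpectrum.mem_zeroLocus, Set.singleton_subset_iff] at h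
        exact h
    rw [hS] at hm
    obtain ⟨q, hq⟩ := hm
    let q' := q.asIdeal.comap π
    obtain ⟨M, hM, hqM⟩ := Ideal.exists_le_maximal q' (Ideal.comap_ne_top _ q.isPrime.ne_top)
    obtain ⟨u, rfl⟩ := MvPolynomial.isMaximal_iff_eq_vanishingIdeal_singleton.mp hM
    have hu : ∀ f ∈ q', eval u f = 0 := fun f hf =>
      (mem_vanishingIdeal_singleton_iff u f).mp (hqM hf)
    have hq' : ∀ f, eval y f = 0 → eval u (ω f) = 0 := by
      intro f hf
      refine hu _ ?_
      have : f ∈ (PrimeSpectrum.comap (φ : MvPolynomial σ K →+* MvPolynomial τ K ⧸ P) q).asIdeal := by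
        rw [hq]
        exact hf
      exact this
    refine ⟨u, fun f hf => hu f ?_, fun f => ?_⟩
    · change π f ∈ q.asIdeal
      rw [show π f = 0 from Ideal.Quotient.eq_zero_iff_mem.mpr hf]
      exact zero_mem _
    · have := hq' (f - C (eval y f)) (by simp)
      rw [map_sub, map_sub, sub_eq_zero, ← algebraMap_eq, AlgHom.commutes, algebraMap_eq,
        eval_C] at this
      exact this

end Chevalley

section Orbits
variable {K : Type} [Field K] {N r : ℕ}

/-- Simultaneous conjugation. -/
def conjTup (g : GL (Fin N) K) (y : Fin r → Matrix (Fin N) (Fin N) K) :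
    Fin r → Matrix (Fin N) (Fin N) K :=
  fun k => (g : Matrix (Fin N) (Fin N) K) * y k * ((g⁻¹ : GL (Fin N) K) : Matrix (Fin N) (Fin N) K)

theorem conjTup_mul (g h : GL (Fin N) K) (y : Fin r → Matrix (Fin N) (Fin N) K) :
    conjTup (g * h) y = conjTup g (conjTup h y) := by
  funext k
  simp only [conjTup, _root_.mul_inv_rev, Units.val_mul, mul_assoc]

theorem conjTup_one (y : Fin r → Matrix (Fin N) (Fin N) K) : conjTup 1 y = y := by
  funext k
  simp [conjTup]

theorem eval_conjAct_eq (g : GL (Fin N) K) (y : Fin r → Matrix (Fin N) (Fin N) K) (f) :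
    eval (tupSubst y) (conjAct g f) = eval (tupSubst (conjTup g⁻¹ y)) f := by
  rw [eval_conjAct, show conjTup g⁻¹ y = _ from funext fun k => by rw [conjTup, inv_inv]]

/-- The polynomials vanishing on a set of tuples. -/
noncomputable def tupIdeal (S : Set (Fin r → Matrix (Fin N) (Fin N) K)) : Ideal (TuplePoly K N r) :=
  ⨅ y : S, RingHom.ker (eval (tupSubst (y : Fin r → Matrix (Fin N) (Fin N) K)))

theorem mem_tupIdeal {S : Set (Fin r → Matrix (Fin N) (Fin N) K)} {f : TuplePoly K N r} :
    f ∈ tupIdeal S ↔ ∀ y ∈ S, eval (tupSubst y) f = 0 := by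
  simp [tupIdeal, RingHom.mem_ker]

theorem conjAct_mem_tupIdeal {G : Subgroup (GL (Fin N) K)}
    {S : Set (Fin r → Matrix (Fin N) (Fin N) K)} (hS : ∀ g ∈ G, ∀ y ∈ S, conjTup g y ∈ S) :
    ∀ g ∈ G, ∀ f ∈ tupIdeal S, conjAct g f ∈ tupIdeal S := by
  refine fun g hg f hf => mem_tupIdeal.mpr fun y hy => ?_
  rw [eval_conjAct_eq]
  exact mem_tupIdeal.mp hf _ (hS _ (inv_mem hg) y hy)

theorem tupDer_mem_of_stable [Infinite K] {G : Subgroup (GL (Fin N) K)} {I : Ideal (TuplePoly K N r)}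
    (hI : ∀ g ∈ G, ∀ f ∈ I, conjAct g f ∈ I) :
    ∀ Z ∈ lieAlg G, ∀ f ∈ I, tupDer Z f ∈ I := by
  intro Z hZ f hf
  obtain ⟨d, hd⟩ := exists_mem_tupDeg f
  exact (hasDifferential_tupRep d).lie_stable (tupRep_one d)
    ((I.restrictScalars K).comap (tupDeg K N r d).subtype) (fun g hg w hw => hI g hg w hw) Z hZ
    ⟨f, hd⟩ hf

/-- An orbit contains a nonempty open part of its closure. -/
theorem exists_open_subset_orbit [IsAlgClosed K] {G : Subgroup (GL (Fin N) K)}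
    (hG : (vanIdeal G).IsPrime)
    (hGcl : ∀ u : GL (Fin N) K, (∀ P ∈ vanIdeal G, eval (glPt u) P = 0) → u ∈ G)
    (q : Fin r → Matrix (Fin N) (Fin N) K) :
    ∃ s : TuplePoly K N r, s ∉ tupIdeal {y | ∃ g ∈ G, y = conjTup g q} ∧
      ∀ y, (∀ f ∈ tupIdeal {y | ∃ g ∈ G, y = conjTup g q}, eval (tupSubst y) f = 0) →
        eval (tupSubst y) s ≠ 0 → ∃ g ∈ G, y = conjTup g q := by
  let ω : TuplePoly K N r →ₐ[K] GLPoly K N :=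
    aeval (tupSubst fun k => xMat K N * (q k).map C * yMat K N)
  have hω : ∀ g f, eval (glPt g) (ω f) = eval (tupSubst (conjTup g q)) f := by
    intro g f
    rw [eval_aeval_tupSubst]
    simp only [Matrix.map_mul, map_C_map_eval, glPt, xMat_map_eval, yMat_map_eval]
    rfl
  have hω' : ∀ f, ω f ∈ vanIdeal G ↔ f ∈ tupIdeal {y | ∃ g ∈ G, y = conjTup g q} := by
    intro f
    rw [mem_vanIdeal, mem_tupIdeal]
    constructor
    · rintro h _ ⟨g, hg, rfl⟩
      rw [← hω]
      exact h g hg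
    · intro h g hg
      rw [hω]
      exact h _ ⟨g, hg, rfl⟩
  obtain ⟨s, hs, hs'⟩ := exists_preimage_of_generic ω (vanIdeal G)
  refine ⟨s, fun h => hs ((hω' s).mpr h), fun y hy hys => ?_⟩
  obtain ⟨u, hu, hu'⟩ := hs' (tupSubst y) (fun f hf => hy f ((hω' f).mp hf)) hys
  let A : Matrix (Fin N) (Fin N) K := Matrix.of fun i j => u ((), Sum.inl (i, j))
  let B : Matrix (Fin N) (Fin N) K := Matrix.of fun i j => u ((), Sum.inr (i, j))
  have huA : u = matSubst A B := by
    funext ⟨_, p⟩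
    cases p <;> rfl
  have hx : (xMat K N).map (eval u) = A := huA ▸ xMat_map_eval A B
  have hy : (yMat K N).map (eval u) = B := huA ▸ yMat_map_eval A B
  have hAB : A * B = 1 := by
    have h1 : ∀ i j, (xMat K N * yMat K N - 1 : Matrix _ _ (GLPoly K N)) i j ∈ vanIdeal G := by
      refine fun i j => mem_vanIdeal.mpr fun g _ => ?_
      have h : (xMat K N * yMat K N - 1).map (eval (glPt g)) = 0 := by
        rw [Matrix.map_sub _ (map_sub _), Matrix.map_mul, glPt, xMat_map_eval, yMat_map_eval,
          Matrix.map_one _ (map_zero _) (map_one _), ← Units.val_mul, mul_inv_cancel, Units.val_one,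
          sub_self]
      exact congrFun (congrFun h i) j
    have h2 : (xMat K N * yMat K N - 1).map (eval u) = 0 := by
      ext1 i j
      exact hu _ (h1 i j)
    rwa [Matrix.map_sub _ (map_sub _), Matrix.map_mul, hx, hy,
      Matrix.map_one _ (map_zero _) (map_one _), sub_eq_zero] at h2
  let g : GL (Fin N) K := ⟨A, B, hAB, mul_eq_one_comm.mp hAB⟩
  have hug : u = glPt g := huA
  refine ⟨g, hGcl g (hug ▸ hu), ?_⟩
  funext k
  ext i j
  have h := hu' (X (k, (i, j)))
  rw [hug, hω] at h
  simpa [tupSubst] using h.symm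

/-- Orbits whose tangent spaces exhaust those of `O` are open in `O`. -/
theorem exists_orbit_open [CharZero K] [IsAlgClosed K] {G : Subgroup (GL (Fin N) K)}
    (hG : (vanIdeal G).IsPrime)
    (hGcl : ∀ u : GL (Fin N) K, (∀ P ∈ vanIdeal G, eval (glPt u) P = 0) → u ∈ G)
    {O : Set (Fin r → Matrix (Fin N) (Fin N) K)} (hO : ∀ g ∈ G, ∀ y ∈ O, conjTup g y ∈ O)
    (htan : ∀ q ∈ O, ∀ v : Fin r → Matrix (Fin N) (Fin N) K,
      (∀ f ∈ tupIdeal O, ∑ i, eval (tupSubst q) (pderiv i f) * tupSubst v i = 0) →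
        ∃ Z ∈ lieAlg G, ∀ k, v k = q k * Z - Z * q k)
    {q : Fin r → Matrix (Fin N) (Fin N) K} (hq : q ∈ O) :
    ∃ t : TuplePoly K N r, eval (tupSubst q) t ≠ 0 ∧
      ∀ y ∈ O, eval (tupSubst y) t ≠ 0 → ∃ g ∈ G, y = conjTup g q := by
  classical
  let F := tupIdeal {y | ∃ g ∈ G, y = conjTup g q}
  have hFst : ∀ g ∈ G, ∀ f ∈ F, conjAct g f ∈ F := by
    refine conjAct_mem_tupIdeal ?_
    rintro g hg _ ⟨h, hh, rfl⟩
    exact ⟨g * h, mul_mem hg hh, (conjTup_mul g h q).symm⟩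
  have hOst := conjAct_mem_tupIdeal hO
  have hloc : ∀ f ∈ F, ∃ s, eval (tupSubst q) s = 1 ∧ s * f ∈ tupIdeal O := by
    refine exists_mul_mem_of_derivations (tupSubst q) (tupIdeal O)
      (fun f hf => mem_tupIdeal.mp hf q hq) (tupDer '' lieAlg G) ?_ ?_ F ?_ ?_
    · rintro _ ⟨Z, hZ, rfl⟩ f hf
      exact tupDer_mem_of_stable hOst Z hZ f hf
    · intro v hv
      let v' : Fin r → Matrix (Fin N) (Fin N) K := fun k => Matrix.of fun i j => v (k, (i, j))
      obtain ⟨Z, hZ, hZ'⟩ := htan q hq v' hv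
      refine ⟨_, ⟨Z, hZ, rfl⟩, fun p => ?_⟩
      have h : ((tupMat K N p.1).map (tupDer Z)).map (eval (tupSubst q)) = v' p.1 := by
        rw [tupMat_map_tupDer, Matrix.map_sub _ (map_sub _), Matrix.map_mul, Matrix.map_mul,
          map_C_map_eval, tupMat_map_eval, hZ']
      exact congrFun (congrFun h p.2.1) p.2.2
    · exact fun f hf => mem_tupIdeal.mp hf q ⟨1, one_mem G, (conjTup_one q).symm⟩
    · rintro _ ⟨Z, hZ, rfl⟩ f hf
      exact tupDer_mem_of_stable hFst Z hZ f hf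
  choose! s hs hsF using hloc
  obtain ⟨T, hT⟩ := IsNoetherian.noetherian F
  have hTF : ∀ f ∈ T, f ∈ F := fun f hf => hT ▸ Submodule.subset_span hf
  let S := ∏ f ∈ T, s f
  have hS : eval (tupSubst q) S = 1 := by
    rw [map_prod]
    exact Finset.prod_eq_one fun f hf => hs f (hTF f hf)
  have hSF : ∀ f ∈ F, S * f ∈ tupIdeal O := by
    intro f hf
    rw [← hT] at hf
    induction hf using Submodule.span_induction with
    | mem f hf =>
      obtain ⟨c, hc⟩ := Finset.dvd_prod_of_mem s hf
      rw [show S = s f * c from hc, mul_right_comm]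
      exact Ideal.mul_mem_right _ _ (hsF f (hTF f hf))
    | zero => simp
    | add a b _ _ ha hb =>
      rw [mul_add]
      exact add_mem ha hb
    | smul a b _ hb =>
      rw [smul_eq_mul, mul_left_comm]
      exact Ideal.mul_mem_left _ _ hb
  obtain ⟨t₀, ht₀, ht₀'⟩ := exists_open_subset_orbit hG hGcl q
  rw [mem_tupIdeal] at ht₀
  push Not at ht₀
  obtain ⟨_, ⟨g, hg, rfl⟩, hgt⟩ := ht₀
  refine ⟨S * conjAct g⁻¹ t₀, ?_, fun y hy hyt => ?_⟩
  · rw [map_mul, hS, one_mul, eval_conjAct_eq, inv_inv]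
    exact hgt
  · rw [map_mul, mul_ne_zero_iff, eval_conjAct_eq, inv_inv] at hyt
    have hcl : ∀ f ∈ F, eval (tupSubst (conjTup g y)) f = 0 := by
      intro f hf
      have h1 := mem_tupIdeal.mp (hSF _ (hFst _ (inv_mem hg) f hf)) y hy
      rw [map_mul, eval_conjAct_eq, inv_inv, mul_eq_zero] at h1
      exact h1.resolve_left hyt.1
    obtain ⟨h, hh, hy'⟩ := ht₀' (conjTup g y) hcl hyt.2
    refine ⟨g⁻¹ * h, mul_mem (inv_mem hg) hh, ?_⟩
    rw [conjTup_mul, ← hy', ← conjTup_mul, inv_mul_cancel, conjTup_one]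

/-- If all orbits in a closed set are open, each orbit is separated from its complement by
invariant polynomials. -/
theorem exists_invariant_of_orbits_open [CharZero K] [IsAlgClosed K] {G : Subgroup (GL (Fin N) K)}
    (hG : (vanIdeal G).IsPrime) (hred : IsReductiveAlg K (lieAlg G))
    (hz : ∀ z ∈ center K (lieAlg G),
      ⨆ a, Module.End.eigenspace (Matrix.toLin' (z : Matrix (Fin N) (Fin N) K)) a = ⊤)
    {O : Set (Fin r → Matrix (Fin N) (Fin N) K)} (hO : ∀ g ∈ G, ∀ y ∈ O, conjTup g y ∈ O)
    (hOcl : ∀ y, (∀ f ∈ tupIdeal O, eval (tupSubst y) f = 0) → y ∈ O)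
    (hopen : ∀ q ∈ O, ∃ t : TuplePoly K N r, eval (tupSubst q) t ≠ 0 ∧
      ∀ y ∈ O, eval (tupSubst y) t ≠ 0 → ∃ g ∈ G, y = conjTup g q)
    {p q : Fin r → Matrix (Fin N) (Fin N) K} (hp : p ∈ O) (hq : q ∈ O)
    (hpq : ∀ g ∈ G, q ≠ conjTup g p) :
    ∃ a : TuplePoly K N r, (∀ g ∈ G, conjAct g a = a) ∧ eval (tupSubst p) a ≠ eval (tupSubst q) a := by
  let C₁ := {y | ∃ g ∈ G, y = conjTup g p}
  let C₂ := O \ C₁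
  have hC₁ : ∀ g ∈ G, ∀ y ∈ C₁, conjTup g y ∈ C₁ := by
    rintro g hg _ ⟨h, hh, rfl⟩
    exact ⟨g * h, mul_mem hg hh, (conjTup_mul g h p).symm⟩
  have hC₁O : C₁ ⊆ O := by
    rintro _ ⟨g, hg, rfl⟩
    exact hO g hg p hp
  have hC₂ : ∀ g ∈ G, ∀ y ∈ C₂, conjTup g y ∈ C₂ := by
    refine fun g hg y hy => ⟨hO g hg y hy.1, fun h => hy.2 ?_⟩
    have := hC₁ g⁻¹ (inv_mem hg) _ h
    rwa [← conjTup_mul, inv_mul_cancel, conjTup_one] at this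
  have hsup : tupIdeal C₁ ⊔ tupIdeal C₂ = ⊤ := by
    by_contra hne
    obtain ⟨M, hM, hle⟩ := Ideal.exists_le_maximal _ hne
    obtain ⟨u, rfl⟩ := MvPolynomial.isMaximal_iff_eq_vanishingIdeal_singleton.mp hM
    let y : Fin r → Matrix (Fin N) (Fin N) K := fun k => Matrix.of fun i j => u (k, (i, j))
    have h1 : ∀ f ∈ tupIdeal C₁, eval (tupSubst y) f = 0 := fun f hf =>
      (mem_vanishingIdeal_singleton_iff u f).mp (hle (Ideal.mem_sup_left hf))
    have h2 : ∀ f ∈ tupIdeal C₂, eval (tupSubst y) f = 0 := fun f hf =>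
      (mem_vanishingIdeal_singleton_iff u f).mp (hle (Ideal.mem_sup_right hf))
    have hyO : y ∈ O := hOcl y fun f hf =>
      h1 f (mem_tupIdeal.mpr fun z hz => mem_tupIdeal.mp hf z (hC₁O hz))
    obtain ⟨t, ht, ht'⟩ := hopen y hyO
    by_cases hy : y ∈ C₁
    · obtain ⟨g, hg, hgy⟩ := hy
      refine ht (h2 t (mem_tupIdeal.mpr fun z hz => ?_))
      by_contra hne
      obtain ⟨h, hh, rfl⟩ := ht' z hz.1 hne
      exact hz.2 ⟨h * g, mul_mem hh hg, by rw [hgy, conjTup_mul]⟩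
    · refine ht (h1 t (mem_tupIdeal.mpr fun z hz => ?_))
      by_contra hne
      obtain ⟨h, hh, rfl⟩ := ht' z (hC₁O hz) hne
      refine hy ?_
      have := hC₁ h⁻¹ (inv_mem hh) _ hz
      rwa [← conjTup_mul, inv_mul_cancel, conjTup_one] at this
  obtain ⟨a, ha, ha', hinv⟩ := exists_invariant hG hred hz _ _ (conjAct_mem_tupIdeal hC₁)
    (conjAct_mem_tupIdeal hC₂) hsup
  refine ⟨a, hinv, ?_⟩
  rw [mem_tupIdeal.mp ha p ⟨1, one_mem G, (conjTup_one p).symm⟩]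
  have := mem_tupIdeal.mp ha' q ⟨hq, fun ⟨g, hg, h⟩ => hpq g hg h⟩
  rw [map_sub, map_one, sub_eq_zero] at this
  rw [← this]
  exact zero_ne_one

end Orbits

section SemisimpleAlgebra
variable {K A V W : Type} [Field K] [Ring A] [Algebra K A] [AddCommGroup V] [Module K V]
  [AddCommGroup W] [Module K W]

/-- A finite-dimensional algebra with a faithful semisimple module is semisimple. -/
theorem isSemisimpleRing_of_faithful [Module.Finite K A] (ψ : A →ₐ[K] Module.End K V)
    (hψ : Function.Injective ψ)
    (hss : ∀ U : Submodule K V, (∀ x, ∀ w ∈ U, ψ x w ∈ U) →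
      ∃ U' : Submodule K V, (∀ x, ∀ w ∈ U', ψ x w ∈ U') ∧ IsCompl U U') : IsSemisimpleRing A := by
  let _i : Module A V := Module.compHom V ψ.toRingHom
  have hsmul : ∀ (a : A) (v : V), a • v = ψ a v := fun _ _ => rfl
  have hcomp : ∀ U : Submodule A V, ∃ U' : Submodule A V, IsCompl U U' := by
    intro U
    obtain ⟨U', h1, h2⟩ := hss
      { U with
        smul_mem' := fun c v hv => by
          have := U.smul_mem (algebraMap K A c) hv
          rwa [hsmul, AlgHom.commutes, Module.algebraMap_end_apply] at this }
      fun x w hw => U.smul_mem x hw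
    refine ⟨{ U' with smul_mem' := fun x w hw => h1 x w hw }, ?_⟩
    rw [isCompl_iff, Submodule.disjoint_def, Submodule.codisjoint_iff_exists_add_eq] at h2 ⊢
    exact h2
  have : IsSemisimpleModule A V := { toComplementedLattice := ⟨hcomp⟩ }
  have : IsArtinianRing A := IsArtinianRing.of_finite K A
  rw [IsArtinianRing.isSemisimpleRing_iff_jacobson, eq_bot_iff]
  intro a ha
  have h := IsSemisimpleModule.jacobson_le_annihilator A V ha
  rw [Module.mem_annihilator] at h
  exact hψ (by rw [map_zero]; exact LinearMap.ext h)

/-- Over a semisimple algebra, injective intertwining maps split. -/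
theorem exists_leftInverse_of_isSemisimpleRing [IsSemisimpleRing A] (ψ₁ : A →ₐ[K] Module.End K V)
    (ψ₂ : A →ₐ[K] Module.End K W) (i : V →ₗ[K] W) (hi : Function.Injective i)
    (hi' : ∀ a v, i (ψ₁ a v) = ψ₂ a (i v)) :
    ∃ p : W →ₗ[K] V, (∀ v, p (i v) = v) ∧ ∀ a w, p (ψ₂ a w) = ψ₁ a (p w) := by
  let _i : Module A V := Module.compHom V ψ₁.toRingHom
  let _j : Module A W := Module.compHom W ψ₂.toRingHom
  let i' : V →ₗ[A] W := { i with map_smul' := fun a v => hi' a v }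
  obtain ⟨p, hp⟩ := IsSemisimpleModule.extension_property i' hi LinearMap.id
  refine ⟨{ p with map_smul' := fun c w => ?_ }, fun v => LinearMap.congr_fun hp v,
    fun a w => p.map_smul a w⟩
  have h := p.map_smul (algebraMap K A c) w
  change p (ψ₂ (algebraMap K A c) w) = ψ₁ (algebraMap K A c) (p w) at h
  rwa [AlgHom.commutes, AlgHom.commutes, Module.algebraMap_end_apply,
    Module.algebraMap_end_apply] at h

/-- Derivations of a semisimple algebra into the endomorphisms of a module are inner. -/
theorem exists_inner_of_isSemisimpleRing [IsSemisimpleRing A] (φ : A →ₐ[K] Module.End K V)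
    (η : A →ₗ[K] Module.End K V) (hη : ∀ a b, η (a * b) = η a * φ b + φ a * η b) :
    ∃ X : Module.End K V, ∀ a, η a = φ a * X - X * φ a := by
  have hη1 : η 1 = 0 := by simpa using hη 1 1
  let Ψ : A →ₐ[K] Module.End K (V × V) := AlgHom.ofLinearMap
    { toFun := fun a => ((φ a).coprod (η a)).prod ((φ a) ∘ₗ LinearMap.snd K V V)
      map_add' := fun a b => by
        ext <;> simp
      map_smul' := fun c a => by
        ext <;> simp }
    (by
      refine LinearMap.ext fun v => ?_
      simp [hη1])
    (fun a b => by
      refine LinearMap.ext fun v => ?_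
      simp [hη]
      abel)
  have hΨ : ∀ a v, Ψ a v = (φ a v.1 + η a v.2, φ a v.2) := fun a v => rfl
  obtain ⟨p, hp, hp'⟩ := exists_leftInverse_of_isSemisimpleRing φ Ψ (LinearMap.inl K V V)
    LinearMap.inl_injective (fun a v => by simp [hΨ])
  refine ⟨p ∘ₗ LinearMap.inr K V V, fun a => LinearMap.ext fun w => ?_⟩
  have h := hp' a (0, w)
  have h2 : Ψ a (0, w) = LinearMap.inl K V V (η a w) + LinearMap.inr K V V (φ a w) := by
    simp [hΨ]
  rw [h2, map_add, hp] at h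
  simp only [LinearMap.sub_apply, Module.End.mul_apply, LinearMap.comp_apply]
  rw [eq_sub_iff_add_eq]
  exact h

/-- Nondegeneracy of the trace form of a semisimple algebra of endomorphisms. -/
theorem eq_zero_of_trace_mul_eq_zero [CharZero K] [Module.Finite K V] [IsSemisimpleRing A]
    (ψ : A →ₐ[K] Module.End K V) (hψ : Function.Injective ψ) (x : A)
    (hx : ∀ y, LinearMap.trace K V (ψ (y * x)) = 0) : x = 0 := by
  obtain ⟨e, he, heq⟩ := IsSemisimpleRing.ideal_eq_span_idempotent (Ideal.span {x})
  have hmem : e ∈ Ideal.span {x} := heq ▸ Ideal.mem_span_singleton_self e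
  obtain ⟨y, hy⟩ := Ideal.mem_span_singleton'.mp hmem
  have htr : LinearMap.trace K V (ψ e) = 0 := hy ▸ hx y
  have hψe : IsIdempotentElem (ψ e) := he.map ψ
  have hproj := LinearMap.IsIdempotentElem.isProj_range (ψ e) hψe
  rw [hproj.trace, Nat.cast_eq_zero, Submodule.finrank_eq_zero, LinearMap.range_eq_bot,
    map_eq_zero_iff ψ hψ] at htr
  have hx' : x ∈ Ideal.span {e} := heq ▸ Ideal.mem_span_singleton_self x
  rw [htr, Ideal.span_singleton_eq_bot.mpr rfl] at hx'
  exact hx'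

end SemisimpleAlgebra

theorem exists_algHom_of_ker_le {K A B E : Type*} [Field K] [Ring A] [Algebra K A] [Ring B]
    [Algebra K B] [Ring E] [Algebra K E] (f : B →ₐ[K] A) (hf : Function.Surjective f)
    (g : B →ₐ[K] E) (hfg : ∀ x, f x = 0 → g x = 0) : ∃ φ : A →ₐ[K] E, ∀ x, φ (f x) = g x := by
  obtain ⟨s, hs⟩ := f.toLinearMap.exists_rightInverse_of_surjective (LinearMap.range_eq_top.mpr hf)
  have hs' : ∀ a, f (s a) = a := fun a => LinearMap.congr_fun hs a
  have hgs : ∀ x y, f x = f y → g x = g y := fun x y h => by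
    rw [← sub_eq_zero, ← map_sub]
    exact hfg _ (by rw [map_sub, h, sub_self])
  refine ⟨AlgHom.ofLinearMap (g.toLinearMap ∘ₗ s) ?_ fun a b => ?_, fun x => ?_⟩
  · change g (s 1) = 1
    rw [← map_one g]
    exact hgs _ _ (by rw [hs', map_one])
  · change g (s (a * b)) = g (s a) * g (s b)
    rw [← map_mul g]
    exact hgs _ _ (by rw [map_mul f, hs', hs', hs'])
  · exact hgs _ _ (hs' _)

section RepresentationVariety
variable {K A : Type} [Field K] [Ring A] [Algebra K A] {N r : ℕ}

/-- The generic value at an element of `A` of a linear map given by the images of a basis. -/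
noncomputable def repMat (N : ℕ) (b : Module.Basis (Fin r) K A) :
    A →ₗ[K] Matrix (Fin N) (Fin N) (TuplePoly K N r) :=
  b.constr K (tupMat K N)

theorem repMat_map_eval (b : Module.Basis (Fin r) K A) (y : Fin r → Matrix (Fin N) (Fin N) K)
    (x : A) : (repMat N b x).map (eval (tupSubst y)) = b.constr K y x := by
  ext1 i j
  simp [repMat, Module.Basis.constr_apply_fintype, Matrix.sum_apply, smul_eq_C_mul, tupMat, tupSubst]

/-- The derivative in the direction of a tuple of matrices. -/
noncomputable def dirDer (v : Fin r → Matrix (Fin N) (Fin N) K) :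
    Derivation K (TuplePoly K N r) (TuplePoly K N r) :=
  mkDerivation K fun p => C (tupSubst v p)

theorem eval_dirDer (v : Fin r → Matrix (Fin N) (Fin N) K) (p) (f : TuplePoly K N r) :
    eval p (dirDer v f) = ∑ i, eval p (pderiv i f) * tupSubst v i := by
  rw [eval_derivation]
  simp [dirDer, mkDerivation_X]

theorem repMat_map_dirDer (b : Module.Basis (Fin r) K A) (v : Fin r → Matrix (Fin N) (Fin N) K)
    (x : A) : (repMat N b x).map (dirDer v) = (b.constr K v x).map C := by
  ext1 i j
  simp [repMat, Module.Basis.constr_apply_fintype, Matrix.sum_apply, smul_eq_C_mul, tupMat, tupSubst,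
    dirDer, mkDerivation_X]

/-- The tuples of elements of `H` which are the images of a basis under a representation. -/
def repVar (H : Subgroup (GL (Fin N) K)) (b : Module.Basis (Fin r) K A) :
    Set (Fin r → Matrix (Fin N) (Fin N) K) :=
  {y | ∃ φ : A →ₐ[K] Matrix (Fin N) (Fin N) K, (∀ k, y k = φ (b k)) ∧
    ∀ k, ∃ h ∈ H, (h : Matrix (Fin N) (Fin N) K) = y k}

theorem constr_eq_of_forall {b : Module.Basis (Fin r) K A} {y : Fin r → Matrix (Fin N) (Fin N) K}
    {φ : A →ₐ[K] Matrix (Fin N) (Fin N) K} (h : ∀ k, y k = φ (b k)) (x : A) :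
    b.constr K y x = φ x := by
  have : b.constr K y = φ.toLinearMap := b.ext fun k => by
    rw [Module.Basis.constr_basis, h]
    rfl
  rw [this]
  rfl

theorem map_inverse_eq {b b' : A} (hb : b * b' = 1) {φ : A →ₐ[K] Matrix (Fin N) (Fin N) K}
    {h : GL (Fin N) K} (hh : (h : Matrix (Fin N) (Fin N) K) = φ b) :
    φ b' = ((h⁻¹ : GL (Fin N) K) : Matrix (Fin N) (Fin N) K) := by
  have h1 : (h : Matrix (Fin N) (Fin N) K) * φ b' = 1 := by rw [hh, ← map_mul, hb, map_one]
  rw [← Units.inv_mul_cancel_left h (φ b'), h1, mul_one]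

theorem conjTup_mem_repVar {H : Subgroup (GL (Fin N) K)} {b : Module.Basis (Fin r) K A}
    {g : GL (Fin N) K} (hg : g ∈ H) {y} (hy : y ∈ repVar H b) : conjTup g y ∈ repVar H b := by
  obtain ⟨φ, h1, h2⟩ := hy
  refine ⟨AlgHom.ofLinearMap (conjRep K N g ∘ₗ φ.toLinearMap) ?_ fun x y => ?_, fun k => ?_,
    fun k => ?_⟩
  · change conjRep K N g (φ 1) = 1
    rw [conjRep_apply, map_one, one_mul, Units.mul_inv]
  · change conjRep K N g (φ (x * y)) = conjRep K N g (φ x) * conjRep K N g (φ y)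
    simp only [conjRep_apply, map_mul, mul_assoc, Units.inv_mul_cancel_left]
  · change conjTup g y k = conjRep K N g (φ (b k))
    rw [conjRep_apply, conjTup, h1, mul_assoc]
  · obtain ⟨h, hh, heq⟩ := h2 k
    exact ⟨g * h * g⁻¹, mul_mem (mul_mem hg hh) (inv_mem hg), by
      rw [Units.val_mul, Units.val_mul, heq, conjTup]⟩

section Equations
variable {H : Subgroup (GL (Fin N) K)} {b : Module.Basis (Fin r) K A}

theorem repMat_mul_mem_tupIdeal (x y : A) (i j : Fin N) :
    (repMat N b x * repMat N b y - repMat N b (x * y) : Matrix _ _ (TuplePoly K N r)) i j ∈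
      tupIdeal (repVar H b) := by
  refine mem_tupIdeal.mpr fun q ⟨φ, hφ, _⟩ => ?_
  have h : (repMat N b x * repMat N b y - repMat N b (x * y)).map (eval (tupSubst q)) = 0 := by
    rw [Matrix.map_sub _ (by simp), Matrix.map_mul]
    simp only [repMat_map_eval, constr_eq_of_forall hφ, map_mul, sub_self]
  exact congrFun (congrFun h i) j

theorem repMat_one_mem_tupIdeal (i j : Fin N) :
    (repMat N b 1 - 1 : Matrix _ _ (TuplePoly K N r)) i j ∈ tupIdeal (repVar H b) := by
  refine mem_tupIdeal.mpr fun q ⟨φ, hφ, _⟩ => ?_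
  have h : (repMat N b 1 - 1).map (eval (tupSubst q)) = 0 := by
    rw [Matrix.map_sub _ (by simp), repMat_map_eval, constr_eq_of_forall hφ, map_one,
      Matrix.map_one _ (map_zero _) (map_one _), sub_self]
  exact congrFun (congrFun h i) j

theorem aeval_repMat_mem_tupIdeal {b' : Fin r → A} (hb : ∀ k, b k * b' k = 1) (k : Fin r)
    {P : GLPoly K N} (hP : P ∈ vanIdeal H) :
    aeval (matSubst (tupMat K N k) (repMat N b (b' k))) P ∈ tupIdeal (repVar H b) := by
  refine mem_tupIdeal.mpr fun q ⟨φ, hφ, hH⟩ => ?_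
  obtain ⟨h, hh, heq⟩ := hH k
  rw [eval_aeval_matSubst, repMat_map_eval, tupMat_map_eval, constr_eq_of_forall hφ,
    map_inverse_eq (hb k) (heq.trans (hφ k)), ← heq]
  exact mem_vanIdeal.mp hP h hh

theorem mem_repVar_of_forall_eval_eq_zero (hH : IsZarClosed K N H) {b' : Fin r → A}
    (hb : ∀ k, b k * b' k = 1) (y : Fin r → Matrix (Fin N) (Fin N) K)
    (hy : ∀ f ∈ tupIdeal (repVar H b), eval (tupSubst y) f = 0) : y ∈ repVar H b := by
  have hmul : ∀ u v, b.constr K y (u * v) = b.constr K y u * b.constr K y v := by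
    intro u v
    have h : (repMat N b u * repMat N b v - repMat N b (u * v)).map (eval (tupSubst y)) = 0 :=
      Matrix.ext fun i j => hy _ (repMat_mul_mem_tupIdeal u v i j)
    rw [Matrix.map_sub _ (by simp), Matrix.map_mul, repMat_map_eval, repMat_map_eval,
      repMat_map_eval] at h
    exact (sub_eq_zero.mp h).symm
  have hone : b.constr K y 1 = 1 := by
    have h : (repMat N b 1 - 1).map (eval (tupSubst y)) = 0 :=
      Matrix.ext fun i j => hy _ (repMat_one_mem_tupIdeal i j)
    rw [Matrix.map_sub _ (by simp), repMat_map_eval, Matrix.map_one _ (map_zero _) (map_one _)] at h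
    exact sub_eq_zero.mp h
  refine ⟨AlgHom.ofLinearMap (b.constr K y) hone hmul, fun k => (b.constr_basis K y k).symm,
    fun k => ?_⟩
  have hright : y k * b.constr K y (b' k) = 1 := by
    rw [← hone, ← hb k, hmul, Module.Basis.constr_basis]
  let h : GL (Fin N) K := ⟨y k, b.constr K y (b' k), hright, _root_.mul_eq_one_comm.mp hright⟩
  obtain ⟨S, hS⟩ := hH
  refine ⟨h, (hS h).mpr fun P hP => ?_, rfl⟩
  have hP' : P ∈ vanIdeal H := mem_vanIdeal.mpr fun g hg => by
    rw [← glCoords_eq_glPt]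
    exact (hS g).mp hg P hP
  have h1 := hy _ (aeval_repMat_mem_tupIdeal hb k hP')
  rw [eval_aeval_matSubst, repMat_map_eval, tupMat_map_eval] at h1
  rw [glCoords_eq_glPt]
  exact h1

end Equations

theorem exists_inner_matrix [IsSemisimpleRing A] (φ : A →ₐ[K] Matrix (Fin N) (Fin N) K)
    (η : A →ₗ[K] Matrix (Fin N) (Fin N) K) (hη : ∀ a b, η (a * b) = η a * φ b + φ a * η b) :
    ∃ X, ∀ a, η a = φ a * X - X * φ a := by
  let e : Matrix (Fin N) (Fin N) K ≃ₐ[K] Module.End K (Fin N → K) := Matrix.toLinAlgEquiv'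
  obtain ⟨X, hX⟩ := exists_inner_of_isSemisimpleRing (e.toAlgHom.comp φ)
    (e.toLinearMap ∘ₗ η) fun a b => by
      change e (η (a * b)) = e (η a) * e (φ b) + e (φ a) * e (η b)
      rw [hη, map_add, map_mul, map_mul]
  refine ⟨e.symm X, fun a => e.injective ?_⟩
  rw [map_sub, map_mul, map_mul, e.apply_symm_apply]
  exact hX a

section Tangent
variable {G H : Subgroup (GL (Fin N) K)} {b : Module.Basis (Fin r) K A}
  {q v : Fin r → Matrix (Fin N) (Fin N) K}

theorem map_dirDer_map_eval_eq_zero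
    (hv : ∀ f ∈ tupIdeal (repVar H b), ∑ i, eval (tupSubst q) (pderiv i f) * tupSubst v i = 0)
    {F : Matrix (Fin N) (Fin N) (TuplePoly K N r)} (hF : ∀ i j, F i j ∈ tupIdeal (repVar H b)) :
    (F.map (dirDer v)).map (eval (tupSubst q)) = 0 :=
  Matrix.ext fun i j => (eval_dirDer v _ _).trans (hv _ (hF i j))

theorem exists_inner_of_tangent [IsSemisimpleRing A] {φ : A →ₐ[K] Matrix (Fin N) (Fin N) K}
    (hφ : ∀ k, q k = φ (b k))
    (hv : ∀ f ∈ tupIdeal (repVar H b), ∑ i, eval (tupSubst q) (pderiv i f) * tupSubst v i = 0) :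
    ∃ X, ∀ a, b.constr K v a = φ a * X - X * φ a := by
  refine exists_inner_matrix φ _ fun x y => ?_
  have h := map_dirDer_map_eval_eq_zero hv (repMat_mul_mem_tupIdeal (H := H) (b := b) x y)
  rw [Matrix.map_sub _ (map_sub _), Derivation.matrix_map_mul, Matrix.map_sub _ (map_sub _),
    Matrix.map_add _ (map_add _), Matrix.map_mul, Matrix.map_mul] at h
  simp only [repMat_map_dirDer, map_C_map_eval, repMat_map_eval, constr_eq_of_forall hφ] at h
  exact (sub_eq_zero.mp h).symm

theorem sub_conj_mem_lieAlg {b' : Fin r → A} (hb : ∀ k, b k * b' k = 1)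
    {φ : A →ₐ[K] Matrix (Fin N) (Fin N) K} (hφ : ∀ k, q k = φ (b k))
    (hv : ∀ f ∈ tupIdeal (repVar H b), ∑ i, eval (tupSubst q) (pderiv i f) * tupSubst v i = 0)
    {X : Matrix (Fin N) (Fin N) K} (hX : ∀ a, b.constr K v a = φ a * X - X * φ a)
    {k : Fin r} {h : GL (Fin N) K} (hh : h ∈ H) (hk : (h : Matrix (Fin N) (Fin N) K) = q k) :
    X - ((h⁻¹ : GL (Fin N) K) : Matrix (Fin N) (Fin N) K) * X * h ∈ lieAlg H := by
  set Z : Matrix (Fin N) (Fin N) K :=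
    X - ((h⁻¹ : GL (Fin N) K) : Matrix (Fin N) (Fin N) K) * X * h with hZ
  have hinv := map_inverse_eq (hb k) (hk.trans (hφ k))
  let θ : GLPoly K N →ₐ[K] TuplePoly K N r :=
    aeval (matSubst (tupMat K N k) (repMat N b (b' k)))
  have hθ : ∀ P, eval (tupSubst q) (θ P) = eval (glPt h) P := by
    intro P
    rw [eval_aeval_matSubst, repMat_map_eval, tupMat_map_eval, constr_eq_of_forall hφ, hinv, ← hk]
    rfl
  have hx : ((tupMat K N k).map (dirDer v)).map (eval (tupSubst q)) =
      ((xMat K N).map (invDer Z)).map (eval (glPt h)) := by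
    have h1 : tupMat K N k = repMat N b (b k) := (b.constr_basis K _ k).symm
    rw [h1, repMat_map_dirDer, map_C_map_eval, xMat_map_invDer, Matrix.map_mul, map_C_map_eval, glPt,
      xMat_map_eval, hX, ← hφ, ← hk, hZ, mul_sub, ← mul_assoc, ← mul_assoc, Units.mul_inv, one_mul]
  have hy : ((repMat N b (b' k)).map (dirDer v)).map (eval (tupSubst q)) =
      ((yMat K N).map (invDer Z)).map (eval (glPt h)) := by
    rw [repMat_map_dirDer, map_C_map_eval, yMat_map_invDer, matrix_map_neg, Matrix.map_mul,
      map_C_map_eval, glPt, yMat_map_eval, hX, hinv, hZ, sub_mul, Units.mul_inv_cancel_right,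
      neg_sub]
  have hD : ∀ P, eval (tupSubst q) (dirDer v (θ P)) = eval (glPt h) (invDer Z P) := by
    intro P
    induction P using MvPolynomial.induction_on with
    | C a =>
      rw [← MvPolynomial.algebraMap_eq, AlgHom.commutes, Derivation.map_algebraMap,
        Derivation.map_algebraMap, map_zero, map_zero]
    | add P Q hP hQ => simp only [map_add, hP, hQ]
    | mul_X P i hP =>
      have hXi : eval (tupSubst q) (dirDer v (θ (MvPolynomial.X i))) =
          eval (glPt h) (invDer Z (MvPolynomial.X i)) := by
        rw [aeval_X]
        obtain ⟨_, i | i⟩ := i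
        · exact congrFun (congrFun hx i.1) i.2
        · exact congrFun (congrFun hy i.1) i.2
      simp only [map_mul, Derivation.leibniz, smul_eq_mul, map_add, hP, hXi, hθ]
  refine mem_lieAlg.mpr fun f hf => ?_
  have h1 := hD (leftTranslate h⁻¹ f)
  rw [eval_dirDer, hv _ (aeval_repMat_mem_tupIdeal hb k
    (leftTranslate_mem_vanIdeal (inv_mem hh) hf)), ← leftTranslate_invDer, eval_leftTranslate,
    inv_mul_cancel] at h1
  exact h1.symm

/-- The orbits are infinitesimally open in the representation variety of a semisimple algebra. -/
theorem exists_mem_lieAlg_of_tangent_repVar [IsSemisimpleRing A] {b' : Fin r → A}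
    (hb : ∀ k, b k * b' k = 1) (hconj : ∀ h ∈ H, ∀ g ∈ G, h * g * h⁻¹ ∈ G)
    {u : GLPoly K N} (hu : eval (glPt 1) u ≠ 0) (hu' : ∀ h ∈ H, h ∉ G → eval (glPt h) u = 0)
    {U' : Submodule K (Matrix (Fin N) (Fin N) K)}
    (hU' : ∀ h ∈ H, ∀ A ∈ U', conjRep K N h A ∈ U') (hc : IsCompl (lieAlg G).toSubmodule U')
    (hq : q ∈ repVar H b)
    (hv : ∀ f ∈ tupIdeal (repVar H b), ∑ i, eval (tupSubst q) (pderiv i f) * tupSubst v i = 0) :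
    ∃ Z ∈ lieAlg G, ∀ k, v k = q k * Z - Z * q k := by
  obtain ⟨φ, hφ, hH⟩ := hq
  obtain ⟨X, hX⟩ := exists_inner_of_tangent hφ hv
  obtain ⟨Z, hZ, M, hM, rfl⟩ := Submodule.mem_sup.mp (hc.sup_eq_top ▸ Submodule.mem_top : X ∈ _ ⊔ _)
  refine ⟨Z, hZ, fun k => ?_⟩
  obtain ⟨h, hh, hk⟩ := hH k
  have h1 := mem_lieAlg_of_open hu hu' (sub_conj_mem_lieAlg hb hφ hv hX hh hk)
  have h2 : Z - ((h⁻¹ : GL (Fin N) K) : Matrix (Fin N) (Fin N) K) * Z * h ∈ lieAlg G := by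
    refine sub_mem hZ ?_
    have := conj_mem_lieAlg (hconj h⁻¹ (inv_mem hh)) hZ
    rwa [inv_inv] at this
  have h3 : M - ((h⁻¹ : GL (Fin N) K) : Matrix (Fin N) (Fin N) K) * M * h ∈ U' := by
    refine sub_mem hM ?_
    have := hU' h⁻¹ (inv_mem hh) M hM
    rwa [conjRep_apply, inv_inv, ← mul_assoc] at this
  have h4 : M - ((h⁻¹ : GL (Fin N) K) : Matrix (Fin N) (Fin N) K) * M * h ∈ lieAlg G := by
    have := sub_mem h1 h2
    rw [mul_add, add_mul] at this
    convert this using 1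
    abel
  have h5 : (h : Matrix (Fin N) (Fin N) K) * M = M * h := by
    have := congrArg ((h : Matrix (Fin N) (Fin N) K) * ·)
      (Submodule.disjoint_def.mp hc.disjoint _ h4 h3)
    simp only [mul_sub, mul_zero, ← mul_assoc, Units.mul_inv, one_mul] at this
    exact sub_eq_zero.mp this
  have h6 := hX (b k)
  rw [Module.Basis.constr_basis, ← hφ, mul_add, add_mul, ← hk, h5] at h6
  rw [h6, ← hk]
  abel

end Tangent
end RepresentationVariety

section GroupAlgebra
variable {K : Type} [Field K] {N : ℕ} {Γ : Type} [Group Γ]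

/-- The matrix representation of the group algebra attached to a matrix representation. -/
noncomputable def groupAlgRep (ρ : Γ →* GL (Fin N) K) :
    MonoidAlgebra K Γ →ₐ[K] Matrix (Fin N) (Fin N) K :=
  MonoidAlgebra.lift K _ Γ ((Units.coeHom _).comp ρ)

theorem groupAlgRep_of (ρ : Γ →* GL (Fin N) K) (γ : Γ) :
    groupAlgRep ρ (MonoidAlgebra.of K Γ γ) = ρ γ :=
  MonoidAlgebra.lift_of _ _

/-- The action on column vectors of the enveloping algebra of a matrix representation. -/
noncomputable def rangeGroupAlgRepToEnd (ρ : Γ →* GL (Fin N) K) :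
    (groupAlgRep ρ).range →ₐ[K] Module.End K (Fin N → K) :=
  (Matrix.toLinAlgEquiv' : Matrix (Fin N) (Fin N) K ≃ₐ[K] _).toAlgHom.comp (groupAlgRep ρ).range.val

theorem rangeGroupAlgRepToEnd_apply (ρ : Γ →* GL (Fin N) K) (x : (groupAlgRep ρ).range)
    (w : Fin N → K) :
    rangeGroupAlgRepToEnd ρ x w = (x : Matrix (Fin N) (Fin N) K) *ᵥ w := rfl

theorem rangeGroupAlgRepToEnd_injective (ρ : Γ →* GL (Fin N) K) :
    Function.Injective (rangeGroupAlgRepToEnd ρ) :=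
  (Matrix.toLinAlgEquiv' : Matrix (Fin N) (Fin N) K ≃ₐ[K] _).injective.comp Subtype.val_injective

theorem isSemisimpleRing_range_groupAlgRep (ρ : Γ →* GL (Fin N) K)
    (hρ : NatSemisimpleOn K N (Set.range ρ)) : IsSemisimpleRing (groupAlgRep ρ).range := by
  refine isSemisimpleRing_of_faithful (rangeGroupAlgRepToEnd ρ)
    (rangeGroupAlgRepToEnd_injective ρ) fun U hU => ?_
  obtain ⟨U', h1, h2⟩ := hρ U (by
    rintro _ ⟨γ, rfl⟩ w hw
    rw [← groupAlgRep_of]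
    exact hU ⟨_, _, rfl⟩ w hw)
  refine ⟨U', ?_, h2⟩
  rintro ⟨_, x, rfl⟩ w hw
  rw [rangeGroupAlgRepToEnd_apply]
  change groupAlgRep ρ x *ᵥ w ∈ U'
  induction x using MonoidAlgebra.induction_on with
  | of γ =>
    rw [groupAlgRep_of]
    exact h1 _ ⟨γ, rfl⟩ w hw
  | add x y hx hy =>
    rw [map_add, add_mulVec]
    exact add_mem hx hy
  | smul c x hx =>
    rw [map_smul, smul_mulVec]
    exact U'.smul_mem c hx

theorem trace_groupAlgRep_eq {ρ ρ' : Γ →* GL (Fin N) K}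
    (h : ∀ γ, trace (ρ γ : Matrix (Fin N) (Fin N) K) = trace (ρ' γ : Matrix (Fin N) (Fin N) K))
    (x : MonoidAlgebra K Γ) : trace (groupAlgRep ρ x) = trace (groupAlgRep ρ' x) := by
  induction x using MonoidAlgebra.induction_on with
  | of γ => rw [groupAlgRep_of, groupAlgRep_of, h]
  | add x y hx hy => rw [map_add, map_add, trace_add, trace_add, hx, hy]
  | smul c x hx => rw [map_smul, map_smul, trace_smul, trace_smul, hx]

/-- A semisimple representation with the same character as another representation factors through
the enveloping algebra of the latter. -/
theorem exists_algHom_of_trace_eq [CharZero K] {ρ ρ' : Γ →* GL (Fin N) K}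
    (hρ' : NatSemisimpleOn K N (Set.range ρ'))
    (h : ∀ γ, trace (ρ γ : Matrix (Fin N) (Fin N) K) = trace (ρ' γ : Matrix (Fin N) (Fin N) K)) :
    ∃ φ : (groupAlgRep ρ).range →ₐ[K] Matrix (Fin N) (Fin N) K,
      ∀ x, φ ((groupAlgRep ρ).rangeRestrict x) = groupAlgRep ρ' x := by
  have _ := isSemisimpleRing_range_groupAlgRep ρ' hρ'
  refine exists_algHom_of_ker_le _ (AlgHom.rangeRestrict_surjective _) _ fun x hx => ?_
  have hx' : groupAlgRep ρ x = 0 := congrArg Subtype.val hx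
  have h0 := eq_zero_of_trace_mul_eq_zero (rangeGroupAlgRepToEnd ρ')
    (rangeGroupAlgRepToEnd_injective ρ') ((groupAlgRep ρ').rangeRestrict x) (by
      rintro ⟨_, y, rfl⟩
      change LinearMap.trace K _ (Matrix.toLin' (groupAlgRep ρ' y * groupAlgRep ρ' x)) = 0
      rw [Matrix.trace_toLin'_eq, ← map_mul, ← trace_groupAlgRep_eq h, map_mul, hx', mul_zero,
        trace_zero])
  exact congrArg Subtype.val h0

theorem exists_basis_range_groupAlgRep (ρ : Γ →* GL (Fin N) K) :
    ∃ (r : ℕ) (a : Fin r → Γ) (b : Module.Basis (Fin r) K (groupAlgRep ρ).range),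
      ∀ k, b k = (groupAlgRep ρ).rangeRestrict (MonoidAlgebra.of K Γ (a k)) := by
  let s := Set.range fun γ => (groupAlgRep ρ).rangeRestrict (MonoidAlgebra.of K Γ γ)
  have hs : Submodule.span K s = ⊤ := by
    refine eq_top_iff.mpr fun x _ => ?_
    obtain ⟨x, rfl⟩ := AlgHom.rangeRestrict_surjective _ x
    induction x using MonoidAlgebra.induction_on with
    | of γ => exact Submodule.subset_span ⟨γ, rfl⟩
    | add x y hx hy =>
      rw [map_add]
      exact add_mem (hx trivial) (hy trivial)
    | smul c x hx =>
      rw [map_smul]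
      exact Submodule.smul_mem _ c (hx trivial)
  obtain ⟨f, hf, hspan, hli⟩ := Submodule.exists_fun_fin_finrank_span_eq K s
  choose a ha using hf
  exact ⟨_, a, Module.Basis.mk hli (hspan.trans hs).ge, fun k => by
    rw [Module.Basis.mk_apply, ← ha]⟩

end GroupAlgebra

theorem stmt_16 (K : Type) [Field K] [CharZero K] [IsAlgClosed K] (N : ℕ)
    (Γ : Type) [Group Γ]
    (H : Subgroup (Matrix.GeneralLinearGroup (Fin N) K))
    (hHcl : IsZarClosed K N H) (hHred : NatSemisimpleOn K N (H : Set _))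
    (σ σ' : Γ →* H)
    (hσ : NatSemisimpleOn K N
      (Set.range fun γ => (σ γ : Matrix.GeneralLinearGroup (Fin N) K)))
    (hσ' : NatSemisimpleOn K N
      (Set.range fun γ => (σ' γ : Matrix.GeneralLinearGroup (Fin N) K)))
    (hinv : ∀ (n : ℕ) (f : (Fin n → H) → K), IsRegularOnPow K N H f →
      (∀ h ∈ identityComponent K N H, ∀ g : Fin n → H,
        f (fun i => h * g i * h⁻¹) = f g) →
      ∀ γ : Fin n → Γ, f (fun i => σ (γ i)) = f (fun i => σ' (γ i))) :
    ∃ h ∈ identityComponent K N H, ∀ γ : Γ, σ' γ = h * σ γ * h⁻¹ := by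
  obtain ⟨G, hGH, hcomp, hconj, hfin, hG, hGcl, u, hu, hu'⟩ :=
    exists_identityComponent_subgroup H hHcl
  obtain ⟨hred, hz⟩ := isReductiveAlg_lieAlg hG (natSemisimpleOn_of_normal hGH hconj hHred)
  obtain ⟨U', hU', hc⟩ := exists_isCompl_lieAlg hfin hconj hG hred hz hGH
  let ρ : Γ →* GL (Fin N) K := H.subtype.comp σ
  let ρ' : Γ →* GL (Fin N) K := H.subtype.comp σ'
  have htr : ∀ γ, trace (ρ γ : Matrix (Fin N) (Fin N) K) =
      trace (ρ' γ : Matrix (Fin N) (Fin N) K) := by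
    refine fun γ => hinv 1 (fun g => trace ((g 0 : GL (Fin N) K) : Matrix (Fin N) (Fin N) K))
      ⟨∑ i, MvPolynomial.X (0, Sum.inl (i, i)), fun g => ?_⟩ (fun h _ g => ?_) fun _ => γ
    · simp [glCoords, trace]
    · simp only [Subgroup.coe_mul, Subgroup.coe_inv, Units.val_mul]
      rw [trace_mul_comm, ← mul_assoc, Units.inv_mul, one_mul]
  obtain ⟨φ, hφ⟩ := exists_algHom_of_trace_eq hσ' htr
  have _ := isSemisimpleRing_range_groupAlgRep ρ hσ
  obtain ⟨r, a, b, hb⟩ := exists_basis_range_groupAlgRep ρ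
  let p : Fin r → Matrix (Fin N) (Fin N) K := fun k => ρ (a k)
  let q : Fin r → Matrix (Fin N) (Fin N) K := fun k => ρ' (a k)
  have hp : p ∈ repVar H b := ⟨(groupAlgRep ρ).range.val, fun k => by
    rw [hb]
    exact (groupAlgRep_of ρ _).symm, fun k => ⟨ρ (a k), (σ (a k)).2, rfl⟩⟩
  have hφq : ∀ k, q k = φ (b k) := fun k => by
    rw [hb, hφ, groupAlgRep_of]
  have hq : q ∈ repVar H b := ⟨φ, hφq, fun k => ⟨ρ' (a k), (σ' (a k)).2, rfl⟩⟩
  have hbb : ∀ k, b k * (groupAlgRep ρ).rangeRestrict (MonoidAlgebra.of K Γ (a k)⁻¹) = 1 := by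
    intro k
    rw [hb, ← map_mul, ← map_mul, mul_inv_cancel, map_one, map_one]
  have hO : ∀ g ∈ G, ∀ y ∈ repVar H b, conjTup g y ∈ repVar H b :=
    fun g hg y hy => conjTup_mem_repVar (hGH hg) hy
  obtain ⟨g, hg, hgpq⟩ : ∃ g ∈ G, q = conjTup g p := by
    by_contra! hne
    obtain ⟨f, hf, hfpq⟩ := exists_invariant_of_orbits_open hG hred hz hO
      (mem_repVar_of_forall_eval_eq_zero hHcl hbb)
      (fun q hq => exists_orbit_open hG hGcl hO
        (fun q hq v hv => exists_mem_lieAlg_of_tangent_repVar hbb hconj hu hu' hU' hc hq hv) hq)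
      hp hq hne
    refine hfpq (hinv r
      (fun g => eval (tupSubst fun k => ((g k : GL (Fin N) K) : Matrix (Fin N) (Fin N) K)) f)
      ⟨rename (fun p => (p.1, Sum.inl p.2)) f, fun g => ?_⟩ (fun h hh g => ?_) a)
    · rw [eval_rename]
      rfl
    · have h1 := eval_conjAct_eq (h : GL (Fin N) K)⁻¹
        (fun k => ((g k : GL (Fin N) K) : Matrix (Fin N) (Fin N) K)) f
      rw [hf _ (inv_mem ((hcomp h).mp hh)), inv_inv] at h1
      exact h1.symm
  refine ⟨⟨g, hGH hg⟩, (hcomp _).mpr hg, fun γ => Subtype.ext (Units.ext ?_)⟩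
  have key : φ.toLinearMap = (conjRep K N g) ∘ₗ (groupAlgRep ρ).range.val.toLinearMap :=
    b.ext fun k => by
      change φ (b k) = conjRep K N g (b k : Matrix (Fin N) (Fin N) K)
      rw [← hφq, hgpq, conjTup, conjRep_apply, ← mul_assoc, hb]
      congr 2
      exact (groupAlgRep_of ρ _).symm
  have h1 := LinearMap.congr_fun key ((groupAlgRep ρ).rangeRestrict (MonoidAlgebra.of K Γ γ))
  change φ _ = conjRep K N g (groupAlgRep ρ (MonoidAlgebra.of K Γ γ)) at h1
  rw [hφ, groupAlgRep_of, groupAlgRep_of, conjRep_apply, ← mul_assoc] at h1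
  exact h1
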